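/- Fix a real constant C > 0 and an integer n ≥ 3. There are only finitely many subfields K of ℝ that are totally real number fields admitting a finite family S_1, …, S_k of O_K-lattices of rank n with k < C such that for every O_K-lattice L, L is n-universal if and only if L represents each S_i (i.e., the family {S_1, …, S_k} is an n-universal criterion set for O_K). -/

import Mathlib

open scoped TensorProduct

noncomputable section

open NumberField

structure OKLattice (K : Type) [Field K] : Type 1 where
  carrier : Type
  [addCommGroup : AddCommGroup carrier]
  [module : Module (𝓞 K) carrier]
  [finite : Module.Finite (𝓞 K) carrier]
  [torsionFree : NoZeroSMulDivisors (𝓞 K) carrier]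
  form : carrier →ₗ[𝓞 K] carrier →ₗ[𝓞 K] 𝓞 K
  symm : ∀ x y, form x y = form y x
  posDef : ∀ v : carrier, v ≠ 0 → ∀ σ : K →+* ℝ, 0 < σ (algebraMap (𝓞 K) K (form v v))

attribute [instance] OKLattice.addCommGroup OKLattice.module OKLattice.finite
  OKLattice.torsionFree

namespace OKLattice

variable {K : Type} [Field K]

/-- The rank of an `O_K`-lattice: the `K`-dimension of `L ⊗ K`. -/
def rank (L : OKLattice K) : ℕ :=
  Module.finrank K (K ⊗[𝓞 K] L.carrier)

/-- `L.Represents L'` : `L'` is represented by `L`. -/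
def Represents (L L' : OKLattice K) : Prop :=
  ∃ σ : L'.carrier →ₗ[𝓞 K] L.carrier, ∀ x, L.form (σ x) (σ x) = L'.form x x

/-- `L` is `n`-universal. -/
def IsUniversal (L : OKLattice K) (n : ℕ) : Prop :=
  ∀ L' : OKLattice K, L'.rank = n → L.Represents L'

end OKLattice

/-- `U_K(n)`: the minimal rank of an `n`-universal `O_K`-lattice. -/
def minUnivRank (K : Type) [Field K] (n : ℕ) : ℕ :=
  sInf {m | ∃ L : OKLattice K, L.IsUniversal n ∧ L.rank = m}

/-- `K` is totally real: every embedding into `ℂ` has image contained in `ℝ`. -/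
def TotallyReal (K : Type) [Field K] : Prop :=
  ∀ φ : K →+* ℂ, ∀ x : K, (φ x).im = 0

namespace TotallyReal
variable {K : Type} [Field K]

/-- The real embedding underlying a complex embedding of a totally real field. -/
def realEmb (h : TotallyReal K) (φ : K →+* ℂ) : K →+* ℝ where
  toFun x := (φ x).re
  map_one' := by simp
  map_zero' := by simp
  map_add' x y := by simp
  map_mul' x y := by simp [h φ x]

def embEquiv (h : TotallyReal K) : (K →+* ℂ) ≃ (K →+* ℝ) where
  toFun := h.realEmb
  invFun σ := Complex.ofRealHom.comp σ
  left_inv φ := by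
    ext x
    apply Complex.ext <;> simp [realEmb, h φ x]
  right_inv σ := by ext x; simp [realEmb]

lemma embEquiv_coe (h : TotallyReal K) (φ : K →+* ℂ) (x : K) : ((h.embEquiv φ x : ℝ) : ℂ) = φ x := by
  apply Complex.ext <;> simp [embEquiv, realEmb, h φ x]

end TotallyReal

instance instFiniteRealEmb {K : Type} [Field K] [NumberField K] : Finite (K →+* ℝ) :=
  Finite.of_injective (fun σ => Complex.ofRealHom.comp σ : (K →+* ℝ) → (K →+* ℂ)) (by
    intro σ τ h
    ext x
    have := RingHom.congr_fun h x
    simpa using this)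

instance instFintypeRealEmb {K : Type} [Field K] [NumberField K] : Fintype (K →+* ℝ) :=
  Fintype.ofFinite _

namespace TotallyReal
variable {K : Type} [Field K] [NumberField K]

lemma card_emb (h : TotallyReal K) : Fintype.card (K →+* ℝ) = Module.finrank ℚ K := by
  rw [← Fintype.card_congr h.embEquiv, NumberField.Embeddings.card]

lemma trace_eq (h : TotallyReal K) (x : K) : ((Algebra.trace ℚ K x : ℚ) : ℝ) = ∑ σ : K →+* ℝ, σ x := by
  have h1 := trace_eq_sum_embeddings (K := ℚ) (L := K) ℂ (x := x)
  have h2 : (algebraMap ℚ ℂ (Algebra.trace ℚ K x)) = ((∑ σ : K →+* ℝ, σ x : ℝ) : ℂ) := by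
    rw [h1, ← Equiv.sum_comp h.embEquiv, Complex.ofReal_sum,
      ← Equiv.sum_comp (RingHom.equivRatAlgHom (R := K) (S := ℂ)).symm]
    refine Finset.sum_congr rfl fun φ _ => ?_
    rw [embEquiv_coe]; rfl
  have h3 : (algebraMap ℚ ℂ (Algebra.trace ℚ K x)) = (((Algebra.trace ℚ K x : ℚ) : ℝ) : ℂ) := by simp
  exact_mod_cast h3.symm.trans h2

lemma norm_eq (h : TotallyReal K) (x : K) : ((Algebra.norm ℚ x : ℚ) : ℝ) = ∏ σ : K →+* ℝ, σ x := by
  have h1 := Algebra.norm_eq_prod_embeddings ℚ ℂ x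
  have h2 : (algebraMap ℚ ℂ (Algebra.norm ℚ x)) = ((∏ σ : K →+* ℝ, σ x : ℝ) : ℂ) := by
    rw [h1, ← Equiv.prod_comp h.embEquiv, Complex.ofReal_prod,
      ← Equiv.prod_comp (RingHom.equivRatAlgHom (R := K) (S := ℂ)).symm]
    refine Finset.prod_congr rfl fun φ _ => ?_
    rw [embEquiv_coe]; rfl
  have h3 : (algebraMap ℚ ℂ (Algebra.norm ℚ x)) = (((Algebra.norm ℚ x : ℚ) : ℝ) : ℂ) := by simp
  exact_mod_cast h3.symm.trans h2

lemma nonempty_emb (h : TotallyReal K) : Nonempty (K →+* ℝ) := by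
  rw [← Fintype.card_pos_iff, h.card_emb]
  exact Module.finrank_pos

/-- The size of `𝓞 K ⧸ (x)`, as a product over embeddings. -/
lemma absNorm_span (h : TotallyReal K) (x : 𝓞 K) :
    ((Ideal.absNorm (Ideal.span {x}) : ℕ) : ℝ) = ∏ σ : K →+* ℝ, |σ x| := by
  rw [Ideal.absNorm_span_singleton, ← Finset.abs_prod, ← h.norm_eq, ← Algebra.coe_norm_int,
    Nat.cast_natAbs]
  simp

end TotallyReal

namespace OKLattice
variable {K : Type} [Field K]

/-- Every functional on `T` is represented by a vector of `T`. -/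
def IsUnimodular (T : OKLattice K) : Prop :=
  ∀ f : T.carrier →ₗ[𝓞 K] 𝓞 K, ∃ t, ∀ x, f x = T.form t x

/-- `T` and `U` are isometric. -/
def Isometric (T U : OKLattice K) : Prop :=
  ∃ e : T.carrier ≃ₗ[𝓞 K] U.carrier, ∀ x y, U.form (e x) (e y) = T.form x y

/-- `x` is not a nontrivial orthogonal sum. -/
def Irred (L : OKLattice K) (x : L.carrier) : Prop :=
  ∀ y z, x = y + z → L.form y z = 0 → y = 0 ∨ z = 0

variable [NumberField K]

lemma form_self_ne_zero (h : TotallyReal K) (L : OKLattice K) {x : L.carrier} (hx : x ≠ 0) :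
    L.form x x ≠ 0 := by
  obtain ⟨σ⟩ := h.nonempty_emb
  intro h0
  have := L.posDef x hx σ
  simp [h0] at this

lemma trace_form_pos (h : TotallyReal K) (L : OKLattice K) {x : L.carrier} (hx : x ≠ 0) :
    0 < Algebra.trace ℤ (𝓞 K) (L.form x x) := by
  have h1 : (0 : ℝ) < ((Algebra.trace ℚ K (L.form x x : K) : ℚ) : ℝ) := by
    rw [h.trace_eq]
    haveI := h.nonempty_emb
    exact Finset.sum_pos (fun σ _ => L.posDef x hx σ) Finset.univ_nonempty
  rw [← Algebra.coe_trace_int] at h1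
  exact_mod_cast h1

lemma mem_span_irred (h : TotallyReal K) (L : OKLattice K) (x : L.carrier) :
    x ∈ Submodule.span (𝓞 K) {y | L.Irred y} := by
  suffices H : ∀ (m : ℕ) (x : L.carrier), Algebra.trace ℤ (𝓞 K) (L.form x x) ≤ m →
      x ∈ Submodule.span (𝓞 K) {y | L.Irred y} from
    H _ x (Int.self_le_toNat _)
  intro m
  induction m with
  | zero =>
    intro x hx
    by_cases h0 : x = 0
    · rw [h0]; exact zero_mem _
    · have := trace_form_pos h L h0
      push_cast at hx
      omega
  | succ m ih =>
    intro x hx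
    by_cases hi : L.Irred x
    · exact Submodule.subset_span hi
    · simp only [Irred, not_forall, not_or] at hi
      obtain ⟨y, z, rfl, hyz, hy, hz⟩ := hi
      have e : L.form (y + z) (y + z) = L.form y y + L.form z z := by
        simp [L.symm z y, hyz]
      rw [e, map_add] at hx
      have h1 := trace_form_pos h L hy
      have h2 := trace_form_pos h L hz
      push_cast at hx
      exact add_mem (ih y (by omega)) (ih z (by omega))

lemma form_map {T L : OKLattice K} {σ : T.carrier →ₗ[𝓞 K] L.carrier}
    (hσ : ∀ x, L.form (σ x) (σ x) = T.form x x) (x y : T.carrier) :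
    L.form (σ x) (σ y) = T.form x y := by
  have h1 := hσ (x + y)
  simp only [map_add, LinearMap.add_apply, hσ, L.symm (σ y) (σ x), T.symm y x] at h1
  have : (2 : 𝓞 K) * L.form (σ x) (σ y) = 2 * T.form x y := by linear_combination h1
  exact mul_left_cancel₀ two_ne_zero this

lemma map_injective (h : TotallyReal K) {T L : OKLattice K} {σ : T.carrier →ₗ[𝓞 K] L.carrier}
    (hσ : ∀ x, L.form (σ x) (σ x) = T.form x x) : Function.Injective σ := by
  rw [injective_iff_map_eq_zero]
  intro x hx
  by_contra h0
  apply form_self_ne_zero h T h0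
  rw [← hσ, hx]; simp

lemma exists_proj {T L : OKLattice K} (hT : T.IsUnimodular) {σ : T.carrier →ₗ[𝓞 K] L.carrier}
    (hσ : ∀ x, L.form (σ x) (σ x) = T.form x x) (x : L.carrier) :
    ∃ t, ∀ u, L.form (x - σ t) (σ u) = 0 := by
  obtain ⟨t, ht⟩ := hT ((L.form x).comp σ)
  refine ⟨t, fun u => ?_⟩
  have := ht u
  simp only [LinearMap.comp_apply] at this
  simp [this, form_map hσ]

/-- Unimodular sublattices of `L` up to isometry are determined by a code of at most
`finrank L` bits. -/
theorem exists_code (h : TotallyReal K) (L : OKLattice K) :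
    ∃ (Γ : Type) (_ : Fintype Γ) (code : {T : OKLattice K // T.IsUnimodular ∧ L.Represents T} → Γ),
      Fintype.card Γ ≤ 2 ^ Module.finrank (𝓞 K) L.carrier ∧
      ∀ T U, code T = code U → Isometric T.1 U.1 := by
  classical
  obtain ⟨s, hs, hmax⟩ := exists_maximal_linearIndepOn (𝓞 K) (fun x : {x // L.Irred x} => x.1)
  haveI : Finite s := hs.linearIndependent.finite
  haveI := Fintype.ofFinite s
  choose σ hσ using fun T : {T : OKLattice K // T.IsUnimodular ∧ L.Represents T} => T.2.2
  have key : ∀ T x, L.Irred x → x ∈ LinearMap.range (σ T) ∨ ∀ u, L.form x (σ T u) = 0 := by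
    intro T x hx
    obtain ⟨t, ht⟩ := exists_proj T.2.1 (hσ T) x
    rcases hx (σ T t) (x - σ T t) (by abel) (by rw [L.symm, ht]) with h0 | h0
    · right; simpa [h0] using ht
    · left; exact ⟨t, (sub_eq_zero.mp h0).symm⟩
  have hrange : ∀ T y, y ∈ LinearMap.range (σ T) ↔
      ∀ x : s, x.1.1 ∉ LinearMap.range (σ T) → L.form y x.1.1 = 0 := by
    intro T y
    constructor
    · rintro ⟨t, rfl⟩ x hx
      rcases key T x.1.1 x.1.2 with h1 | h1
      · exact absurd h1 hx
      · rw [L.symm, h1]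
    · intro hy
      obtain ⟨t, ht⟩ := exists_proj T.2.1 (hσ T) y
      set q := y - σ T t with hq
      have h1 : ∀ x : s, L.form q x.1.1 = 0 := by
        intro x
        by_cases hx : x.1.1 ∈ LinearMap.range (σ T)
        · obtain ⟨u, hu⟩ := hx
          rw [← hu, ht]
        · rcases key T x.1.1 x.1.2 with h2 | h2
          · exact absurd h2 hx
          · rw [hq, map_sub, LinearMap.sub_apply, hy x hx, L.symm, h2, sub_zero]
      have h2 : ∀ x, L.Irred x → L.form q x = 0 := by
        intro x hx
        by_cases hxs : (⟨x, hx⟩ : {x // L.Irred x}) ∈ s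
        · exact h1 ⟨_, hxs⟩
        · obtain ⟨a, ha, hsp⟩ := hmax ⟨x, hx⟩ hxs
          have h3 : Submodule.span (𝓞 K) ((fun x : {x // L.Irred x} => x.1) '' s) ≤
              LinearMap.ker (L.form q) := by
            rw [Submodule.span_le]
            rintro _ ⟨z, hz, rfl⟩
            exact h1 ⟨z, hz⟩
          have h4 := h3 hsp
          rw [LinearMap.mem_ker, map_smul, smul_eq_mul] at h4
          exact (mul_eq_zero.mp h4).resolve_left ha
      have h3 : Submodule.span (𝓞 K) {y | L.Irred y} ≤ LinearMap.ker (L.form q) :=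
        Submodule.span_le.mpr h2
      have h4 : L.form q q = 0 := h3 (mem_span_irred h L q)
      have h5 : q = 0 := by
        by_contra h0
        exact form_self_ne_zero h L h0 h4
      exact ⟨t, (sub_eq_zero.mp h5).symm⟩
  refine ⟨Finset s, inferInstance,
    fun T => Finset.univ.filter fun x : s => x.1.1 ∈ LinearMap.range (σ T), ?_, ?_⟩
  · rw [Fintype.card_finset]
    exact Nat.pow_le_pow_right two_pos hs.linearIndependent.fintype_card_le_finrank
  · intro T U hTU
    have hTU' : ∀ x : s, x.1.1 ∈ LinearMap.range (σ T) ↔ x.1.1 ∈ LinearMap.range (σ U) := by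
      intro x
      have := Finset.ext_iff.mp hTU x
      simpa using this
    have hr : LinearMap.range (σ T) = LinearMap.range (σ U) := by
      ext y
      rw [hrange T, hrange U]
      simp only [hTU']
    let eT := LinearEquiv.ofInjective (σ T) (map_injective h (hσ T))
    let eU := LinearEquiv.ofInjective (σ U) (map_injective h (hσ U))
    let e := (eT.trans (LinearEquiv.ofEq _ _ hr)).trans eU.symm
    have he : ∀ x, σ U (e x) = σ T x := by
      intro x
      have : (eU (e x) : L.carrier) = eT x := by simp [e]
      simpa [eU, eT] using this
    refine ⟨e, fun x y => ?_⟩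
    rw [← form_map (hσ U), he, he, form_map (hσ T)]

end OKLattice

namespace OKLattice
variable {K : Type} [Field K]

/-- The form of an orthogonal sum. -/
def piForm {ι : Type} [Fintype ι] (S : ι → OKLattice K) :
    (∀ i, (S i).carrier) →ₗ[𝓞 K] (∀ i, (S i).carrier) →ₗ[𝓞 K] 𝓞 K :=
  ∑ i, (S i).form.compl₁₂ (LinearMap.proj i) (LinearMap.proj i)

lemma piForm_apply {ι : Type} [Fintype ι] (S : ι → OKLattice K) (x y : ∀ i, (S i).carrier) :
    piForm S x y = ∑ i, (S i).form (x i) (y i) := by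
  simp [piForm, LinearMap.sum_apply]

/-- The orthogonal sum of a finite family of lattices. -/
def pi {ι : Type} [Fintype ι] (S : ι → OKLattice K) : OKLattice K where
  carrier := ∀ i, (S i).carrier
  finite := Module.Finite.pi
  torsionFree := ⟨fun {c x} hcx => by
    by_cases hc : c = 0
    · exact Or.inl hc
    · right
      ext i
      exact ((smul_eq_zero (M := (S i).carrier)).mp (congr_fun hcx i)).resolve_left hc⟩
  form := piForm S
  symm x y := by
    simp only [piForm_apply]
    exact Finset.sum_congr rfl fun i _ => (S i).symm _ _
  posDef v hv σ := by
    simp only [piForm_apply, map_sum]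
    obtain ⟨i, hi⟩ := Function.ne_iff.mp hv
    refine Finset.sum_pos' (fun j _ => ?_) ⟨i, Finset.mem_univ _, (S i).posDef _ hi σ⟩
    by_cases hj : v j = 0
    · simp [hj]
    · exact ((S j).posDef _ hj σ).le

lemma piForm_single {ι : Type} [Fintype ι] [DecidableEq ι] (S : ι → OKLattice K) (i : ι)
    (x : (S i).carrier) :
    piForm S (LinearMap.single (𝓞 K) (fun i => (S i).carrier) i x)
      (LinearMap.single (𝓞 K) (fun i => (S i).carrier) i x) = (S i).form x x := by
  rw [piForm_apply, Finset.sum_eq_single i]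
  · simp
  · intro j _ hj; simp [Pi.single_eq_of_ne hj]
  · simp

lemma represents_pi {ι : Type} [Fintype ι] (S : ι → OKLattice K) (i : ι) :
    (pi S).Represents (S i) := by
  classical
  exact ⟨LinearMap.single (𝓞 K) (fun i => (S i).carrier) i, piForm_single S i⟩

lemma rank_pi {ι : Type} [Fintype ι] (S : ι → OKLattice K) :
    (pi S).rank = ∑ i, (S i).rank := by
  classical
  have e := TensorProduct.piRight (𝓞 K) K K (fun i => (S i).carrier)
  have := e.finrank_eq
  rw [Module.finrank_pi_fintype] at this
  exact this

/-- The lattice `⟨1⟩`. -/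
def one (K : Type) [Field K] : OKLattice K where
  carrier := 𝓞 K
  form := LinearMap.mul (𝓞 K) (𝓞 K)
  symm x y := mul_comm _ _
  posDef v hv σ := by
    simp only [LinearMap.mul_apply', map_mul]
    have : σ (algebraMap (𝓞 K) K v) ≠ 0 := by simpa using hv
    exact mul_self_pos.mpr this

lemma rank_one : (one K).rank = 1 := by
  have := (TensorProduct.AlgebraTensorModule.rid (𝓞 K) K K).finrank_eq
  rw [Module.finrank_self] at this
  exact this

lemma Represents.trans {L M N : OKLattice K} (h : L.Represents M) (h' : M.Represents N) :
    L.Represents N := by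
  obtain ⟨σ, hσ⟩ := h
  obtain ⟨τ, hτ⟩ := h'
  exact ⟨σ.comp τ, fun x => by simp [hσ, hτ]⟩

lemma IsUniversal.represents {L : OKLattice K} {n : ℕ} (hL : L.IsUniversal n) (T : OKLattice K)
    (hT : T.rank ≤ n) : L.Represents T := by
  let S : Option (Fin (n - T.rank)) → OKLattice K := fun o => o.elim T fun _ => one K
  have hS : (pi S).rank = n := by
    rw [rank_pi, Fintype.sum_option]
    simp only [S, Option.elim, rank_one]
    simp
    omega
  exact (hL _ hS).trans (represents_pi S none)

lemma rank_eq_finrank (L : OKLattice K) : L.rank = Module.finrank (𝓞 K) L.carrier := by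
  unfold rank
  exact IsBaseChange.finrank_eq (TensorProduct.isBaseChange (𝓞 K) L.carrier K)

/-- A lattice of small rank representing every unimodular lattice of rank at most `n`. -/
lemma exists_universal {n k : ℕ} (S : Fin k → OKLattice K) (hr : ∀ i, (S i).rank = n)
    (hS : ∀ L : OKLattice K, L.IsUniversal n ↔ ∀ i, L.Represents (S i)) :
    ∃ L : OKLattice K, Module.finrank (𝓞 K) L.carrier = k * n ∧
      ∀ T : OKLattice K, T.rank ≤ n → L.Represents T := by
  refine ⟨pi S, ?_, ((hS _).mpr (represents_pi S)).represents⟩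
  rw [← rank_eq_finrank, rank_pi]
  simp [hr]

end OKLattice

namespace OKLattice
variable {K : Type} [Field K]
variable {V : Type} [AddCommGroup V] [Module K V] [Module (𝓞 K) V] [IsScalarTower (𝓞 K) K V]

section restrict

variable (B : V →ₗ[K] V →ₗ[K] K) (T : Submodule (𝓞 K) V)
  (hInt : ∀ x ∈ T, ∀ y ∈ T, ∃ c : 𝓞 K, algebraMap (𝓞 K) K c = B x y)

/-- The restriction of a bilinear form to a submodule on which it is integral. -/
def restrictForm : T →ₗ[𝓞 K] T →ₗ[𝓞 K] 𝓞 K :=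
  LinearMap.mk₂ (𝓞 K) (fun x y => (hInt x x.2 y y.2).choose)
    (fun x y z => RingOfIntegers.coe_injective <| by
      have h1 := (hInt _ (x + y).2 z z.2).choose_spec
      have h2 := (hInt x x.2 z z.2).choose_spec
      have h3 := (hInt y y.2 z z.2).choose_spec
      simp only [map_add]
      rw [h1, h2, h3]; simp)
    (fun c x z => RingOfIntegers.coe_injective <| by
      have h1 := (hInt _ (c • x).2 z z.2).choose_spec
      have h2 := (hInt x x.2 z z.2).choose_spec
      simp only [smul_eq_mul, map_mul]
      rw [h1, h2]
      rw [Submodule.coe_smul, ← algebraMap_smul K c (x : V)]; simp [Algebra.smul_def])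
    (fun x y z => RingOfIntegers.coe_injective <| by
      have h1 := (hInt x x.2 _ (y + z).2).choose_spec
      have h2 := (hInt x x.2 y y.2).choose_spec
      have h3 := (hInt x x.2 z z.2).choose_spec
      simp only [map_add]
      rw [h1, h2, h3]; simp)
    (fun c x z => RingOfIntegers.coe_injective <| by
      have h1 := (hInt x x.2 _ (c • z).2).choose_spec
      have h2 := (hInt x x.2 z z.2).choose_spec
      simp only [smul_eq_mul, map_mul]
      rw [h1, h2]
      rw [Submodule.coe_smul, ← algebraMap_smul K c (z : V)]; simp [Algebra.smul_def])

lemma coe_restrictForm (x y : T) : algebraMap (𝓞 K) K (restrictForm B T hInt x y) = B x y :=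
  (hInt x x.2 y y.2).choose_spec

end restrict

/-- The lattice given by a finitely generated submodule of a quadratic space. -/
def ofSubmodule (B : V →ₗ[K] V →ₗ[K] K) (hsymm : ∀ x y, B x y = B y x)
    (hpos : ∀ v, v ≠ 0 → ∀ σ : K →+* ℝ, 0 < σ (B v v)) (T : Submodule (𝓞 K) V) (hfg : T.FG)
    (hInt : ∀ x ∈ T, ∀ y ∈ T, ∃ c : 𝓞 K, algebraMap (𝓞 K) K c = B x y) : OKLattice K where
  carrier := T
  finite := Module.Finite.iff_fg.mpr hfg
  torsionFree := ⟨fun {c x} hcx => by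
    have h1 : (algebraMap (𝓞 K) K c) • (x : V) = 0 := by
      rw [← Submodule.coe_zero (p := T), ← hcx, Submodule.coe_smul, ← algebraMap_smul K c (x : V)]
    rcases smul_eq_zero.mp h1 with h | h
    · left; exact RingOfIntegers.coe_injective (by simpa using h)
    · right; exact Subtype.ext h⟩
  form := restrictForm B T hInt
  symm x y := RingOfIntegers.coe_injective <| by
    rw [coe_restrictForm, coe_restrictForm, hsymm]
  posDef v hv σ := by
    rw [coe_restrictForm]
    exact hpos _ (fun h => hv (Subtype.ext h)) σ

variable (B : V →ₗ[K] V →ₗ[K] K) (hsymm : ∀ x y, B x y = B y x)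
    (hpos : ∀ v, v ≠ 0 → ∀ σ : K →+* ℝ, 0 < σ (B v v)) (T : Submodule (𝓞 K) V) (hfg : T.FG)
    (hInt : ∀ x ∈ T, ∀ y ∈ T, ∃ c : 𝓞 K, algebraMap (𝓞 K) K c = B x y)

lemma form_ofSubmodule (x y : T) :
    algebraMap (𝓞 K) K ((ofSubmodule B hsymm hpos T hfg hInt).form x y) = B x y :=
  coe_restrictForm B T hInt x y

lemma rank_ofSubmodule_le [NumberField K] [FiniteDimensional K V] :
    (ofSubmodule B hsymm hpos T hfg hInt).rank ≤ Module.finrank K V := by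
  rw [rank_eq_finrank]
  change Module.finrank (𝓞 K) T ≤ _
  have h1 : Module.rank (𝓞 K) T ≤ Module.rank (𝓞 K) V := Submodule.rank_le T
  rw [← IsFractionRing.rank_right_eq (R := 𝓞 K) (S := K) (N := V)] at h1
  exact Cardinal.toNat_le_toNat h1 (Module.rank_lt_aleph0 K V)

end OKLattice

namespace OKLattice
variable {K : Type} [Field K]

/-- The form `x y / c` on `K`. -/
def lineForm (c : K) : K →ₗ[K] K →ₗ[K] K := c⁻¹ • LinearMap.mul K K

lemma lineForm_apply (c x y : K) : lineForm c x y = x * y / c := by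
  simp [lineForm]; ring

variable [NumberField K]

/-- The unimodular lattice of rank one given by an ideal `J` with `J ^ 2 = (c)`. -/
def ofIdeal (c : 𝓞 K) (hc : ∀ σ : K →+* ℝ, 0 < σ c) (J : Ideal (𝓞 K))
    (hJ : J * J = Ideal.span {c}) : OKLattice K :=
  ofSubmodule (lineForm (algebraMap (𝓞 K) K c))
    (fun x y => by rw [lineForm_apply, lineForm_apply, mul_comm])
    (fun v hv σ => by
      rw [lineForm_apply, map_div₀, map_mul]
      exact div_pos (mul_self_pos.mpr (by simpa using hv)) (hc σ))
    (Submodule.map (Algebra.linearMap (𝓞 K) K) J)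
    ((IsNoetherian.noetherian J).map _)
    (by
      rintro _ ⟨x, hx, rfl⟩ _ ⟨y, hy, rfl⟩
      have : x * y ∈ J * J := Ideal.mul_mem_mul hx hy
      rw [hJ, Ideal.mem_span_singleton] at this
      obtain ⟨d, hd⟩ := this
      by_cases h0 : c = 0
      · exact ⟨0, by simp [lineForm_apply, h0]⟩
      · have : algebraMap (𝓞 K) K c ≠ 0 := by simpa using h0
        refine ⟨d, ?_⟩
        rw [lineForm_apply]
        simp only [Algebra.linearMap_apply]
        rw [← map_mul, hd, map_mul]
        field_simp)

variable (c : 𝓞 K) (hc : ∀ σ : K →+* ℝ, 0 < σ c) (J : Ideal (𝓞 K)) (hJ : J * J = Ideal.span {c})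

lemma rank_ofIdeal_le : (ofIdeal c hc J hJ).rank ≤ 1 := by
  have := rank_ofSubmodule_le (K := K) (V := K) (lineForm (algebraMap (𝓞 K) K c))
  rw [Module.finrank_self] at this
  exact this _ _ _ _ _

/-- The element of `ofIdeal` attached to an element of the ideal. -/
def ofIdealMk (x : J) : (ofIdeal c hc J hJ).carrier :=
  ⟨algebraMap (𝓞 K) K x.1, ⟨x.1, x.2, rfl⟩⟩

lemma ofIdealMk_surjective : Function.Surjective (ofIdealMk c hc J hJ) := by
  rintro ⟨_, x, hx, rfl⟩
  exact ⟨⟨x, hx⟩, rfl⟩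

lemma smul_ofIdealMk (r : 𝓞 K) (x : J) :
    r • ofIdealMk c hc J hJ x = ofIdealMk c hc J hJ (r • x) :=
  Subtype.ext (by
    change r • algebraMap (𝓞 K) K x.1 = algebraMap (𝓞 K) K (r * x.1)
    rw [Algebra.smul_def, map_mul])

lemma form_ofIdealMk (x y : J) :
    algebraMap (𝓞 K) K ((ofIdeal c hc J hJ).form (ofIdealMk c hc J hJ x) (ofIdealMk c hc J hJ y)) =
      algebraMap (𝓞 K) K x * algebraMap (𝓞 K) K y / algebraMap (𝓞 K) K c := by
  rw [← lineForm_apply]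
  exact form_ofSubmodule ..

lemma isUnimodular_ofIdeal (h : TotallyReal K) : (ofIdeal c hc J hJ).IsUnimodular := by
  intro f
  obtain ⟨σ⟩ := h.nonempty_emb
  have hc0 : c ≠ 0 := by
    rintro rfl
    simpa using hc σ
  have hcK : algebraMap (𝓞 K) K c ≠ 0 := by simpa using hc0
  have hcJ : c ∈ J * J := by rw [hJ]; exact Ideal.mem_span_singleton_self c
  have hcJ' : c ∈ J := Ideal.mul_le_left hcJ
  let φ : J → 𝓞 K := fun x => f (ofIdealMk c hc J hJ x)
  have hφ : ∀ x y : J, φ x * y.1 = φ y * x.1 := by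
    intro x y
    have h1 : y.1 • ofIdealMk c hc J hJ x = x.1 • ofIdealMk c hc J hJ y := by
      rw [smul_ofIdealMk, smul_ofIdealMk]
      congr 1
      exact Subtype.ext (mul_comm _ _)
    have h2 := congr_arg f h1
    rw [map_smul, map_smul, smul_eq_mul, smul_eq_mul] at h2
    rw [mul_comm, h2, mul_comm]
  have key : ∀ d ∈ J * J, ∃ z : J, z.1 * c = φ ⟨c, hcJ'⟩ * d := by
    intro d hd
    refine Submodule.mul_induction_on hd ?_ ?_
    · intro x hx y hy
      refine ⟨⟨φ ⟨x, hx⟩ * y, J.mul_mem_left _ hy⟩, ?_⟩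
      have := hφ ⟨x, hx⟩ ⟨c, hcJ'⟩
      simp only at this ⊢
      linear_combination y * this
    · rintro x y ⟨z, hz⟩ ⟨w, hw⟩
      refine ⟨z + w, ?_⟩
      rw [Submodule.coe_add]
      linear_combination hz + hw
  obtain ⟨z, hz⟩ := key c hcJ
  have hz' : z.1 = φ ⟨c, hcJ'⟩ := mul_right_cancel₀ hc0 hz
  refine ⟨ofIdealMk c hc J hJ z, fun x => ?_⟩
  obtain ⟨x, rfl⟩ := ofIdealMk_surjective c hc J hJ x
  apply RingOfIntegers.coe_injective
  rw [form_ofIdealMk, hz', eq_div_iff hcK, ← map_mul, ← map_mul]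
  congr 1
  exact hφ x ⟨c, hcJ'⟩

lemma exists_sq_of_isometric_ofIdeal (h : TotallyReal K) (c' : 𝓞 K)
    (hc' : ∀ σ : K →+* ℝ, 0 < σ c')
    (J' : Ideal (𝓞 K)) (hJ' : J' * J' = Ideal.span {c'})
    (hi : Isometric (ofIdeal c hc J hJ) (ofIdeal c' hc' J' hJ')) :
    IsSquare (algebraMap (𝓞 K) K (c * c')) := by
  obtain ⟨σ⟩ := h.nonempty_emb
  have hc0 : algebraMap (𝓞 K) K c ≠ 0 := fun h0 => by simpa [h0] using hc σ
  have hc0' : algebraMap (𝓞 K) K c' ≠ 0 := fun h0 => by simpa [h0] using hc' σ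
  have hcJ : c ∈ J := Ideal.mul_le_left (by rw [hJ]; exact Ideal.mem_span_singleton_self c)
  obtain ⟨e, he⟩ := hi
  let x := ofIdealMk c hc J hJ ⟨c, hcJ⟩
  obtain ⟨y, hy⟩ := ofIdealMk_surjective c' hc' J' hJ' (e x)
  have h1 := congr_arg (algebraMap (𝓞 K) K) (he x x)
  rw [← hy, form_ofIdealMk, form_ofIdealMk] at h1
  simp only at h1
  refine ⟨algebraMap (𝓞 K) K y, ?_⟩
  field_simp at h1
  rw [map_mul]
  linear_combination -h1

end OKLattice

namespace OKLattice
variable {K : Type} [Field K]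

/-- The dot product on `K³`. -/
def dotForm (K : Type) [Field K] : (Fin 3 → K) →ₗ[K] (Fin 3 → K) →ₗ[K] K :=
  LinearMap.mk₂ K (fun x y => x ⬝ᵥ y) add_dotProduct smul_dotProduct dotProduct_add
    (fun c x y => dotProduct_smul c x y)

@[simp] lemma dotForm_apply (x y : Fin 3 → K) : dotForm K x y = x ⬝ᵥ y := rfl

lemma dotProduct_self_pos {x : Fin 3 → K} (hx : x ≠ 0) (σ : K →+* ℝ) : 0 < σ (x ⬝ᵥ x) := by
  obtain ⟨i, hi⟩ := Function.ne_iff.mp hx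
  simp only [dotProduct, map_sum, map_mul]
  refine Finset.sum_pos' (fun j _ => mul_self_nonneg _) ⟨i, Finset.mem_univ _, ?_⟩
  exact mul_self_pos.mpr (by simpa using hi)

/-- The vector of `K³` attached to a vector of `(𝓞 K)³`. -/
def toK (v : Fin 3 → 𝓞 K) : Fin 3 → K := fun i => algebraMap (𝓞 K) K (v i)

lemma toK_dot (v w : Fin 3 → 𝓞 K) : toK v ⬝ᵥ toK w = algebraMap (𝓞 K) K (v ⬝ᵥ w) := by
  simp [toK, dotProduct, map_sum]

/-- The neighbour of `(𝓞 K)³` with respect to the vector `w` and the modulus `a`. -/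
def nbr (a : 𝓞 K) (w : Fin 3 → 𝓞 K) : Submodule (𝓞 K) (Fin 3 → K) where
  carrier := {x | ∃ (v : Fin 3 → 𝓞 K) (ρ : 𝓞 K), a ∣ v ⬝ᵥ w ∧
    x = toK v + (algebraMap (𝓞 K) K ρ / algebraMap (𝓞 K) K a) • toK w}
  zero_mem' := ⟨0, 0, by simp, by ext i; simp [toK]⟩
  add_mem' := by
    rintro _ _ ⟨v, ρ, hv, rfl⟩ ⟨v', ρ', hv', rfl⟩
    refine ⟨v + v', ρ + ρ', by rw [add_dotProduct]; exact dvd_add hv hv', ?_⟩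
    ext i
    simp [toK]; ring
  smul_mem' := by
    rintro c _ ⟨v, ρ, hv, rfl⟩
    refine ⟨c • v, c * ρ, by rw [smul_dotProduct]; exact Dvd.dvd.mul_left hv c, ?_⟩
    ext i
    simp [toK, Algebra.smul_def]; ring

/-- The conditions on `a`, `w` making the neighbour unimodular. -/
structure NbrData (a : 𝓞 K) (w : Fin 3 → 𝓞 K) : Prop where
  ne_zero : a ≠ 0
  dvd_self : a ^ 2 ∣ w ⬝ᵥ w
  exists_unit : ∃ r : Fin 3 → 𝓞 K, a ∣ r ⬝ᵥ w - 1

lemma single_mem_nbr (a : 𝓞 K) (w : Fin 3 → 𝓞 K) (j : Fin 3) :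
    Pi.single j (algebraMap (𝓞 K) K a) ∈ nbr a w := by
  refine ⟨Pi.single j a, 0, by simp, ?_⟩
  ext i
  by_cases h : i = j
  · subst h; simp [toK]
  · simp [toK, h]

variable {a : 𝓞 K} {w : Fin 3 → 𝓞 K}

lemma NbrData.coe_ne_zero (hd : NbrData a w) : algebraMap (𝓞 K) K a ≠ 0 := by
  simpa using hd.ne_zero

lemma NbrData.smul_mem (hd : NbrData a w) : (algebraMap (𝓞 K) K a)⁻¹ • toK w ∈ nbr a w :=
  ⟨0, 1, by simp, by simp [toK]; rfl⟩

lemma NbrData.exists_toK (hd : NbrData a w) {x : Fin 3 → K} (hx : x ∈ nbr a w) :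
    ∃ v : Fin 3 → 𝓞 K, algebraMap (𝓞 K) K a • x = toK v := by
  obtain ⟨v, ρ, -, rfl⟩ := hx
  refine ⟨a • v + ρ • w, ?_⟩
  have := hd.coe_ne_zero
  ext i
  simp [toK]
  field_simp

lemma NbrData.integral (hd : NbrData a w) : ∀ x ∈ nbr a w, ∀ y ∈ nbr a w,
    ∃ c : 𝓞 K, algebraMap (𝓞 K) K c = dotForm K x y := by
  rintro _ ⟨v, ρ, ⟨d, hv⟩, rfl⟩ _ ⟨v', ρ', ⟨d', hv'⟩, rfl⟩
  obtain ⟨e, he⟩ := hd.dvd_self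
  refine ⟨v ⬝ᵥ v' + ρ * d' + ρ' * d + ρ * ρ' * e, ?_⟩
  have := hd.coe_ne_zero
  rw [dotForm_apply]
  simp only [add_dotProduct, dotProduct_add, smul_dotProduct, dotProduct_smul,
    smul_eq_mul, toK_dot, dotProduct_comm w v', he, hv, hv', map_add, map_mul, map_pow]
  field_simp
  ring

/-- Vectors pairing integrally with the neighbour lie in it. -/
lemma NbrData.mem_of_dual (hd : NbrData a w) {x : Fin 3 → K}
    (hx : ∀ y ∈ nbr a w, ∃ c : 𝓞 K, algebraMap (𝓞 K) K c = x ⬝ᵥ y) : x ∈ nbr a w := by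
  have ha := hd.coe_ne_zero
  obtain ⟨r, hr⟩ := hd.exists_unit
  have h1 : ∀ j, ∃ c : 𝓞 K, algebraMap (𝓞 K) K c = x j * algebraMap (𝓞 K) K a := fun j => by
    simpa using hx _ (single_mem_nbr a w j)
  choose y hy using h1
  have hxy : algebraMap (𝓞 K) K a • x = toK y := by
    ext j; simp [toK, hy, mul_comm]
  have h2 : ∀ j, a ∣ y j - (y ⬝ᵥ r) * w j := by
    intro j
    have hmem : toK (Pi.single j 1 - w j • r) ∈ nbr a w := by
      refine ⟨Pi.single j 1 - w j • r, 0, ?_, by simp⟩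
      obtain ⟨e, he⟩ := hr
      refine ⟨-(w j * e), ?_⟩
      rw [sub_dotProduct, smul_dotProduct, single_dotProduct, smul_eq_mul]
      linear_combination -(w j) * he
    obtain ⟨c, hc⟩ := hx _ hmem
    refine ⟨c, RingOfIntegers.coe_injective ?_⟩
    have h3 : algebraMap (𝓞 K) K (y ⬝ᵥ (Pi.single j 1 - w j • r)) =
        algebraMap (𝓞 K) K a * algebraMap (𝓞 K) K c := by
      rw [← toK_dot, ← hxy, smul_dotProduct, hc, smul_eq_mul]
    rw [map_mul, ← h3, dotProduct_sub, dotProduct_smul, dotProduct_single, smul_eq_mul]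
    simp [mul_comm]
  choose v hv using h2
  obtain ⟨c, hc⟩ := hx _ hd.smul_mem
  obtain ⟨e, he⟩ := hd.dvd_self
  have hxe : x = toK v + (algebraMap (𝓞 K) K (y ⬝ᵥ r) / algebraMap (𝓞 K) K a) • toK w := by
    ext j
    have h4 := congr_arg (algebraMap (𝓞 K) K) (hv j)
    simp only [map_sub, map_mul, hy] at h4
    simp only [toK, Pi.add_apply, Pi.smul_apply, smul_eq_mul]
    field_simp
    linear_combination h4
  refine ⟨v, y ⬝ᵥ r, ?_, hxe⟩
  refine ⟨c - (y ⬝ᵥ r) * e, RingOfIntegers.coe_injective ?_⟩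
  have h5 : toK v = x - (algebraMap (𝓞 K) K (y ⬝ᵥ r) / algebraMap (𝓞 K) K a) • toK w := by
    rw [eq_sub_iff_add_eq, ← hxe]
  rw [← toK_dot, h5, sub_dotProduct, smul_dotProduct, toK_dot, he]
  rw [dotProduct_smul, smul_eq_mul] at hc
  have h6 : x ⬝ᵥ toK w = algebraMap (𝓞 K) K a * algebraMap (𝓞 K) K c := by
    rw [hc]; field_simp
  rw [h6]
  simp only [map_mul, map_sub, smul_eq_mul, map_pow]
  field_simp

variable [NumberField K]

lemma NbrData.fg (hd : NbrData a w) : (nbr a w).FG := by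
  have h1 : nbr a w ≤ Submodule.span (𝓞 K)
      (Set.range fun j : Fin 3 => (Pi.single j (algebraMap (𝓞 K) K a)⁻¹ : Fin 3 → K)) := by
    intro x hx
    obtain ⟨v, hv⟩ := hd.exists_toK hx
    have hx' : x = ∑ j, v j • (Pi.single j (algebraMap (𝓞 K) K a)⁻¹ : Fin 3 → K) := by
      ext i
      have h2 := congr_fun hv i
      have := hd.coe_ne_zero
      simp only [Finset.sum_apply, Pi.smul_apply, Pi.single_apply, smul_ite, smul_zero,
        Finset.sum_ite_eq, Finset.mem_univ, if_true]
      simp only [toK, Pi.smul_apply, smul_eq_mul] at h2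
      rw [Algebra.smul_def, ← h2]
      field_simp
    rw [hx']
    exact Submodule.sum_mem _ fun j _ => Submodule.smul_mem _ _ (Submodule.subset_span ⟨j, rfl⟩)
  have h2 : (Submodule.span (𝓞 K)
      (Set.range fun j : Fin 3 => (Pi.single j (algebraMap (𝓞 K) K a)⁻¹ : Fin 3 → K))).FG :=
    Submodule.fg_span (Set.finite_range _)
  exact Submodule.FG.of_le h2 h1

/-- The neighbour as a lattice. -/
def NbrData.lattice (hd : NbrData a w) : OKLattice K :=
  ofSubmodule (dotForm K) (fun x y => dotProduct_comm x y) (fun _ hv σ => dotProduct_self_pos hv σ)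
    (nbr a w) hd.fg hd.integral

lemma NbrData.rank_le (hd : NbrData a w) : hd.lattice.rank ≤ 3 := by
  have := rank_ofSubmodule_le (K := K) (V := Fin 3 → K) (dotForm K)
  rw [Module.finrank_fin_fun] at this
  exact this _ _ _ _ _

lemma NbrData.form_eq (hd : NbrData a w) (x y : nbr a w) :
    algebraMap (𝓞 K) K (hd.lattice.form x y) = x.1 ⬝ᵥ y.1 :=
  form_ofSubmodule ..

/-- Linear maps out of a neighbour extend to `K³`. -/
lemma NbrData.extend (hd : NbrData a w) {V : Type} [AddCommGroup V] [Module K V] [Module (𝓞 K) V]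
    [IsScalarTower (𝓞 K) K V] (f : nbr a w →ₗ[𝓞 K] V) :
    ∃ g : (Fin 3 → K) →ₗ[K] V, ∀ x : nbr a w, g x = f x := by
  have ha := hd.coe_ne_zero
  let g : (Fin 3 → K) →ₗ[K] V := ∑ j, (LinearMap.proj j).smulRight
    ((algebraMap (𝓞 K) K a)⁻¹ • f ⟨_, single_mem_nbr a w j⟩)
  refine ⟨g, fun x => ?_⟩
  obtain ⟨v, hv⟩ := hd.exists_toK x.2
  have hv' : ∀ j, algebraMap (𝓞 K) K a * x.1 j = algebraMap (𝓞 K) K (v j) := fun j =>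
    congr_fun hv j
  have h1 : (a * a) • x = ∑ j, v j • (⟨_, single_mem_nbr a w j⟩ : nbr a w) := by
    apply Subtype.ext
    ext i
    rw [Submodule.coe_smul, Submodule.coe_sum, Finset.sum_apply]
    simp only [Submodule.coe_smul, Pi.smul_apply, Pi.single_apply, smul_ite, smul_zero,
      Algebra.smul_def, mul_ite, mul_zero,
      Finset.sum_ite_eq, Finset.mem_univ, if_true]
    rw [map_mul, ← hv']
    ring
  have h2 := congr_arg f h1
  rw [map_smul, map_sum] at h2
  simp only [map_smul] at h2
  have h3 : (algebraMap (𝓞 K) K a * algebraMap (𝓞 K) K a) • f x =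
      (algebraMap (𝓞 K) K a * algebraMap (𝓞 K) K a) • g x.1 := by
    simp only [g]
    rw [← map_mul, algebraMap_smul, h2, LinearMap.sum_apply, map_mul, Finset.smul_sum]
    refine Finset.sum_congr rfl fun j _ => ?_
    rw [LinearMap.smulRight_apply, LinearMap.proj_apply, smul_smul, smul_smul,
      ← algebraMap_smul K (v j), ← hv']
    congr 1
    field_simp
  exact (smul_right_injective V (mul_ne_zero ha ha) h3).symm

lemma NbrData.isUnimodular (hd : NbrData a w) : hd.lattice.IsUnimodular := by
  intro f
  obtain ⟨g, hg⟩ := hd.extend ((Algebra.linearMap (𝓞 K) K).comp f)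
  let x : Fin 3 → K := fun j => g (Pi.single j 1)
  have hx : ∀ y, g y = x ⬝ᵥ y := by
    intro y
    have : y = ∑ j, y j • (Pi.single j 1 : Fin 3 → K) := by
      ext i; simp [Pi.single_apply]
    conv_lhs => rw [this]
    rw [map_sum]
    simp [dotProduct, x, mul_comm]
  have hmem : x ∈ nbr a w := hd.mem_of_dual fun y hy => ⟨f ⟨y, hy⟩, by
    rw [← hx]; exact (hg ⟨y, hy⟩).symm⟩
  refine ⟨⟨x, hmem⟩, fun y => RingOfIntegers.coe_injective ?_⟩
  refine Eq.trans ?_ (hd.form_eq ⟨x, hmem⟩ y).symm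
  rw [← hx]
  exact (hg y).symm

/-- Isometries of neighbours extend to isometries of `K³`. -/
lemma NbrData.exists_isometry (hd : NbrData a w) {a' : 𝓞 K} {w' : Fin 3 → 𝓞 K}
    (hd' : NbrData a' w') (hi : Isometric hd.lattice hd'.lattice) :
    ∃ g : (Fin 3 → K) →ₗ[K] (Fin 3 → K), (∀ x y, g x ⬝ᵥ g y = x ⬝ᵥ y) ∧
      (∀ x ∈ nbr a w, g x ∈ nbr a' w') ∧ (∀ y ∈ nbr a' w', ∃ x ∈ nbr a w, g x = y) := by
  obtain ⟨e, he⟩ := hi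
  have ha := hd.coe_ne_zero
  let e' : nbr a w →ₗ[𝓞 K] nbr a' w' := e.toLinearMap
  obtain ⟨g, hg⟩ := hd.extend ((nbr a' w').subtype.comp e')
  have h1 : ∀ x y : nbr a w, g x ⬝ᵥ g y = x.1 ⬝ᵥ y.1 := by
    intro x y
    rw [hg, hg]
    have h2 := congr_arg (algebraMap (𝓞 K) K) (he x y)
    exact ((hd'.form_eq (e' x) (e' y)).symm.trans h2).trans (hd.form_eq x y)
  refine ⟨g, ?_, ?_, ?_⟩
  · have h3 : ∀ i j, g (Pi.single i 1) ⬝ᵥ g (Pi.single j 1) =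
        (Pi.single i 1 : Fin 3 → K) ⬝ᵥ Pi.single j 1 := by
      intro i j
      have h4 := h1 ⟨_, single_mem_nbr a w i⟩ ⟨_, single_mem_nbr a w j⟩
      have h5 : ∀ i : Fin 3, (Pi.single i (algebraMap (𝓞 K) K a) : Fin 3 → K) =
          algebraMap (𝓞 K) K a • Pi.single i 1 := fun i => by
        rw [← Pi.single_smul, smul_eq_mul, mul_one]
      simp only [h5, map_smul, smul_dotProduct, dotProduct_smul] at h4
      exact smul_right_injective K ha (smul_right_injective K ha h4)
    intro x y
    have h6 : ∀ y : Fin 3 → K, y = ∑ j, y j • (Pi.single j 1 : Fin 3 → K) := by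
      intro y; ext i; simp [Pi.single_apply]
    rw [h6 x, h6 y]
    simp only [map_sum, map_smul, sum_dotProduct, dotProduct_sum, smul_dotProduct,
      dotProduct_smul, h3]
  · intro x hx
    rw [hg ⟨x, hx⟩]
    exact (e' ⟨x, hx⟩).2
  · intro y hy
    let x : nbr a w := e.symm (show hd'.lattice.carrier from (⟨y, hy⟩ : nbr a' w'))
    refine ⟨x.1, x.2, (hg x).trans ?_⟩
    exact congr_arg Subtype.val (e.apply_symm_apply ⟨y, hy⟩)

end OKLattice

namespace OKLattice
variable {K : Type} [Field K]

section
variable [NumberField K]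

/-- Modulo powers of a prime not dividing two, `-1` is a sum of two squares. -/
lemma exists_sq_add_sq_prime_pow {P : Ideal (𝓞 K)} (hP : Prime P) (h2 : (2 : 𝓞 K) ∉ P) (k : ℕ) :
    ∃ s t : 𝓞 K, s ∉ P ∧ s ^ 2 + t ^ 2 + 1 ∈ P ^ (k + 1) := by
  have hPp : P.IsPrime := Ideal.isPrime_of_prime hP
  have hmax : P.IsMaximal := hPp.isMaximal hP.ne_zero
  induction k with
  | zero =>
    have hfin : Finite (𝓞 K ⧸ P) := Ideal.finiteQuotientOfFreeOfNeBot P hP.ne_zero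
    obtain ⟨p, hp⟩ := CharP.exists (𝓞 K ⧸ P)
    have : NeZero p := ⟨CharP.char_ne_zero_of_finite (𝓞 K ⧸ P) p⟩
    obtain ⟨a, b, hab⟩ := CharP.sq_add_sq (𝓞 K ⧸ P) p (-1)
    have hmem : (a : 𝓞 K) ^ 2 + (b : 𝓞 K) ^ 2 + 1 ∈ P := by
      rw [← Ideal.Quotient.eq_zero_iff_mem]
      simp [hab]
    by_cases ha : (a : 𝓞 K) ∈ P
    · refine ⟨b, a, fun hb => ?_, by simpa [add_comm, add_left_comm] using hmem⟩
      refine hPp.ne_top ((Ideal.eq_top_iff_one _).mpr ?_)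
      have := P.sub_mem hmem (P.add_mem (P.mul_mem_left a ha) (P.mul_mem_left b hb))
      convert this using 1
      ring
    · exact ⟨a, b, ha, by simpa using hmem⟩
  | succ k ih =>
    obtain ⟨s, t, hs, hst⟩ := ih
    have h2s : (2 : 𝓞 K) * s ∉ P := fun h => (hPp.mem_or_mem h).elim h2 hs
    obtain ⟨r, hr⟩ : ∃ r, (2 * s) * r - 1 ∈ P := by
      obtain ⟨r, i, hi, h⟩ := hmax.exists_inv h2s
      refine ⟨r, ?_⟩
      have : (2 * s) * r - 1 = - i := by rw [← h]; ring
      rw [this]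
      exact P.neg_mem hi
    set E := s ^ 2 + t ^ 2 + 1 with hE
    refine ⟨s - r * E, t, fun h => hs ?_, ?_⟩
    · have : s = (s - r * E) + r * E := by ring
      rw [this]
      exact P.add_mem h (P.mul_mem_left _ (Ideal.pow_le_self (by omega) hst))
    · have : (s - r * E) ^ 2 + t ^ 2 + 1 = - (E * (2 * s * r - 1)) + r ^ 2 * (E * E) := by
        rw [hE]; ring
      rw [this, pow_succ]
      refine Ideal.add_mem _ (Submodule.neg_mem _ (Ideal.mul_mem_mul hst hr))
        (Ideal.mul_mem_left _ _ (Ideal.mul_mem_mul hst (Ideal.pow_le_self (by omega) hst)))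

/-- Modulo an ideal prime to two, `-1` is a sum of two squares. -/
lemma exists_sq_add_sq_ideal (I : Ideal (𝓞 K)) (hI : I ≠ 0) (h2 : I ⊔ Ideal.span {2} = ⊤) :
    ∃ s t : 𝓞 K, s ^ 2 + t ^ 2 + 1 ∈ I := by
  induction I using UniqueFactorizationMonoid.induction_on_coprime with
  | h0 => exact absurd rfl hI
  | h1 h =>
    rw [Ideal.isUnit_iff] at h
    subst h
    exact ⟨0, 0, trivial⟩
  | @hpr P i hP =>
    rcases i with _ | i
    · exact ⟨0, 0, by simp⟩
    · refine (exists_sq_add_sq_prime_pow hP (fun h => ?_) i).imp fun s => Exists.imp fun t h => h.2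
      have hle : P ^ (i + 1) ⊔ Ideal.span {2} ≤ P := sup_le (Ideal.pow_le_self (by omega))
        (by simpa using h)
      rw [h2, top_le_iff] at hle
      exact (Ideal.isPrime_of_prime hP).ne_top hle
  | @hcp A B hAB hA hB =>
    have hA0 : A ≠ 0 := left_ne_zero_of_mul hI
    have hB0 : B ≠ 0 := right_ne_zero_of_mul hI
    have hA2 : A ⊔ Ideal.span {2} = ⊤ := by
      rw [eq_top_iff, ← h2]; exact sup_le_sup_right Ideal.mul_le_left _
    have hB2 : B ⊔ Ideal.span {2} = ⊤ := by
      rw [eq_top_iff, ← h2]; exact sup_le_sup_right Ideal.mul_le_right _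
    obtain ⟨s, t, hst⟩ := hA hA0 hA2
    obtain ⟨s', t', hst'⟩ := hB hB0 hB2
    have hcop : IsCoprime A B := by
      rw [Ideal.isCoprime_iff_sup_eq]
      have := hAB (d := A ⊔ B) (Ideal.dvd_iff_le.mpr le_sup_left) (Ideal.dvd_iff_le.mpr le_sup_right)
      rwa [Ideal.isUnit_iff] at this
    obtain ⟨e, he, f, hf, hef⟩ := (Ideal.isCoprime_iff_exists).mp hcop
    refine ⟨s * f + s' * e, t * f + t' * e, ?_⟩
    rw [Ideal.mul_eq_inf_of_coprime (Ideal.isCoprime_iff_sup_eq.mp hcop)]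
    refine ⟨?_, ?_⟩
    · have : (s * f + s' * e) ^ 2 + (t * f + t' * e) ^ 2 + 1 =
        f ^ 2 * (s ^ 2 + t ^ 2 + 1) + e * (2 * s * s' * f + s' ^ 2 * e + 2 * t * t' * f + t' ^ 2 * e
          + (1 + f)) := by
        have : f = 1 - e := by rw [← hef]; ring
        rw [this]; ring
      rw [this]
      exact A.add_mem (A.mul_mem_left _ hst) (A.mul_mem_right _ he)
    · have : (s * f + s' * e) ^ 2 + (t * f + t' * e) ^ 2 + 1 =
        e ^ 2 * (s' ^ 2 + t' ^ 2 + 1) + f * (2 * s * s' * e + s ^ 2 * f + 2 * t * t' * e + t ^ 2 * f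
          + (1 + e)) := by
        have : e = 1 - f := by rw [← hef]; ring
        rw [this]; ring
      rw [this]
      exact B.add_mem (B.mul_mem_left _ hst') (B.mul_mem_right _ hf)

lemma exists_sq_dvd (a : 𝓞 K) (ha : a ≠ 0) (h2 : IsCoprime a 2) :
    ∃ s t : 𝓞 K, a ^ 2 ∣ s ^ 2 + t ^ 2 + 1 := by
  obtain ⟨s, t, h⟩ := exists_sq_add_sq_ideal (Ideal.span {a ^ 2}) (by simpa using ha) (by
    rw [← Ideal.isCoprime_iff_sup_eq, Ideal.isCoprime_span_singleton_iff]
    exact h2.pow_left)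
  exact ⟨s, t, Ideal.mem_span_singleton.mp h⟩

end

/-- An isotropic vector modulo divisors of `s ^ 2 + t ^ 2 + 1`. -/
def wvec (s t u : 𝓞 K) : Fin 3 → 𝓞 K :=
  ![1 + u ^ 2, s + 2 * u * t - u ^ 2 * s, t - 2 * u * s - u ^ 2 * t]

lemma wvec_dot_self (s t u : 𝓞 K) :
    wvec s t u ⬝ᵥ wvec s t u = (s ^ 2 + t ^ 2 + 1) * (1 + u ^ 2) ^ 2 := by
  simp [wvec, dotProduct, Fin.sum_univ_three]; ring

/-- An auxiliary vector pairing to two with `wvec s t u`. -/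
def fvec (s t : 𝓞 K) : Fin 3 → 𝓞 K := ![1, -s, -t]

lemma fvec_dot (s t u : 𝓞 K) : fvec s t ⬝ᵥ wvec s t u =
    2 + (s ^ 2 + t ^ 2 + 1) * (u ^ 2 - 1) := by
  simp [wvec, fvec, dotProduct, Fin.sum_univ_three]; ring

lemma mvec_dot (s t u : 𝓞 K) : ![0, t, -s] ⬝ᵥ wvec s t u =
    2 * u * ((s ^ 2 + t ^ 2 + 1) - 1) := by
  simp [wvec, dotProduct, Fin.sum_univ_three]; ring

variable {a s t : 𝓞 K}

lemma nbrData_wvec (ha : a ≠ 0) (h2 : IsCoprime a 2) (hst : a ^ 2 ∣ s ^ 2 + t ^ 2 + 1) (u : 𝓞 K) :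
    NbrData a (wvec s t u) where
  ne_zero := ha
  dvd_self := by rw [wvec_dot_self]; exact Dvd.dvd.mul_right hst _
  exists_unit := by
    obtain ⟨x, y, hxy⟩ := h2
    obtain ⟨c, hc⟩ := hst
    refine ⟨y • fvec s t, -x + a * c * y * (u ^ 2 - 1), ?_⟩
    rw [smul_dotProduct, fvec_dot, hc, smul_eq_mul, ← hxy]
    ring

lemma dvd_sub_of_nbr_eq (ha : a ≠ 0) (h2 : IsCoprime a 2) (hst : a ^ 2 ∣ s ^ 2 + t ^ 2 + 1)
    {u v : 𝓞 K} (h : nbr a (wvec s t u) = nbr a (wvec s t v)) : a ∣ u - v := by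
  have hmem := (nbrData_wvec ha h2 hst u).smul_mem
  rw [h] at hmem
  obtain ⟨x, ρ, -, hx⟩ := hmem
  have haK : algebraMap (𝓞 K) K a ≠ 0 := by simpa using ha
  have hw : wvec s t u = a • x + ρ • wvec s t v := by
    ext i
    have := congr_fun hx i
    simp only [toK, Pi.smul_apply, smul_eq_mul, Pi.add_apply] at this
    field_simp at this
    simp only [Pi.add_apply, Pi.smul_apply, smul_eq_mul, map_add, map_mul]
    linear_combination this
  have hf := congr_arg (fun z => fvec s t ⬝ᵥ z) hw
  have hm := congr_arg (fun z => ![0, t, -s] ⬝ᵥ z) hw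
  simp only [dotProduct_add, dotProduct_smul, fvec_dot, mvec_dot, smul_eq_mul] at hf hm
  obtain ⟨c, hc⟩ := hst
  rw [hc] at hf hm
  generalize fvec s t ⬝ᵥ x = A at hf
  generalize ![0, t, -s] ⬝ᵥ x = B at hm
  have key : a ∣ 2 * (u - v) := by
    have h1 : a ∣ 2 * (ρ - 1) :=
      ⟨a * c * (u ^ 2 - 1) - ρ * (a * c) * (v ^ 2 - 1) - A, by linear_combination -hf⟩
    have h2 : a ∣ 2 * (u - v) - 2 * (ρ - 1) * v :=
      ⟨2 * u * a * c - ρ * 2 * v * a * c - B, by linear_combination -hm⟩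
    have h3 : a ∣ 2 * (ρ - 1) * v := Dvd.dvd.mul_right h1 v
    simpa using dvd_add h2 h3
  exact h2.dvd_of_dvd_mul_left key

end OKLattice

namespace OKLattice
variable {K : Type} [Field K]

/-- The (unnormalised) rotation matrix of a quaternion, given by its coordinates. -/
def rotMat (q : Fin 4 → K) : Matrix (Fin 3) (Fin 3) K :=
  !![q 0 ^ 2 + q 1 ^ 2 - q 2 ^ 2 - q 3 ^ 2, 2 * (q 1 * q 2 - q 0 * q 3), 2 * (q 1 * q 3 + q 0 * q 2);
    2 * (q 1 * q 2 + q 0 * q 3), q 0 ^ 2 - q 1 ^ 2 + q 2 ^ 2 - q 3 ^ 2, 2 * (q 2 * q 3 - q 0 * q 1);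
    2 * (q 1 * q 3 - q 0 * q 2), 2 * (q 2 * q 3 + q 0 * q 1), q 0 ^ 2 - q 1 ^ 2 - q 2 ^ 2 + q 3 ^ 2]

/-- Multiplication of quaternions in coordinates. -/
def quatMul (p q : Fin 4 → K) : Fin 4 → K :=
  ![p 0 * q 0 - p 1 * q 1 - p 2 * q 2 - p 3 * q 3,
    p 0 * q 1 + p 1 * q 0 + p 2 * q 3 - p 3 * q 2,
    p 0 * q 2 - p 1 * q 3 + p 2 * q 0 + p 3 * q 1,
    p 0 * q 3 + p 1 * q 2 - p 2 * q 1 + p 3 * q 0]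

/-- Conjugation of quaternions in coordinates. -/
def quatConj (q : Fin 4 → K) : Fin 4 → K := ![q 0, -q 1, -q 2, -q 3]

lemma quatMul_dot_self (p q : Fin 4 → K) :
    quatMul p q ⬝ᵥ quatMul p q = (p ⬝ᵥ p) * (q ⬝ᵥ q) := by
  simp [quatMul, dotProduct, Fin.sum_univ_four]; ring

lemma quatConj_dot_self (q : Fin 4 → K) : quatConj q ⬝ᵥ quatConj q = q ⬝ᵥ q := by
  simp [quatConj, dotProduct, Fin.sum_univ_four]

lemma quatMul_conj_re (p q : Fin 4 → K) : quatMul p (quatConj q) 0 = p ⬝ᵥ q := by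
  simp [quatMul, quatConj, dotProduct, Fin.sum_univ_four]

lemma rotMat_quatMul (p q : Fin 4 → K) : rotMat (quatMul p q) = rotMat p * rotMat q := by
  ext i j
  fin_cases i <;> fin_cases j <;>
    simp [rotMat, quatMul, Matrix.mul_apply, Fin.sum_univ_three] <;> ring

lemma rotMat_quatConj (q : Fin 4 → K) : rotMat (quatConj q) = (rotMat q).transpose := by
  ext i j
  fin_cases i <;> fin_cases j <;>
    simp [rotMat, quatConj] <;> ring_nf <;> simp

lemma rotMat_transpose_mul (q : Fin 4 → K) :
    (rotMat q).transpose * rotMat q = ((q ⬝ᵥ q) ^ 2) • (1 : Matrix (Fin 3) (Fin 3) K) := by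
  ext i j
  fin_cases i <;> fin_cases j <;>
    simp [rotMat, Matrix.mul_apply, Fin.sum_univ_three, dotProduct, Fin.sum_univ_four] <;> ring

lemma trace_rotMat (q : Fin 4 → K) : (q ⬝ᵥ q) + (rotMat q).trace = 4 * q 0 ^ 2 := by
  simp [rotMat, Matrix.trace, Fin.sum_univ_three, dotProduct, Fin.sum_univ_four]; ring

/-- The matrix `G` is, up to sign, the rotation attached to the quaternion `q`. -/
def IsRot (q : Fin 4 → K) (G : Matrix (Fin 3) (Fin 3) K) : Prop :=
  q ⬝ᵥ q ≠ 0 ∧ ((q ⬝ᵥ q) • G = rotMat q ∨ (q ⬝ᵥ q) • G = - rotMat q)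

lemma IsRot.one : IsRot (K := K) ![1, 0, 0, 0] 1 := by
  refine ⟨by simp [dotProduct, Fin.sum_univ_four], Or.inl ?_⟩
  ext i j
  fin_cases i <;> fin_cases j <;> simp [rotMat, dotProduct, Fin.sum_univ_four]

lemma IsRot.mul {p q : Fin 4 → K} {G H : Matrix (Fin 3) (Fin 3) K} (hG : IsRot p G)
    (hH : IsRot q H) : IsRot (quatMul p q) (G * H) := by
  refine ⟨by rw [quatMul_dot_self]; exact mul_ne_zero hG.1 hH.1, ?_⟩
  have : (quatMul p q ⬝ᵥ quatMul p q) • (G * H) = ((p ⬝ᵥ p) • G) * ((q ⬝ᵥ q) • H) := by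
    rw [quatMul_dot_self, smul_mul_smul_comm]
  rw [this, rotMat_quatMul]
  rcases hG.2 with h | h <;> rcases hH.2 with h' | h' <;> rw [h, h'] <;> simp

lemma IsRot.transpose {q : Fin 4 → K} {G : Matrix (Fin 3) (Fin 3) K} (hG : IsRot q G) :
    IsRot (quatConj q) G.transpose := by
  refine ⟨by rw [quatConj_dot_self]; exact hG.1, ?_⟩
  rw [quatConj_dot_self, rotMat_quatConj, ← Matrix.transpose_smul]
  rcases hG.2 with h | h <;> rw [h] <;> simp

lemma IsRot.transpose_mul {q : Fin 4 → K} {G : Matrix (Fin 3) (Fin 3) K} (hG : IsRot q G) :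
    G.transpose * G = 1 := by
  have h0 : (q ⬝ᵥ q) ^ 2 ≠ 0 := pow_ne_zero 2 hG.1
  have : ((q ⬝ᵥ q) ^ 2) • (G.transpose * G) = ((q ⬝ᵥ q) ^ 2) • 1 := by
    rw [← rotMat_transpose_mul]
    rw [pow_two, ← smul_mul_smul_comm, ← Matrix.transpose_smul]
    rcases hG.2 with h | h <;> rw [h] <;> simp
  exact (smul_right_injective _ h0) this

/-- The reflection along `u`. -/
def reflMat (u : Fin 3 → K) : Matrix (Fin 3) (Fin 3) K :=
  1 - (2 / (u ⬝ᵥ u)) • Matrix.vecMulVec u u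

lemma reflMat_mulVec (u v : Fin 3 → K) :
    (reflMat u).mulVec v = v - (2 * (u ⬝ᵥ v) / (u ⬝ᵥ u)) • u := by
  rw [reflMat, Matrix.sub_mulVec, Matrix.one_mulVec, Matrix.smul_mulVec, Matrix.vecMulVec_mulVec]
  congr 1
  ext i
  simp
  ring

lemma IsRot.refl {u : Fin 3 → K} (hu : u ⬝ᵥ u ≠ 0) :
    IsRot ![0, u 0, u 1, u 2] (reflMat u) := by
  have hd : ![0, u 0, u 1, u 2] ⬝ᵥ ![0, u 0, u 1, u 2] = u ⬝ᵥ u := by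
    simp [dotProduct, Fin.sum_univ_four, Fin.sum_univ_three]
  refine ⟨by rwa [hd], Or.inr ?_⟩
  rw [hd, reflMat, smul_sub, smul_smul, mul_div_cancel₀ _ hu]
  ext i j
  fin_cases i <;> fin_cases j <;>
    simp [rotMat, dotProduct, Fin.sum_univ_three, Matrix.vecMulVec] <;> ring_nf <;> simp

lemma dot_self_ne_zero (σ : K →+* ℝ) {x : Fin 3 → K} (hx : x ≠ 0) : x ⬝ᵥ x ≠ 0 := by
  intro h
  have := dotProduct_self_pos hx σ
  rw [h, map_zero] at this
  exact lt_irrefl _ this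

lemma exists_isRot_fix (σ : K →+* ℝ) (G : Matrix (Fin 3) (Fin 3) K)
    (hG : ∀ x y, G.mulVec x ⬝ᵥ G.mulVec y = x ⬝ᵥ y) (i : Fin 3) :
    ∃ q H, IsRot q H ∧ H * H = 1 ∧ (∀ x y, (H * G).mulVec x ⬝ᵥ (H * G).mulVec y = x ⬝ᵥ y) ∧
      (H * G).mulVec (Pi.single i 1) = Pi.single i 1 ∧
      ∀ j, G.mulVec (Pi.single j 1) = Pi.single j 1 →
        (H * G).mulVec (Pi.single j 1) = Pi.single j 1 := by
  by_cases h : G.mulVec (Pi.single i 1) = Pi.single i 1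
  · exact ⟨_, 1, IsRot.one, by simp, by simpa using hG, by simpa using h, by simp⟩
  set e : Fin 3 → K := Pi.single i 1 with he
  set u := G.mulVec e - e with hu
  have hu0 : u ⬝ᵥ u ≠ 0 := dot_self_ne_zero σ (sub_ne_zero.mpr h)
  have huu : u ⬝ᵥ u = 2 * (u ⬝ᵥ G.mulVec e) := by
    simp only [hu, sub_dotProduct, dotProduct_sub, hG, dotProduct_comm (G.mulVec e) e]; ring
  have hrr : ∀ x y, (reflMat u).mulVec x ⬝ᵥ (reflMat u).mulVec y = x ⬝ᵥ y := by
    intro x y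
    simp only [reflMat_mulVec, sub_dotProduct, dotProduct_sub, smul_dotProduct, dotProduct_smul,
      smul_eq_mul, dotProduct_comm x u]
    field_simp
    ring
  refine ⟨_, reflMat u, IsRot.refl hu0, ?_, ?_, ?_, ?_⟩
  · apply Matrix.toLin'.injective
    refine LinearMap.ext fun x => ?_
    simp only [Matrix.toLin'_apply, ← Matrix.mulVec_mulVec, Matrix.one_mulVec]
    simp only [reflMat_mulVec, dotProduct_sub, dotProduct_smul, smul_eq_mul]
    ext k
    simp only [Pi.sub_apply, Pi.smul_apply, smul_eq_mul]
    field_simp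
    ring
  · intro x y
    simp only [← Matrix.mulVec_mulVec, hrr, hG]
  · rw [← Matrix.mulVec_mulVec, reflMat_mulVec, ← huu, div_self hu0, one_smul, hu]
    abel
  · intro j hj
    rw [← Matrix.mulVec_mulVec, reflMat_mulVec, hj]
    have hij : i ≠ j := by rintro rfl; exact h hj
    have : u ⬝ᵥ Pi.single j 1 = 0 := by
      rw [hu, sub_dotProduct]
      nth_rewrite 1 [← hj]
      rw [hG, sub_self]
    rw [this]; simp

/-- Every isometry is a rotation, up to sign. -/
lemma exists_isRot (σ : K →+* ℝ) (G : Matrix (Fin 3) (Fin 3) K)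
    (hG : ∀ x y, G.mulVec x ⬝ᵥ G.mulVec y = x ⬝ᵥ y) : ∃ q, IsRot q G := by
  obtain ⟨q₀, H₀, hr₀, hs₀, hi₀, hf₀, -⟩ := exists_isRot_fix σ G hG 0
  obtain ⟨q₁, H₁, hr₁, hs₁, hi₁, hf₁, hg₁⟩ := exists_isRot_fix σ _ hi₀ 1
  obtain ⟨q₂, H₂, hr₂, hs₂, hi₂, hf₂, hg₂⟩ := exists_isRot_fix σ _ hi₁ 2
  have h1 : H₂ * (H₁ * (H₀ * G)) = 1 := by
    apply Matrix.toLin'.injective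
    refine (Pi.basisFun K (Fin 3)).ext fun i => ?_
    rw [Pi.basisFun_apply, Matrix.toLin'_apply, Matrix.toLin'_one, LinearMap.id_apply]
    fin_cases i
    · exact hg₂ 0 (hg₁ 0 hf₀)
    · exact hg₂ 1 hf₁
    · exact hf₂
  have hGe : G = H₀ * (H₁ * H₂) := by
    have := congr_arg (fun M => H₀ * (H₁ * (H₂ * M))) h1
    simp only [← Matrix.mul_assoc, mul_one] at this
    simp only [Matrix.mul_assoc] at this
    rw [← Matrix.mul_assoc H₂, hs₂, one_mul, ← Matrix.mul_assoc H₁, hs₁, one_mul,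
      ← Matrix.mul_assoc H₀, hs₀, one_mul] at this
    exact this
  exact ⟨_, hGe ▸ hr₀.mul (hr₁.mul hr₂)⟩

/-- A rotation with integral entries comes from a quaternion whose norm has even valuation. -/
lemma IsRot.isSquare_valuation {Γ₀ : Type*} [LinearOrderedCommGroupWithZero Γ₀] (v : Valuation K Γ₀)
    (h2 : v 2 = 1) {q : Fin 4 → K} {G : Matrix (Fin 3) (Fin 3) K} (hG : IsRot q G)
    (hInt : ∀ i j, v (G i j) ≤ 1) : IsSquare (v (q ⬝ᵥ q)) := by
  set N := q ⬝ᵥ q with hN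
  have hN0 : N ≠ 0 := hG.1
  have hent : ∀ i j, v (rotMat q i j) ≤ v N := by
    intro i j
    have : v (rotMat q i j) = v (N * G i j) := by
      rcases hG.2 with h | h
      · rw [← h]; rfl
      · rw [← neg_eq_iff_eq_neg] at h
        rw [← h, Matrix.neg_apply, Valuation.map_neg]; rfl
    rw [this, map_mul]
    exact mul_le_of_le_one_right' (hInt i j)
  have h4 : v (4 : K) = 1 := by
    rw [show (4 : K) = 2 * 2 by norm_num, map_mul, h2, one_mul]
  have hadd : ∀ {x y : K}, v x ≤ v N → v y ≤ v N → v (x + y) ≤ v N := fun hx hy =>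
    Valuation.map_add_le v hx hy
  have hsub : ∀ {x y : K}, v x ≤ v N → v y ≤ v N → v (x - y) ≤ v N := fun hx hy =>
    Valuation.map_sub_le v hx hy
  have key : ∀ k, v (q k) ^ 2 ≤ v N := by
    intro k
    have : v (4 * q k ^ 2) ≤ v N := by
      have e : N = q 0 ^ 2 + q 1 ^ 2 + q 2 ^ 2 + q 3 ^ 2 := by
        rw [hN]; simp [dotProduct, Fin.sum_univ_four]; ring
      have h00 := hent 0 0
      have h11 := hent 1 1
      have h22 := hent 2 2
      fin_cases k
      · convert hadd (hadd (hadd le_rfl h00) h11) h22 using 2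
        simp [rotMat, e]; ring
      · convert hsub (hsub (hadd le_rfl h00) h11) h22 using 2
        simp [rotMat, e]; ring
      · convert hsub (hadd (hsub le_rfl h00) h11) h22 using 2
        simp [rotMat, e]; ring
      · convert hadd (hsub (hsub le_rfl h00) h11) h22 using 2
        simp [rotMat, e]; ring
    rwa [map_mul, h4, one_mul, map_pow] at this
  obtain ⟨k, hk⟩ : ∃ k, v N ≤ v (q k) ^ 2 := by
    by_contra! hcon
    have : v N < v N := by
      have e : N = ∑ k, q k ^ 2 := by
        rw [hN]; simp [dotProduct, pow_two]
      nth_rewrite 1 [e]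
      refine Valuation.map_sum_lt v ((Valuation.ne_zero_iff v).mpr hN0) fun k _ => ?_
      rw [map_pow]; exact hcon k
    exact lt_irrefl _ this
  exact ⟨v (q k), by rw [← pow_two]; exact le_antisymm hk (key k)⟩

end OKLattice

namespace OKLattice
variable {K : Type} [Field K]

/-- The quaternion `z` rotates `Λ` onto `Λ'`, up to sign. -/
def Moves (z : Fin 4 → K) (Λ Λ' : Submodule (𝓞 K) (Fin 3 → K)) : Prop :=
  ∃ G : Matrix (Fin 3) (Fin 3) K, IsRot z G ∧ (∀ x ∈ Λ, G.mulVec x ∈ Λ') ∧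
    ∀ y ∈ Λ', G.transpose.mulVec y ∈ Λ

lemma IsRot.mul_transpose {q : Fin 4 → K} {G : Matrix (Fin 3) (Fin 3) K} (hG : IsRot q G) :
    G * G.transpose = 1 := by
  simpa using hG.transpose.transpose_mul

lemma Moves.symm {z : Fin 4 → K} {Λ Λ' : Submodule (𝓞 K) (Fin 3 → K)} (h : Moves z Λ Λ') :
    Moves (quatConj z) Λ' Λ := by
  obtain ⟨G, hG, h1, h2⟩ := h
  exact ⟨_, hG.transpose, h2, by simpa using h1⟩

lemma Moves.trans {z z' : Fin 4 → K} {Λ Λ' Λ'' : Submodule (𝓞 K) (Fin 3 → K)} (h : Moves z Λ Λ')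
    (h' : Moves z' Λ' Λ'') : Moves (quatMul z' z) Λ Λ'' := by
  obtain ⟨G, hG, h1, h2⟩ := h
  obtain ⟨G', hG', h1', h2'⟩ := h'
  refine ⟨_, hG'.mul hG, fun x hx => ?_, fun y hy => ?_⟩
  · rw [← Matrix.mulVec_mulVec]; exact h1' _ (h1 _ hx)
  · rw [Matrix.transpose_mul, ← Matrix.mulVec_mulVec]; exact h2 _ (h2' _ hy)

lemma IsRot.eq_or_neg {q : Fin 4 → K} {G H : Matrix (Fin 3) (Fin 3) K} (hG : IsRot q G)
    (hH : IsRot q H) : G = H ∨ G = -H := by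
  have hinj := smul_right_injective (Matrix (Fin 3) (Fin 3) K) hG.1
  rcases hG.2 with h | h <;> rcases hH.2 with h' | h'
  · exact Or.inl (hinj (h.trans h'.symm))
  · exact Or.inr (hinj (by simp only [smul_neg, h', h, neg_neg]))
  · exact Or.inr (hinj (by simp only [smul_neg, h', h]))
  · exact Or.inl (hinj (h.trans h'.symm))

lemma Moves.unique {z : Fin 4 → K} {Λ Λ' Λ'' : Submodule (𝓞 K) (Fin 3 → K)} (h : Moves z Λ Λ')
    (h' : Moves z Λ Λ'') : Λ' ≤ Λ'' := by
  obtain ⟨G, hG, h1, h2⟩ := h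
  obtain ⟨G', hG', h1', h2'⟩ := h'
  intro y hy
  have hy' : y = G.mulVec (G.transpose.mulVec y) := by
    rw [Matrix.mulVec_mulVec, hG.mul_transpose, Matrix.one_mulVec]
  rw [hy']
  rcases hG.eq_or_neg hG' with h | h <;> rw [h]
  · rw [← h]
    nth_rewrite 1 [h]
    exact h1' _ (h2 _ hy)
  · rw [← h]
    nth_rewrite 1 [h]
    rw [Matrix.neg_mulVec]
    exact neg_mem (h1' _ (h2 _ hy))

lemma IsRot.smul {q : Fin 4 → K} {G : Matrix (Fin 3) (Fin 3) K} (hG : IsRot q G) {c : K}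
    (hc : c ≠ 0) : IsRot (c • q) G := by
  have h1 : (c • q) ⬝ᵥ (c • q) = c ^ 2 * (q ⬝ᵥ q) := by
    rw [smul_dotProduct, dotProduct_smul, smul_eq_mul, smul_eq_mul]; ring
  have h2 : rotMat (c • q) = c ^ 2 • rotMat q := by
    ext i j
    fin_cases i <;> fin_cases j <;> simp [rotMat] <;> ring
  refine ⟨by rw [h1]; exact mul_ne_zero (pow_ne_zero 2 hc) hG.1, ?_⟩
  rw [h1, h2, mul_smul]
  rcases hG.2 with h | h <;> rw [h] <;> simp

lemma Moves.smul {z : Fin 4 → K} {Λ Λ' : Submodule (𝓞 K) (Fin 3 → K)} (h : Moves z Λ Λ') {c : K}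
    (hc : c ≠ 0) : Moves (c • z) Λ Λ' :=
  let ⟨G, hG, h1, h2⟩ := h
  ⟨G, hG.smul hc, h1, h2⟩

variable {a : 𝓞 K} {w : Fin 3 → 𝓞 K}

variable [NumberField K]
open IsDedekindDomain

/-- At a prime not dividing two, the neighbour contains a rotated copy of the standard lattice. -/
lemma NbrData.exists_local (hd : NbrData a w) (P : HeightOneSpectrum (𝓞 K))
    (h2 : (2 : 𝓞 K) ∉ P.asIdeal) :
    ∃ (q : Fin 4 → K) (H : Matrix (Fin 3) (Fin 3) K) (ε : 𝓞 K), IsRot q H ∧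
      IsSquare (P.valuation K ((q ⬝ᵥ q) * algebraMap (𝓞 K) K a)) ∧
      P.valuation K (algebraMap (𝓞 K) K ε) = 1 ∧
      ∀ i, algebraMap (𝓞 K) K ε • H.mulVec (Pi.single i 1) ∈ nbr a w := by
  by_cases ha : a ∈ P.asIdeal
  · obtain ⟨r, d, hr⟩ := hd.exists_unit
    obtain ⟨c, hc⟩ := hd.dvd_self
    set ε : 𝓞 K := c * a + 2 * (r ⬝ᵥ w) + a * (r ⬝ᵥ r) with hε
    set y : Fin 3 → 𝓞 K := w + a • r with hy
    have hyy : y ⬝ᵥ y = a * ε := by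
      rw [hy]
      simp only [add_dotProduct, dotProduct_add, smul_dotProduct, dotProduct_smul, smul_eq_mul, hc,
        dotProduct_comm w r]
      ring
    have hv : P.valuation K (algebraMap (𝓞 K) K ε) = 1 := by
      rw [HeightOneSpectrum.valuation_eq_one_iff_notMem]
      intro hmem
      apply h2
      have : (2 : 𝓞 K) = ε - a * (c + 2 * d + (r ⬝ᵥ r)) := by
        rw [hε]; linear_combination -2 * hr
      rw [this]
      exact sub_mem hmem (Ideal.mul_mem_right _ _ ha)
    have hε0 : ε ≠ 0 := by
      rintro h; rw [h] at hv; simp at hv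
    have hε0' : algebraMap (𝓞 K) K ε ≠ 0 := by simpa using hε0
    have haK := hd.coe_ne_zero
    have hYY : toK y ⬝ᵥ toK y = algebraMap (𝓞 K) K a * algebraMap (𝓞 K) K ε := by
      rw [toK_dot, hyy, map_mul]
    have hY0 : toK y ⬝ᵥ toK y ≠ 0 := by rw [hYY]; exact mul_ne_zero haK hε0'
    refine ⟨_, _, ε, IsRot.refl hY0, ?_, hv, ?_⟩
    · have hd : ![0, toK y 0, toK y 1, toK y 2] ⬝ᵥ ![0, toK y 0, toK y 1, toK y 2] =
          toK y ⬝ᵥ toK y := by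
        simp [dotProduct, Fin.sum_univ_four, Fin.sum_univ_three]
      rw [hd, hYY]
      refine ⟨P.valuation K (algebraMap (𝓞 K) K a), ?_⟩
      rw [map_mul, map_mul, hv, mul_one]
    · intro i
      rw [reflMat_mulVec]
      refine ⟨ε • Pi.single i 1 - (2 * y i) • r, -2 * y i, ?_, ?_⟩
      · rw [sub_dotProduct, smul_dotProduct, smul_dotProduct, single_dotProduct, hy, hε]
        simp only [Pi.add_apply, Pi.smul_apply, smul_eq_mul]
        refine ⟨w i * (c + (r ⬝ᵥ r)) - 2 * r i * (r ⬝ᵥ w), ?_⟩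
        ring
      · ext j
        rw [hYY]
        simp only [toK, dotProduct_single, Pi.smul_apply, Pi.sub_apply, Pi.add_apply, smul_eq_mul,
          map_sub, map_mul, map_neg, map_ofNat, hy, map_add, mul_one]
        have : algebraMap (𝓞 K) K ((Pi.single i 1 : Fin 3 → 𝓞 K) j) =
            (Pi.single i 1 : Fin 3 → K) j := by
          by_cases hij : j = i
          · subst hij; simp
          · simp [hij]
        rw [this]
        field_simp
        ring
  · refine ⟨_, 1, a, IsRot.one, ?_, ?_, ?_⟩
    · have : P.valuation K (algebraMap (𝓞 K) K a) = 1 :=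
        (HeightOneSpectrum.valuation_eq_one_iff_notMem _).mpr ha
      simp [dotProduct, Fin.sum_univ_four, this]
    · exact (HeightOneSpectrum.valuation_eq_one_iff_notMem _).mpr ha
    · intro i
      convert single_mem_nbr a w i using 1
      rw [Matrix.one_mulVec, ← Pi.single_smul, smul_eq_mul, mul_one]

lemma isSquare_of_mul_eq {Γ : Type*} [CommGroupWithZero Γ] {q q' z a a' s : Γ} (hq : q ≠ 0)
    (hq' : q' ≠ 0) (h : q' * (z * q) * (q * a) * (q' * a') = s * s) : IsSquare (z * (a * a')) := by
  refine ⟨s * q⁻¹ * q'⁻¹, ?_⟩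
  field_simp
  rw [pow_two s, ← h]
  simp only [pow_two]
  ac_rfl

/-- The norm of a quaternion moving one neighbour to another has controlled parity away from 2. -/
lemma Moves.isSquare_valuation (hd : NbrData a w) {a' : 𝓞 K} {w' : Fin 3 → 𝓞 K}
    (hd' : NbrData a' w') {z : Fin 4 → K} (hz : Moves z (nbr a w) (nbr a' w'))
    (P : HeightOneSpectrum (𝓞 K)) (h2 : (2 : 𝓞 K) ∉ P.asIdeal) :
    IsSquare (P.valuation K ((z ⬝ᵥ z) * algebraMap (𝓞 K) K (a * a'))) := by
  obtain ⟨q, H, ε, hq, hsq, hε, hmem⟩ := hd.exists_local P h2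
  obtain ⟨q', H', ε', hq', hsq', hε', hmem'⟩ := hd'.exists_local P h2
  obtain ⟨G, hG, h1, -⟩ := hz
  have hrot := hq'.transpose.mul (hG.mul hq)
  have hsqv := hrot.isSquare_valuation (P.valuation K)
    (by rw [← map_ofNat (algebraMap (𝓞 K) K) 2]
        exact (HeightOneSpectrum.valuation_eq_one_iff_notMem (K := K) P).mpr h2) (by
      intro i j
      obtain ⟨c, hc⟩ := hd'.integral _ (hmem' i) _ (h1 _ (hmem j))
      rw [dotForm_apply, Matrix.mulVec_smul, smul_dotProduct, dotProduct_smul, smul_eq_mul,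
        smul_eq_mul] at hc
      have he : H'.mulVec (Pi.single i 1) ⬝ᵥ G.mulVec (H.mulVec (Pi.single j 1)) =
          (H'.transpose * (G * H)) i j := by
        rw [Matrix.mulVec_mulVec, ← Matrix.vecMul_transpose, ← Matrix.dotProduct_mulVec,
          Matrix.mulVec_mulVec]
        simp
      have h3 := congr_arg (P.valuation K) hc
      rw [map_mul, map_mul, hε, hε', one_mul, one_mul, he] at h3
      rw [← h3]
      exact P.valuation_le_one c)
  rw [quatMul_dot_self, quatMul_dot_self, quatConj_dot_self] at hsqv
  have hv : ∀ {x : K}, x ≠ 0 → P.valuation K x ≠ 0 := fun hx => (Valuation.ne_zero_iff _).mpr hx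
  have key := (hsqv.mul hsq).mul hsq'
  obtain ⟨s, hs⟩ := key
  have hq0 := hv hq.1
  have hq0' := hv hq'.1
  simp only [map_mul] at hs ⊢
  exact isSquare_of_mul_eq hq0 hq0' hs

end OKLattice

namespace OKLattice
variable {K : Type} [Field K] [NumberField K]
open IsDedekindDomain

lemma even_of_isSquare_exp {n : ℕ} (h : IsSquare (WithZero.exp (-(n : ℤ)))) : Even n := by
  obtain ⟨s, hs⟩ := h
  have hs0 : s ≠ 0 := by
    rintro rfl
    simp at hs
  have := congr_arg WithZero.log hs
  rw [WithZero.log_exp, WithZero.log_mul hs0 hs0] at this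
  have h2 : Even (-(n : ℤ)) := ⟨_, this⟩
  simpa using h2

/-- An algebraic integer with even valuations generates the square of an ideal. -/
lemma exists_ideal_sq {c : 𝓞 K} (hc : c ≠ 0) (h : ∀ P : HeightOneSpectrum (𝓞 K),
    IsSquare (P.valuation K (algebraMap (𝓞 K) K c))) : ∃ J : Ideal (𝓞 K), J * J = Ideal.span {c} := by
  have hI : Ideal.span {c} ≠ 0 := by simpa using hc
  set e : HeightOneSpectrum (𝓞 K) → ℕ := fun P =>
    (Associates.mk P.asIdeal).count (Associates.mk (Ideal.span {c})).factors with he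
  have hev : ∀ P, e P = e P / 2 + e P / 2 := by
    intro P
    have h1 := h P
    rw [HeightOneSpectrum.valuation_of_algebraMap, HeightOneSpectrum.intValuation_if_neg _ hc] at h1
    have := even_of_isSquare_exp h1
    rw [← Nat.two_mul, Nat.two_mul_div_two_of_even this]
  refine ⟨∏ᶠ P : HeightOneSpectrum (𝓞 K), P.asIdeal ^ (e P / 2), ?_⟩
  have hfin : (Function.mulSupport fun P : HeightOneSpectrum (𝓞 K) => P.asIdeal ^ (e P / 2)).Finite := by
    refine (Ideal.hasFiniteMulSupport hI).subset fun P hP => ?_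
    contrapose! hP
    have h0 : e P = 0 := by
      by_contra h0
      simp only [Function.mem_mulSupport, not_not, HeightOneSpectrum.maxPowDividing] at hP
      rw [Ideal.one_eq_top] at hP
      have := Ideal.pow_le_self (I := P.asIdeal) h0
      exact P.isPrime.ne_top (top_le_iff.mp (hP ▸ this))
    simp [h0]
  rw [← finprod_mul_distrib hfin hfin]
  conv_rhs => rw [← Ideal.finprod_heightOneSpectrum_factorization hI]
  refine finprod_congr fun P => ?_
  rw [← pow_add, ← hev]
  rfl

/-- A totally positive element with even valuations is, up to squares, a totally positive integer
generating the square of an ideal. -/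
lemma exists_integer_of_even {x : K} (hx : ∀ σ : K →+* ℝ, 0 < σ x) (hx0 : x ≠ 0)
    (h : ∀ P : HeightOneSpectrum (𝓞 K), IsSquare (P.valuation K x)) :
    ∃ (c : 𝓞 K) (J : Ideal (𝓞 K)) (m : K), m ≠ 0 ∧ algebraMap (𝓞 K) K c = x * m ^ 2 ∧
      (∀ σ : K →+* ℝ, 0 < σ (algebraMap (𝓞 K) K c)) ∧ J * J = Ideal.span {c} := by
  obtain ⟨p, q, hq, hpq⟩ := IsFractionRing.div_surjective (A := 𝓞 K) x
  have hq0 : algebraMap (𝓞 K) K q ≠ 0 := by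
    simpa using nonZeroDivisors.ne_zero hq
  have hc : algebraMap (𝓞 K) K (p * q) = x * (algebraMap (𝓞 K) K q) ^ 2 := by
    rw [← hpq, map_mul]; field_simp
  have hc0 : p * q ≠ 0 := by
    intro h0
    rw [h0, map_zero, eq_comm] at hc
    exact mul_ne_zero hx0 (pow_ne_zero 2 hq0) hc
  obtain ⟨J, hJ⟩ := exists_ideal_sq hc0 (fun P => by
    rw [hc, map_mul, map_pow]
    exact (h P).mul ⟨_, pow_two _⟩)
  refine ⟨p * q, J, _, hq0, hc, fun σ => ?_, hJ⟩
  rw [hc, map_mul, map_pow]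
  have : σ (algebraMap (𝓞 K) K q) ≠ 0 := by simpa using hq0
  exact mul_pos (hx σ) (by positivity)

end OKLattice

namespace OKLattice
open IsDedekindDomain

/-- The data indexing the ternary neighbours that we count. -/
structure Item (K : Type) [Field K] where
  a : 𝓞 K
  u : 𝓞 K
  ne_zero : a ≠ 0
  pos : ∀ σ : K →+* ℝ, 0 < σ (algebraMap (𝓞 K) K a)
  odd : IsCoprime a 2

instance (K : Type) [Field K] : Nonempty (Item K) :=
  ⟨⟨1, 0, one_ne_zero, fun σ => by simp, isCoprime_one_left⟩⟩

variable {K : Type} [Field K] [NumberField K]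

/-- The first auxiliary square root for the modulus `a`. -/
def Item.s (i : Item K) : 𝓞 K := by
  classical
  exact if h : i.a ≠ 0 ∧ IsCoprime i.a 2 then (exists_sq_dvd i.a h.1 h.2).choose else 0

/-- The second auxiliary square root for the modulus `a`. -/
def Item.t (i : Item K) : 𝓞 K := by
  classical
  exact if h : i.a ≠ 0 ∧ IsCoprime i.a 2 then (exists_sq_dvd i.a h.1 h.2).choose_spec.choose else 0

lemma Item.s_congr {i j : Item K} (h : i.a = j.a) : i.s = j.s := by
  obtain ⟨a, u, _, _, _⟩ := i
  obtain ⟨a', u', _, _, _⟩ := j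
  obtain rfl : a = a' := h
  rfl

lemma Item.t_congr {i j : Item K} (h : i.a = j.a) : i.t = j.t := by
  obtain ⟨a, u, _, _, _⟩ := i
  obtain ⟨a', u', _, _, _⟩ := j
  obtain rfl : a = a' := h
  rfl

lemma Item.dvd_st (i : Item K) : i.a ^ 2 ∣ i.s ^ 2 + i.t ^ 2 + 1 := by
  have h : i.a ≠ 0 ∧ IsCoprime i.a 2 := ⟨i.ne_zero, i.odd⟩
  simp only [Item.s, Item.t, dif_pos h]
  exact (exists_sq_dvd i.a h.1 h.2).choose_spec.choose_spec

/-- The neighbour attached to an item. -/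
def Item.lat (i : Item K) : Submodule (𝓞 K) (Fin 3 → K) := nbr i.a (wvec i.s i.t i.u)

lemma Item.data (i : Item K) : NbrData i.a (wvec i.s i.t i.u) :=
  nbrData_wvec i.ne_zero i.odd i.dvd_st i.u

lemma Item.dvd_of_lat_eq {i j : Item K} (ha : i.a = j.a) (h : i.lat = j.lat) : i.a ∣ i.u - j.u := by
  rw [Item.lat, Item.lat, ← ha, ← Item.s_congr ha, ← Item.t_congr ha] at h
  exact dvd_sub_of_nbr_eq i.ne_zero i.odd i.dvd_st h

lemma isSquare_mul_of_not {x y : WithZero (Multiplicative ℤ)} (hx : ¬ IsSquare x)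
    (hy : ¬ IsSquare y) : IsSquare (x * y) := by
  have hx0 : x ≠ 0 := by rintro rfl; exact hx (IsSquare.zero)
  have hy0 : y ≠ 0 := by rintro rfl; exact hy (IsSquare.zero)
  have key : ∀ {z : WithZero (Multiplicative ℤ)}, z ≠ 0 → Even (WithZero.log z) → IsSquare z := by
    rintro z hz ⟨k, hk⟩
    refine ⟨WithZero.exp k, ?_⟩
    rw [← WithZero.exp_log hz, hk, WithZero.exp_add]
  refine key (mul_ne_zero hx0 hy0) ?_
  rw [WithZero.log_mul hx0 hy0]
  have h1 : ¬ Even (WithZero.log x) := fun h => hx (key hx0 h)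
  have h2 : ¬ Even (WithZero.log y) := fun h => hy (key hy0 h)
  rw [Int.not_even_iff_odd] at h1 h2
  exact h1.add_odd h2

instance finite_primes_two : Finite {P : HeightOneSpectrum (𝓞 K) // (2 : 𝓞 K) ∈ P.asIdeal} := by
  have h : (Ideal.span {(2 : 𝓞 K)}) ≠ 0 := by simp
  refine (Set.Finite.subset (Ideal.finite_factors h) fun P hP => ?_).to_subtype
  rw [Set.mem_setOf_eq, Ideal.dvd_span_singleton]
  exact hP

lemma exists_rational_of_isometric {i j : Item K} (hi : Isometric i.data.lattice j.data.lattice)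
    (h : TotallyReal K) : ∃ z, Moves z i.lat j.lat := by
  obtain ⟨σ⟩ := h.nonempty_emb
  obtain ⟨g, hg, h1, h2⟩ := i.data.exists_isometry j.data hi
  have hG : ∀ x, (LinearMap.toMatrix' g).mulVec x = g x := fun x => by
    rw [← Matrix.toLin'_apply, Matrix.toLin'_toMatrix']
  obtain ⟨z, hz⟩ := exists_isRot σ (LinearMap.toMatrix' g) (fun x y => by rw [hG, hG, hg])
  refine ⟨z, _, hz, fun x hx => by rw [hG]; exact h1 x hx, fun y hy => ?_⟩
  obtain ⟨x, hx, rfl⟩ := h2 y hy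
  rw [← hG, Matrix.mulVec_mulVec, hz.transpose_mul, Matrix.one_mulVec]
  exact hx

/-- The classification of items by finitely many codes. -/
theorem exists_item_code (h : TotallyReal K) (L : OKLattice K)
    (hL : ∀ T : OKLattice K, T.rank ≤ 3 → L.Represents T) :
    ∃ (Γ : Type) (_ : Fintype Γ) (f : Item K → Γ),
      Fintype.card Γ ≤ 4 ^ Module.finrank (𝓞 K) L.carrier *
        2 ^ Nat.card {P : HeightOneSpectrum (𝓞 K) // (2 : 𝓞 K) ∈ P.asIdeal} ∧
      ∀ i j, f i = f j → ∃ z, Moves z i.lat j.lat ∧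
        z ⬝ᵥ z = algebraMap (𝓞 K) K j.a / algebraMap (𝓞 K) K i.a := by
  classical
  obtain ⟨Γ, hΓ, code, hcard, hcode⟩ := exists_code h L
  set R := Module.finrank (𝓞 K) L.carrier
  set T := {P : HeightOneSpectrum (𝓞 K) // (2 : 𝓞 K) ∈ P.asIdeal}
  haveI : Fintype T := Fintype.ofFinite T
  let c₁ : Item K → Γ := fun i => code ⟨i.data.lattice, i.data.isUnimodular, hL _ i.data.rank_le⟩
  have hc₁ : ∀ i j, c₁ i = c₁ j → ∃ z, Moves z i.lat j.lat := fun i j hij =>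
    exists_rational_of_isometric (hcode _ _ hij) h
  let r : Item K → Item K := fun i => Function.invFun c₁ (c₁ i)
  have hr : ∀ i, c₁ (r i) = c₁ i := fun i => Function.invFun_eq ⟨i, rfl⟩
  choose z hz using fun i => hc₁ _ _ (hr i)
  have hz0 : ∀ i, z i ⬝ᵥ z i ≠ 0 := fun i => let ⟨_, hG, _⟩ := hz i; hG.1
  let κ : Item K → K := fun i => (z i ⬝ᵥ z i) * algebraMap (𝓞 K) K ((r i).a * i.a)
  have ha0 : ∀ i : Item K, algebraMap (𝓞 K) K i.a ≠ 0 := fun i => i.data.coe_ne_zero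
  have hκ0 : ∀ i, κ i ≠ 0 := fun i => by
    simp only [κ, map_mul]
    exact mul_ne_zero (hz0 i) (mul_ne_zero (ha0 _) (ha0 _))
  have hκpos : ∀ i (σ : K →+* ℝ), 0 < σ (κ i) := fun i σ => by
    simp only [κ, map_mul]
    refine mul_pos ?_ (mul_pos ((r i).pos σ) (i.pos σ))
    refine lt_of_le_of_ne ?_ (Ne.symm ((map_ne_zero σ).mpr (hz0 i)))
    simp only [dotProduct, map_sum, map_mul]
    exact Finset.sum_nonneg fun k _ => mul_self_nonneg _
  let c₂ : Item K → Γ × (T → Bool) := fun i =>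
    (c₁ i, fun P => decide (IsSquare (P.1.valuation K (κ i))))
  let r₂ : Item K → Item K := fun i => Function.invFun c₂ (c₂ i)
  have hr₂ : ∀ i, c₂ (r₂ i) = c₂ i := fun i => Function.invFun_eq ⟨i, rfl⟩
  have hsq : ∀ i (P : HeightOneSpectrum (𝓞 K)), IsSquare (P.valuation K (κ i * κ (r₂ i))) := by
    intro i P
    rw [map_mul]
    by_cases hP : (2 : 𝓞 K) ∈ P.asIdeal
    · have h1 := congr_fun (congr_arg Prod.snd (hr₂ i)) ⟨P, hP⟩
      simp only [c₂, decide_eq_decide] at h1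
      by_cases hs : IsSquare (P.valuation K (κ i))
      · exact hs.mul (h1.mpr hs)
      · exact isSquare_mul_of_not hs (fun h2 => hs (h1.mp h2))
    · exact (Moves.isSquare_valuation (r i).data i.data (hz i) P hP).mul
        (Moves.isSquare_valuation (r (r₂ i)).data (r₂ i).data (hz (r₂ i)) P hP)
  choose c J m hm hc hcpos hJ using fun i => exists_integer_of_even
    (fun σ => by rw [map_mul]; exact mul_pos (hκpos i σ) (hκpos (r₂ i) σ))
    (mul_ne_zero (hκ0 i) (hκ0 (r₂ i))) (hsq i)
  let c₃ : Item K → Γ := fun i => code ⟨ofIdeal (c i) (hcpos i) (J i) (hJ i),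
    isUnimodular_ofIdeal (c i) (hcpos i) (J i) (hJ i) h,
    hL _ ((rank_ofIdeal_le (c i) (hcpos i) (J i) (hJ i)).trans (by norm_num))⟩
  refine ⟨(Γ × (T → Bool)) × Γ, inferInstance, fun i => (c₂ i, c₃ i), ?_, ?_⟩
  · rw [Fintype.card_prod, Fintype.card_prod, Fintype.card_fun, Fintype.card_bool,
      Nat.card_eq_fintype_card]
    calc _ ≤ 2 ^ R * 2 ^ Fintype.card T * 2 ^ R := by gcongr
      _ = _ := by rw [show 4 = 2 * 2 by norm_num, mul_pow]; ring
  · intro i j hij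
    simp only [Prod.mk.injEq] at hij
    obtain ⟨h2, h3⟩ := hij
    have h1 : c₁ i = c₁ j := congr_arg Prod.fst h2
    have hrr : r i = r j := by simp only [r, h1]
    have hrr₂ : r₂ i = r₂ j := by simp only [r₂, h2]
    obtain ⟨y, hy⟩ := exists_sq_of_isometric_ofIdeal (c i) (hcpos i) (J i) (hJ i) h (c j) (hcpos j)
      (J j) (hJ j) (hcode _ _ h3)
    rw [map_mul, hc, hc, ← hrr₂] at hy
    have hzi := hz i
    have hzj := hz j
    rw [← hrr] at hzj
    have hmv := hzi.symm.trans hzj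
    have hA := ha0 i
    have hB := ha0 j
    have hC := ha0 (r i)
    have hki : κ i = (z i ⬝ᵥ z i) * (algebraMap (𝓞 K) K (r i).a * algebraMap (𝓞 K) K i.a) := by
      simp only [κ, map_mul]
    have hkj : κ j = (z j ⬝ᵥ z j) * (algebraMap (𝓞 K) K (r i).a * algebraMap (𝓞 K) K j.a) := by
      simp only [κ, map_mul, hrr]
    have hk0 := hκ0 (r₂ i)
    have hy0 : y ≠ 0 := by
      rintro rfl
      rw [mul_zero] at hy
      exact mul_ne_zero (mul_ne_zero (mul_ne_zero (hκ0 i) hk0) (pow_ne_zero 2 (hm i)))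
        (mul_ne_zero (mul_ne_zero (hκ0 j) hk0) (pow_ne_zero 2 (hm j))) hy
    have hmi := hm i
    have hmj := hm j
    set e := algebraMap (𝓞 K) K j.a * algebraMap (𝓞 K) K (r i).a * κ (r₂ i) * m i * m j / y with he
    have he0 : e ≠ 0 := by
      rw [he]
      exact div_ne_zero (mul_ne_zero (mul_ne_zero (mul_ne_zero (mul_ne_zero hB hC) hk0) hmi) hmj) hy0
    refine ⟨_, hmv.smul he0, ?_⟩
    rw [smul_dotProduct, dotProduct_smul, smul_eq_mul, smul_eq_mul, quatMul_dot_self,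
      quatConj_dot_self, he]
    field_simp
    rw [pow_two y, ← hy, hki, hkj]
    ring

end OKLattice

namespace OKLattice

variable {K : Type} [Field K] [NumberField K]

lemma exists_of_sq_eq {x : K} {c : 𝓞 K} (h : x ^ 2 = algebraMap (𝓞 K) K c) :
    ∃ e : 𝓞 K, algebraMap (𝓞 K) K e = x := by
  have hx : IsIntegral (𝓞 K) x := by
    apply IsIntegral.of_pow (n := 2) two_pos
    rw [h]
    exact isIntegral_algebraMap
  exact IsIntegrallyClosed.isIntegral_iff.mp hx

lemma Moves.exists_entry {a a' : 𝓞 K} {w w' : Fin 3 → 𝓞 K} (hd' : NbrData a' w')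
    {G : Matrix (Fin 3) (Fin 3) K} (hG : ∀ x ∈ nbr a w, G.mulVec x ∈ nbr a' w') (k : Fin 3) :
    ∃ c : 𝓞 K, algebraMap (𝓞 K) K c =
      algebraMap (𝓞 K) K a * algebraMap (𝓞 K) K a' * G k k := by
  obtain ⟨c, hc⟩ := hd'.integral _ (hG _ (single_mem_nbr a w k)) _ (single_mem_nbr a' w' k)
  refine ⟨c, hc.trans ?_⟩
  simp [dotForm_apply, Matrix.mulVec_single, Algebra.smul_def]
  ring

/-- The elements moving a fixed neighbour to other neighbours have integral inner products, up to
a fixed denominator. -/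
theorem Item.pair_integral {i₀ i j : Item K} {z z' : Fin 4 → K} (hi : Moves z i₀.lat i.lat)
    (hj : Moves z' i₀.lat j.lat)
    (hz : z ⬝ᵥ z = algebraMap (𝓞 K) K i.a / algebraMap (𝓞 K) K i₀.a)
    (hz' : z' ⬝ᵥ z' = algebraMap (𝓞 K) K j.a / algebraMap (𝓞 K) K i₀.a) :
    ∃ c : 𝓞 K, algebraMap (𝓞 K) K c = 2 * algebraMap (𝓞 K) K i₀.a * (z ⬝ᵥ z') := by
  obtain ⟨G, hrot, hG, -⟩ := hi.symm.trans hj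
  have hN := quatMul_dot_self z' (quatConj z)
  have hre := quatMul_conj_re z' z
  rw [quatConj_dot_self, hz, hz'] at hN
  set y := quatMul z' (quatConj z)
  have ht := trace_rotMat y
  have h0 : algebraMap (𝓞 K) K i₀.a ≠ 0 := i₀.data.coe_ne_zero
  have hent : ∀ k, ∃ c : 𝓞 K, algebraMap (𝓞 K) K c =
      algebraMap (𝓞 K) K i.a * algebraMap (𝓞 K) K j.a * G k k :=
    Moves.exists_entry j.data hG
  choose c hc using hent
  have htr : algebraMap (𝓞 K) K (∑ k, c k) =
      algebraMap (𝓞 K) K i.a * algebraMap (𝓞 K) K j.a * G.trace := by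
    rw [map_sum, Matrix.trace, Finset.mul_sum]
    exact Finset.sum_congr rfl fun k _ => hc k
  have key : ∃ e : 𝓞 K, (2 * algebraMap (𝓞 K) K i₀.a * (z ⬝ᵥ z')) ^ 2 = algebraMap (𝓞 K) K e := by
    rw [dotProduct_comm z z', ← hre]
    have hsq : (2 * algebraMap (𝓞 K) K i₀.a * y 0) ^ 2 =
        algebraMap (𝓞 K) K i₀.a ^ 2 * ((y ⬝ᵥ y) + (rotMat y).trace) := by
      rw [ht]; ring
    rcases hrot.2 with h | h
    · refine ⟨i.a * j.a + ∑ k, c k, ?_⟩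
      rw [hsq, ← h, Matrix.trace_smul, hN, map_add, map_mul, htr, smul_eq_mul]
      field_simp
    · refine ⟨i.a * j.a - ∑ k, c k, ?_⟩
      have h' : rotMat y = -((y ⬝ᵥ y) • G) := by rw [h, neg_neg]
      rw [hsq, h', Matrix.trace_neg, Matrix.trace_smul, hN, map_sub, map_mul, htr, smul_eq_mul]
      field_simp
      ring
  obtain ⟨e, he⟩ := key
  exact exists_of_sq_eq he

end OKLattice

namespace OKLattice
open MeasureTheory Filter Topology Pointwise

lemma tendsto_card_lattice {ι : Type} [Fintype ι] [DecidableEq ι] (A : Matrix ι ι ℝ) (hA : A.det ≠ 0)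
    {S : Set (ι → ℝ)} (hconv : Convex ℝ S) (hb : Bornology.IsBounded S) (hm : MeasurableSet S) :
    Tendsto (fun n : ℕ => (Nat.card {c : ι → ℤ // A.mulVec (fun i => (c i : ℝ)) ∈ (n : ℝ) • S} : ℝ) /
      (n : ℝ) ^ Fintype.card ι) atTop (𝓝 (volume.real S / |A.det|)) := by
  set f := Matrix.toLin' A with hf
  have hdet : LinearMap.det f ≠ 0 := by rw [hf, LinearMap.det_toLin']; exact hA
  have hunit : IsUnit A.det := isUnit_iff_ne_zero.mpr hA
  have hcont : Continuous f := LinearMap.continuous_of_finiteDimensional f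
  have hconv' : Convex ℝ (f ⁻¹' S) := hconv.linear_preimage f
  have hm' : MeasurableSet (f ⁻¹' S) := hcont.measurable hm
  have hb' : Bornology.IsBounded (f ⁻¹' S) := by
    let g := Matrix.toLin' A⁻¹
    have hg : Continuous g := LinearMap.continuous_of_finiteDimensional g
    have : f ⁻¹' S ⊆ g '' closure S := by
      intro x hx
      refine ⟨f x, subset_closure hx, ?_⟩
      simp [f, g, Matrix.mulVec_mulVec, Matrix.nonsing_inv_mul _ hunit]
    exact ((hb.isCompact_closure.image hg).isBounded).subset this
  have hvol : volume.real (f ⁻¹' S) = volume.real S / |A.det| := by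
    rw [Measure.real, Measure.addHaar_preimage_linearMap _ hdet, hf, LinearMap.det_toLin']
    rw [ENNReal.toReal_mul, ENNReal.toReal_ofReal (abs_nonneg _), abs_inv, Measure.real]
    ring
  have := tendsto_card_div_pow_atTop_volume (f ⁻¹' S) hb' hm'
    (hconv'.addHaar_frontier volume)
  rw [hvol] at this
  refine this.congr' ?_
  filter_upwards [eventually_gt_atTop 0] with n hn
  congr 2
  have hn' : (n : ℝ) ≠ 0 := by positivity
  refine (Nat.card_congr ?_).symm
  refine Equiv.ofBijective (fun c => ⟨(n : ℝ)⁻¹ • fun i => (c.1 i : ℝ), ?_, ?_⟩) ⟨?_, ?_⟩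
  · have := c.2
    rw [Set.mem_smul_set_iff_inv_smul_mem₀ hn'] at this
    simpa [f, Matrix.mulVec_smul] using this
  · have : NeZero n := ⟨hn.ne'⟩
    rw [← Submodule.coe_pointwise_smul, SetLike.mem_coe, BoxIntegral.unitPartition.mem_smul_span_iff]
    intro i
    exact ⟨c.1 i, by simp [hn']⟩
  · intro c c' h
    ext i
    have := congrFun (Subtype.ext_iff.mp h) i
    simpa [hn'] using this
  · rintro ⟨x, hx, hx'⟩
    have : NeZero n := ⟨hn.ne'⟩
    rw [← Submodule.coe_pointwise_smul, SetLike.mem_coe, BoxIntegral.unitPartition.mem_smul_span_iff] at hx'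
    choose c hc using hx'
    have hcx : (fun i => (c i : ℝ)) = (n : ℝ) • x := by
      ext i; simpa using hc i
    refine ⟨⟨c, ?_⟩, ?_⟩
    · rw [Set.mem_smul_set_iff_inv_smul_mem₀ hn', hcx, Matrix.mulVec_smul, inv_smul_smul₀ hn']
      simpa [f] using hx
    · apply Subtype.ext
      simp only [hcx]
      rw [inv_smul_smul₀ hn']

lemma finite_lattice {ι : Type} [Fintype ι] [DecidableEq ι] (A : Matrix ι ι ℝ) (hA : A.det ≠ 0)
    {S : Set (ι → ℝ)} (hb : Bornology.IsBounded S) :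
    {c : ι → ℤ | A.mulVec (fun i => (c i : ℝ)) ∈ S}.Finite := by
  have hunit : IsUnit A.det := isUnit_iff_ne_zero.mpr hA
  let g := Matrix.toLin' A⁻¹
  have hg : Continuous g := LinearMap.continuous_of_finiteDimensional g
  obtain ⟨M, hM⟩ := (hb.isCompact_closure.image hg).isBounded.exists_norm_le
  refine (Set.finite_Icc (fun _ : ι => -⌈M⌉) (fun _ => ⌈M⌉)).subset ?_
  intro c hc
  have h1 : ‖(fun i => (c i : ℝ))‖ ≤ M := by
    apply hM
    refine ⟨_, subset_closure hc, ?_⟩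
    simp [g, Matrix.mulVec_mulVec, Matrix.nonsing_inv_mul _ hunit]
  have h2 : ∀ i, |c i| ≤ ⌈M⌉ := by
    intro i
    have h3 := (norm_le_pi_norm (fun i => (c i : ℝ)) i).trans h1
    rw [Real.norm_eq_abs] at h3
    have h4 := h3.trans (Int.le_ceil M)
    exact_mod_cast h4
  exact ⟨fun i => (abs_le.mp (h2 i)).1, fun i => (abs_le.mp (h2 i)).2⟩

end OKLattice

namespace OKLattice
open scoped nonZeroDivisors

variable {K : Type} [Field K] [NumberField K]

instance instDecidableEqRealEmb : DecidableEq (K →+* ℝ) := Classical.decEq _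

/-- A `ℤ`-basis of a fractional ideal indexed by the real embeddings, with its determinant. -/
lemma exists_basis_det (h : TotallyReal K) (I : (FractionalIdeal (𝓞 K)⁰ K)ˣ) :
    ∃ b : (K →+* ℝ) → K, (∀ x, x ∈ Submodule.span ℤ (Set.range b) ↔ x ∈ (I : FractionalIdeal (𝓞 K)⁰ K)) ∧
      |(Matrix.of fun σ τ : K →+* ℝ => σ (b τ)).det| =
        √|(discr K : ℝ)| * (FractionalIdeal.absNorm I.1 : ℝ) := by
  classical
  let κ := Module.Free.ChooseBasisIndex ℤ (𝓞 K)
  have hκ : Fintype.card κ = Module.finrank ℚ K := by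
    rw [← Module.finrank_eq_card_chooseBasisIndex, RingOfIntegers.rank]
  let e₀ : κ ≃ (K →+* ℝ) := Fintype.equivOfCardEq (by rw [hκ, h.card_emb])
  let e : κ ≃ Module.Free.ChooseBasisIndex ℤ I := Fintype.equivOfCardEq (by
    rw [← Module.finrank_eq_card_chooseBasisIndex, ← Module.finrank_eq_card_chooseBasisIndex,
      fractionalIdeal_rank])
  let b' := (basisOfFractionalIdeal K I).reindex e.symm
  let W : (κ → K) → Matrix κ κ ℝ := fun c => Matrix.of fun i j => e₀ i (c j)
  have hW0 : (W (integralBasis K)).det ^ 2 = (discr K : ℝ) := by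
    let e' : κ ≃ (K →ₐ[ℚ] ℂ) := e₀.trans (h.embEquiv.symm.trans (RingHom.equivRatAlgHom K ℂ))
    have h1 := Algebra.discr_eq_det_embeddingsMatrixReindex_pow_two ℚ ℂ (integralBasis K) e'
    rw [← coe_discr] at h1
    have h2 : (Algebra.embeddingsMatrixReindex ℚ ℂ (integralBasis K) e') =
        ((W (integralBasis K)).map Complex.ofRealHom).transpose := by
      ext i j
      simp [Algebra.embeddingsMatrixReindex, Algebra.embeddingsMatrix, W, e', TotallyReal.embEquiv]
    rw [h2, Matrix.det_transpose, ← RingHom.mapMatrix_apply, ← RingHom.map_det] at h1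
    have h3 : ((discr K : ℝ) : ℂ) = (((W (integralBasis K)).det ^ 2 : ℝ) : ℂ) := by
      simpa using h1
    exact (Complex.ofReal_injective h3).symm
  have hmul : W b' = W (integralBasis K) * ((integralBasis K).toMatrix b').map (algebraMap ℚ ℝ) := by
    ext i j
    simp only [W, Matrix.of_apply, Matrix.mul_apply, Matrix.map_apply]
    conv_lhs => rw [← (integralBasis K).sum_toMatrix_smul_self b' j]
    rw [map_sum]
    refine Finset.sum_congr rfl fun k _ => ?_
    rw [Algebra.smul_def, map_mul, mul_comm]
    congr 1
    simp
  have hdet : |(W b').det| = √|(discr K : ℝ)| * (FractionalIdeal.absNorm I.1 : ℝ) := by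
    rw [hmul, Matrix.det_mul, abs_mul, ← hW0, abs_of_nonneg (sq_nonneg (W (integralBasis K)).det), Real.sqrt_sq_eq_abs]
    congr 1
    rw [← RingHom.mapMatrix_apply, ← RingHom.map_det]
    have := det_basisOfFractionalIdeal_eq_absNorm K I e
    rw [Module.Basis.det_apply] at this
    rw [← this]
    simp [b']
  refine ⟨fun τ => b' (e₀.symm τ), fun x => ?_, ?_⟩
  · rw [show Set.range (fun τ => b' (e₀.symm τ)) = Set.range (basisOfFractionalIdeal K I) from ?_,
      mem_span_basisOfFractionalIdeal]
    · rfl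
    · ext y
      constructor
      · rintro ⟨τ, rfl⟩; exact ⟨e (e₀.symm τ), by simp [b']⟩
      · rintro ⟨k, rfl⟩; exact ⟨e₀ (e.symm k), by simp [b']⟩
  · rw [← hdet, ← Matrix.det_submatrix_equiv_self e₀.symm (W b')]
    congr 2
    refine Matrix.ext fun σ τ => ?_
    simp [W]

end OKLattice

namespace OKLattice

variable {K : Type} [Field K] [NumberField K]

/-- Integrality of the scaled dot product on a set. -/
def DotIntegral (κ : 𝓞 K) (Z : Set (Fin 4 → K)) : Prop :=
  ∀ x ∈ Z, ∀ y ∈ Z, ∃ c : 𝓞 K, algebraMap (𝓞 K) K c = algebraMap (𝓞 K) K κ * (x ⬝ᵥ y)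

lemma DotIntegral.span {κ : 𝓞 K} {Z : Set (Fin 4 → K)} (hZ : DotIntegral κ Z) :
    DotIntegral κ (Submodule.span (𝓞 K) Z : Set (Fin 4 → K)) := by
  have h1 : ∀ x ∈ Z, ∀ y ∈ Submodule.span (𝓞 K) Z, ∃ c : 𝓞 K,
      algebraMap (𝓞 K) K c = algebraMap (𝓞 K) K κ * (x ⬝ᵥ y) := by
    intro x hx y hy
    induction hy using Submodule.span_induction with
    | mem y hy => exact hZ x hx y hy
    | zero => exact ⟨0, by simp⟩
    | add y z _ _ hy hz =>
      obtain ⟨c, hc⟩ := hy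
      obtain ⟨d, hd⟩ := hz
      exact ⟨c + d, by rw [map_add, hc, hd, dotProduct_add]; ring⟩
    | smul r y _ hy =>
      obtain ⟨c, hc⟩ := hy
      exact ⟨r * c, by rw [map_mul, hc, dotProduct_smul, Algebra.smul_def]; ring⟩
  intro x hx y hy
  simp only [SetLike.mem_coe] at hx hy
  induction hx using Submodule.span_induction with
  | mem x hx => exact h1 x hx y hy
  | zero => exact ⟨0, by simp⟩
  | add x z _ _ hx hz =>
    obtain ⟨c, hc⟩ := hx
    obtain ⟨d, hd⟩ := hz
    exact ⟨c + d, by rw [map_add, hc, hd, add_dotProduct]; ring⟩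
  | smul r x _ hx =>
    obtain ⟨c, hc⟩ := hx
    exact ⟨r * c, by rw [map_mul, hc, smul_dotProduct, Algebra.smul_def]; ring⟩

lemma dot_self_eq_zero (σ : K →+* ℝ) {x : Fin 4 → K} (hx : x ⬝ᵥ x = 0) : x = 0 := by
  have h : (fun i => σ (x i)) ⬝ᵥ (fun i => σ (x i)) = 0 := by
    have := congrArg σ hx
    simpa [dotProduct] using this
  have h2 := dotProduct_self_eq_zero.mp h
  ext i
  have h3 := congrFun h2 i
  simpa using h3

/-- A set with integral dot products lies in a full integral lattice. -/
theorem exists_full_integral (σ : K →+* ℝ) {κ : 𝓞 K} (hκ : κ ≠ 0) {Z : Set (Fin 4 → K)}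
    (hZ : DotIntegral κ Z) :
    ∃ X : Submodule (𝓞 K) (Fin 4 → K), Z ⊆ X ∧ DotIntegral κ (X : Set (Fin 4 → K)) ∧
      ∀ x, ∃ c : 𝓞 K, c ≠ 0 ∧ c • x ∈ X := by
  have hzorn : ∃ X : Submodule (𝓞 K) (Fin 4 → K), Submodule.span (𝓞 K) Z ≤ X ∧
      Maximal (fun Y => Y ∈ {Y : Submodule (𝓞 K) (Fin 4 → K) | DotIntegral κ (Y : Set (Fin 4 → K))})
        X := by
    refine zorn_le_nonempty₀ _ ?_ _ hZ.span
    intro c hc hchain Y hY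
    refine ⟨sSup c, ?_, fun _ h => le_sSup h⟩
    intro x hx y hy
    have hdir := hchain.directedOn
    rw [SetLike.mem_coe, Submodule.mem_sSup_of_directed ⟨Y, hY⟩ hdir] at hx hy
    obtain ⟨A, hA, hxA⟩ := hx
    obtain ⟨B, hB, hyB⟩ := hy
    obtain ⟨D, hD, hAD, hBD⟩ := hdir A hA B hB
    exact hc hD x (hAD hxA) y (hBD hyB)
  obtain ⟨X, hX, hmax⟩ := hzorn
  have hInt : DotIntegral κ (X : Set (Fin 4 → K)) := hmax.prop
  refine ⟨X, fun z hz => hX (Submodule.subset_span hz), hInt, ?_⟩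
  have htop : Submodule.span K (X : Set (Fin 4 → K)) = ⊤ := by
    by_contra hne
    obtain ⟨f, hf0, hf⟩ := Submodule.exists_le_ker_of_lt_top _ (lt_top_iff_ne_top.mpr hne)
    let v : Fin 4 → K := fun i => f (Pi.single i 1)
    have hfv : ∀ x, f x = v ⬝ᵥ x := by
      intro x
      have : x = ∑ i, x i • (Pi.single i (1 : K) : Fin 4 → K) := by
        ext j; simp [Pi.single_apply]
      conv_lhs => rw [this]
      simp [v, dotProduct, mul_comm]
    have hv0 : v ≠ 0 := by
      intro h0
      apply hf0
      refine LinearMap.ext fun x => ?_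
      simp [hfv, h0]
    have hvX : ∀ x ∈ X, v ⬝ᵥ x = 0 := fun x hx => by
      rw [← hfv]; exact hf (Submodule.subset_span hx)
    obtain ⟨⟨r, s⟩, hrs⟩ := IsLocalization.surj (nonZeroDivisors (𝓞 K)) (v ⬝ᵥ v)
    simp only at hrs
    have hs : (s : 𝓞 K) ≠ 0 := nonZeroDivisors.coe_ne_zero s
    set v' : Fin 4 → K := algebraMap (𝓞 K) K s • v with hv'
    have hv'X : ∀ x ∈ X, v' ⬝ᵥ x = 0 := fun x hx => by simp [v', hvX x hx]
    have hvv : v' ⬝ᵥ v' = algebraMap (𝓞 K) K (s * r) := by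
      rw [map_mul, ← hrs, hv', smul_dotProduct, dotProduct_smul, smul_eq_mul, smul_eq_mul]; ring
    have hins : DotIntegral κ (insert v' (X : Set (Fin 4 → K))) := by
      rintro x (rfl | hx) y (rfl | hy)
      · exact ⟨κ * (s * r), by rw [map_mul, ← hvv]⟩
      · exact ⟨0, by rw [hv'X y hy]; simp⟩
      · exact ⟨0, by rw [dotProduct_comm, hv'X x hx]; simp⟩
      · exact hInt x hx y hy
    have hle := hmax.le_of_ge hins.span (fun x hx => Submodule.subset_span (Or.inr hx))
    have hmem : v' ∈ X := hle (Submodule.subset_span (Or.inl rfl))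
    have h0 := dot_self_eq_zero σ (hv'X v' hmem)
    rw [hv', smul_eq_zero] at h0
    rcases h0 with h0 | h0
    · exact hs (by simpa using h0)
    · exact hv0 h0
  intro x
  have hx : x ∈ Submodule.span K (X : Set (Fin 4 → K)) := by rw [htop]; trivial
  induction hx using Submodule.span_induction with
  | mem x hx => exact ⟨1, one_ne_zero, by simpa using hx⟩
  | zero => exact ⟨1, one_ne_zero, by simp⟩
  | add x y _ _ hx hy =>
    obtain ⟨c, hc, hcx⟩ := hx
    obtain ⟨d, hd, hdy⟩ := hy
    refine ⟨c * d, mul_ne_zero hc hd, ?_⟩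
    rw [smul_add]
    refine X.add_mem ?_ ?_
    · rw [mul_comm, mul_smul]; exact X.smul_mem _ hcx
    · rw [mul_smul]; exact X.smul_mem _ hdy
  | smul r x _ hx =>
    obtain ⟨c, hc, hcx⟩ := hx
    obtain ⟨⟨p, s⟩, hps⟩ := IsLocalization.surj (nonZeroDivisors (𝓞 K)) r
    simp only at hps
    refine ⟨s * c, mul_ne_zero (nonZeroDivisors.coe_ne_zero s) hc, ?_⟩
    have : ((s : 𝓞 K) * c) • r • x = p • c • x := by
      ext i
      change ((s : 𝓞 K) * c) • (r * x i) = p • c • x i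
      simp only [Algebra.smul_def, map_mul, ← hps]
      ring
    rw [this]
    exact X.smul_mem _ hcx

end OKLattice

namespace OKLattice
open scoped nonZeroDivisors

variable {K : Type} [Field K] [NumberField K]

/-- The leading coefficients of the vectors of `X` supported on the first coordinates. -/
def leadCoeff (X : Submodule (𝓞 K) (Fin 4 → K)) (k : Fin 4) : Submodule (𝓞 K) K where
  carrier := {y | ∃ x ∈ X, (∀ j, k < j → x j = 0) ∧ x k = y}
  zero_mem' := ⟨0, X.zero_mem, by simp, rfl⟩
  add_mem' := by
    rintro _ _ ⟨x, hx, h, rfl⟩ ⟨x', hx', h', rfl⟩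
    exact ⟨x + x', X.add_mem hx hx', fun j hj => by simp [h j hj, h' j hj], rfl⟩
  smul_mem' := by
    rintro c _ ⟨x, hx, h, rfl⟩
    exact ⟨c • x, X.smul_mem c hx, fun j hj => by simp [h j hj], rfl⟩

lemma prod_leadCoeff_integral {κ : 𝓞 K} {X : Submodule (𝓞 K) (Fin 4 → K)}
    (hX : DotIntegral κ (X : Set (Fin 4 → K))) {y : Fin 4 → K} (hy : ∀ k, y k ∈ leadCoeff X k) :
    ∃ c : 𝓞 K, algebraMap (𝓞 K) K c = algebraMap (𝓞 K) K κ ^ 2 * ∏ k, y k := by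
  choose v hv hv0 hvy using hy
  choose c hc using fun i j => hX (v i) (hv i) (v j) (hv j)
  let V : Matrix (Fin 4) (Fin 4) K := Matrix.of v
  have hV : V.det = ∏ k, y k := by
    rw [Matrix.det_of_isLowerTriangular]
    · exact Finset.prod_congr rfl fun k _ => hvy k
    · intro i j hij
      exact hv0 i j hij
  have h1 : (Matrix.of c).map (algebraMap (𝓞 K) K) =
      algebraMap (𝓞 K) K κ • (V * V.transpose) := by
    ext i j
    simp [hc, V, Matrix.mul_apply, dotProduct]
  apply exists_of_sq_eq (c := (Matrix.of c).det)
  rw [RingHom.map_det, RingHom.mapMatrix_apply, h1, Matrix.det_smul, Matrix.det_mul,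
    Matrix.det_transpose, hV, Fintype.card_fin]
  ring

lemma spanSingleton_mul_mul_le {c : K} {I M : FractionalIdeal (𝓞 K)⁰ K}
    (h : ∀ i ∈ I, FractionalIdeal.spanSingleton (𝓞 K)⁰ (c * i) * M ≤ 1) :
    FractionalIdeal.spanSingleton (𝓞 K)⁰ c * (I * M) ≤ 1 := by
  rw [mul_left_comm, FractionalIdeal.mul_le]
  intro i hi j hj
  apply h i hi
  rw [mul_comm c i, ← FractionalIdeal.spanSingleton_mul_spanSingleton, mul_assoc]
  exact FractionalIdeal.mul_mem_mul (FractionalIdeal.mem_spanSingleton_self _ i) hj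

lemma _root_.FractionalIdeal.one_le_absNorm {I : FractionalIdeal (𝓞 K)⁰ K} (h0 : I ≠ 0)
    (h : I ≤ 1) : 1 ≤ FractionalIdeal.absNorm I := by
  obtain ⟨J, rfl⟩ := FractionalIdeal.le_one_iff_exists_coeIdeal.mp h
  rw [FractionalIdeal.coeIdeal_absNorm]
  have : Ideal.absNorm J ≠ 0 := by
    rw [Ne, Ideal.absNorm_eq_zero_iff]
    rintro rfl
    exact h0 (by simp)
  exact_mod_cast Nat.one_le_iff_ne_zero.mpr this

/-- A full integral lattice has a `ℤ`-spanning family of large determinant. -/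
theorem exists_spanning_det (h : TotallyReal K) {κ : 𝓞 K} (hκ : κ ≠ 0)
    {X : Submodule (𝓞 K) (Fin 4 → K)} (hX : DotIntegral κ (X : Set (Fin 4 → K)))
    (hfull : ∀ x, ∃ c : 𝓞 K, c ≠ 0 ∧ c • x ∈ X) :
    ∃ v : (K →+* ℝ) × Fin 4 → (Fin 4 → K),
      (∀ x ∈ X, x ∈ Submodule.span ℤ (Set.range v)) ∧
      |(discr K : ℝ)| ^ 2 ≤ |(Matrix.of fun p q : (K →+* ℝ) × Fin 4 => p.1 (v q p.2)).det| *
        (Ideal.absNorm (Ideal.span {κ}) : ℝ) ^ 2 := by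
  have hκ' : algebraMap (𝓞 K) K κ ≠ 0 := by simpa using hκ
  have hbasis : ∀ k : Fin 4, ∃ c : 𝓞 K, c ≠ 0 ∧
      (Pi.single k (algebraMap (𝓞 K) K c) : Fin 4 → K) ∈ X := by
    intro k
    obtain ⟨c, hc, hcx⟩ := hfull (Pi.single k 1)
    refine ⟨c, hc, ?_⟩
    convert hcx using 1
    ext j
    by_cases hj : j = k
    · subst hj; simp [Algebra.smul_def]
    · simp [hj]
  choose e he0 heX using hbasis
  have hmem : ∀ k, algebraMap (𝓞 K) K (e k) ∈ leadCoeff X k := fun k =>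
    ⟨_, heX k, fun j hj => by simp [hj.ne'], by simp⟩
  have hfrac : ∀ k, IsFractional (𝓞 K)⁰ (leadCoeff X k) := by
    intro k
    refine ⟨κ * e k, mem_nonZeroDivisors_of_ne_zero (mul_ne_zero hκ (he0 k)), ?_⟩
    rintro _ ⟨x, hx, -, rfl⟩
    obtain ⟨c, hc⟩ := hX _ hx _ (heX k)
    refine ⟨c, hc.trans ?_⟩
    simp [Algebra.smul_def]
    ring
  let J : Fin 4 → FractionalIdeal (𝓞 K)⁰ K := fun k => ⟨leadCoeff X k, hfrac k⟩
  have hJ0 : ∀ k, J k ≠ 0 := by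
    intro k h0
    have h1 : algebraMap (𝓞 K) K (e k) ∈ J k := hmem k
    rw [h0, FractionalIdeal.mem_zero_iff] at h1
    exact he0 k (by simpa using h1)
  have hJmem : ∀ k y, y ∈ J k ↔ y ∈ leadCoeff X k := fun k y => Iff.rfl
  have hprod : FractionalIdeal.spanSingleton (𝓞 K)⁰ (algebraMap (𝓞 K) K κ ^ 2) *
      (J 0 * (J 1 * (J 2 * J 3))) ≤ 1 := by
    refine spanSingleton_mul_mul_le fun x₀ h₀ => spanSingleton_mul_mul_le fun x₁ h₁ =>
      spanSingleton_mul_mul_le fun x₂ h₂ => ?_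
    rw [FractionalIdeal.spanSingleton_mul_le_iff]
    intro x₃ h₃
    obtain ⟨c, hc⟩ := prod_leadCoeff_integral hX (y := ![x₀, x₁, x₂, x₃]) (by
      intro k
      fin_cases k
      exacts [h₀, h₁, h₂, h₃])
    rw [FractionalIdeal.mem_one_iff]
    refine ⟨c, hc.trans ?_⟩
    simp [Fin.prod_univ_four]
    ring
  have hnorm : 1 ≤ (Ideal.absNorm (Ideal.span {κ}) : ℝ) ^ 2 *
      ∏ k, (FractionalIdeal.absNorm (J k) : ℝ) := by
    have h1 := FractionalIdeal.one_le_absNorm (I := FractionalIdeal.spanSingleton (𝓞 K)⁰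
      (algebraMap (𝓞 K) K κ ^ 2) * (J 0 * (J 1 * (J 2 * J 3)))) (by
        simp [FractionalIdeal.spanSingleton_eq_zero_iff, hκ, hJ0]) hprod
    rw [← FractionalIdeal.spanSingleton_pow, ← FractionalIdeal.coeIdeal_span_singleton] at h1
    simp only [map_mul, map_pow, FractionalIdeal.coeIdeal_absNorm] at h1
    rw [Fin.prod_univ_four]
    have h2 := (Rat.cast_le (K := ℝ)).mpr h1
    push_cast at h2
    simpa only [mul_assoc] using h2
  choose b hb hbdet using fun k => exists_basis_det h (Units.mk0 (J k) (hJ0 k))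
  have hbmem : ∀ k τ, b k τ ∈ leadCoeff X k := fun k τ =>
    (hb k _).mp (Submodule.subset_span ⟨τ, rfl⟩)
  choose w hwX hw0 hw using hbmem
  refine ⟨fun p => w p.2 p.1, ?_, ?_⟩
  · have key : ∀ t : ℕ, t ≤ 4 → ∀ x ∈ X, (∀ j : Fin 4, t ≤ (j : ℕ) → x j = 0) →
        x ∈ Submodule.span ℤ (Set.range fun p : (K →+* ℝ) × Fin 4 => w p.2 p.1) := by
      intro t
      induction t with
      | zero =>
        intro _ x _ hx
        have : x = 0 := by ext j; exact hx j (Nat.zero_le _)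
        rw [this]; exact Submodule.zero_mem _
      | succ t ih =>
        intro ht x hxX hx
        let k : Fin 4 := ⟨t, by omega⟩
        have hxk : x k ∈ J k := ⟨x, hxX, fun j hj => hx j hj, rfl⟩
        rw [show J k = ((Units.mk0 (J k) (hJ0 k) : (FractionalIdeal (𝓞 K)⁰ K)ˣ) :
          FractionalIdeal (𝓞 K)⁰ K) from rfl, ← hb k, Submodule.mem_span_range_iff_exists_fun] at hxk
        obtain ⟨c, hc⟩ := hxk
        set s : Fin 4 → K := ∑ τ, c τ • w k τ with hs
        have hsX : s ∈ X := X.sum_mem fun τ _ => zsmul_mem (hwX k τ) _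
        have hs0 : ∀ j, k < j → s j = 0 := by
          intro j hj
          simp [s, hw0 k _ j hj]
        have hsk : s k = x k := by
          rw [← hc]; simp [s, hw]
        have hspan : s ∈ Submodule.span ℤ (Set.range fun p : (K →+* ℝ) × Fin 4 => w p.2 p.1) :=
          Submodule.sum_mem _ fun τ _ => Submodule.smul_mem _ _ (Submodule.subset_span ⟨(τ, k), rfl⟩)
        have := ih (by omega) (x - s) (X.sub_mem hxX hsX) (by
          intro j hj
          rcases eq_or_lt_of_le hj with hj | hj
          · have : j = k := Fin.ext hj.symm
            subst this
            simp [hsk]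
          · simp [hx j hj, hs0 j hj])
        simpa using Submodule.add_mem _ this hspan
    intro x hx
    exact key 4 le_rfl x hx fun j hj => absurd j.2 (by omega)
  · have hdet : (Matrix.of fun p q : (K →+* ℝ) × Fin 4 => p.1 (w q.2 q.1 p.2)).det =
        ∏ k, (Matrix.of fun σ τ : K →+* ℝ => σ (b k τ)).det := by
      rw [Matrix.BlockTriangular.det_fintype (b := fun p : (K →+* ℝ) × Fin 4 => p.2)]
      · refine Finset.prod_congr rfl fun k _ => ?_
        let f : (K →+* ℝ) ≃ {p : (K →+* ℝ) × Fin 4 // p.2 = k} :=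
          { toFun := fun σ => ⟨(σ, k), rfl⟩
            invFun := fun p => p.1.1
            left_inv := fun _ => rfl
            right_inv := by rintro ⟨⟨σ, k'⟩, h⟩; simp only at h; subst h; rfl }
        rw [← Matrix.det_submatrix_equiv_self f]
        congr 1
        refine Matrix.ext fun σ τ => ?_
        simp [Matrix.toSquareBlock_def, f, hw]
      · intro p q hpq
        simp [hw0 _ _ _ hpq]
    rw [hdet, Finset.abs_prod]
    simp only [hbdet, Units.val_mk0]
    rw [Finset.prod_mul_distrib, Finset.prod_const, Finset.card_univ, Fintype.card_fin]
    have h4 : √|(discr K : ℝ)| ^ 4 = |(discr K : ℝ)| ^ 2 := by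
      rw [show (4 : ℕ) = 2 * 2 from rfl, pow_mul, Real.sq_sqrt (abs_nonneg _)]
    rw [h4, mul_assoc, mul_comm (∏ k, _)]
    exact le_mul_of_one_le_right (by positivity) hnorm

end OKLattice

namespace OKLattice
open MeasureTheory

/-- A product of closed four-dimensional balls with prescribed squared radii. -/
def ballProd {ι : Type} (r : ι → ℝ) : Set (ι × Fin 4 → ℝ) :=
  {x | ∀ i, ∑ k, x (i, k) ^ 2 ≤ r i}

lemma convex_ballProd {ι : Type} (r : ι → ℝ) : Convex ℝ (ballProd r) := by
  have : ballProd r = ⋂ i, {x : ι × Fin 4 → ℝ | x ∈ Set.univ ∧ ∑ k, x (i, k) ^ 2 ≤ r i} := by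
    ext x; simp [ballProd]
  rw [this]
  refine convex_iInter fun i => ConvexOn.convex_le ?_ (r i)
  have key : ∀ k : Fin 4, ConvexOn ℝ Set.univ fun x : ι × Fin 4 → ℝ => x (i, k) ^ 2 := fun k => by
    have := (even_two.convexOn_pow (𝕜 := ℝ)).comp_linearMap
      (LinearMap.proj (R := ℝ) (φ := fun _ : ι × Fin 4 => ℝ) (i, k))
    simpa [Function.comp_def] using this
  simp only [Fin.sum_univ_four]
  exact (((key 0).add (key 1)).add (key 2)).add (key 3)

variable {ι : Type} [Fintype ι]

lemma measurableSet_ballProd (r : ι → ℝ) : MeasurableSet (ballProd r) := by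
  have : ballProd r = ⋂ i, {x : ι × Fin 4 → ℝ | ∑ k, x (i, k) ^ 2 ≤ r i} := by
    ext x; simp [ballProd]
  rw [this]
  exact MeasurableSet.iInter fun i => measurableSet_le (by fun_prop) measurable_const

lemma isBounded_ballProd (r : ι → ℝ) : Bornology.IsBounded (ballProd r) := by
  rw [← Bornology.forall_isBounded_image_eval_iff]
  rintro ⟨i, k⟩
  refine (Metric.isBounded_Icc (-√(r i)) √(r i)).subset ?_
  rintro _ ⟨x, hx, rfl⟩
  rw [Set.mem_Icc, ← abs_le]
  apply Real.abs_le_sqrt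
  refine le_trans ?_ (hx i)
  exact Finset.single_le_sum (f := fun k => x (i, k) ^ 2) (fun _ _ => sq_nonneg _)
    (Finset.mem_univ k)

lemma volume_map_uncurry {κ : Type} [Fintype κ] :
    (volume : Measure (ι → κ → ℝ)).map (fun f (p : ι × κ) => f p.1 p.2) = volume := by
  rw [volume_pi (ι := ι × κ)]
  refine (Measure.pi_eq fun s hs => ?_).symm
  rw [Measure.map_apply (by fun_prop) (MeasurableSet.univ_pi hs)]
  have : (fun (f : ι → κ → ℝ) (p : ι × κ) => f p.1 p.2) ⁻¹' Set.univ.pi s =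
      Set.univ.pi fun i => Set.univ.pi fun k => s (i, k) := by
    ext f; simp
  rw [this, volume_pi_pi, Fintype.prod_prod_type]
  exact Finset.prod_congr rfl fun i _ => volume_pi_pi _

lemma volume_four_ball {r : ℝ} (hr : 0 ≤ r) :
    volume {x : Fin 4 → ℝ | ∑ k, x k ^ 2 ≤ r} = ENNReal.ofReal (Real.pi ^ 2 / 2 * r ^ 2) := by
  have h1 := EuclideanSpace.volume_closedBall (ι := Fin 4) 0 √r
  have h2 : WithLp.toLp 2 ⁻¹' (Metric.closedBall (0 : EuclideanSpace ℝ (Fin 4)) √r) =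
      {x : Fin 4 → ℝ | ∑ k, x k ^ 2 ≤ r} := by
    ext x
    simp [EuclideanSpace.norm_eq, Real.sqrt_le_sqrt_iff hr]
  rw [← h2, (PiLp.volume_preserving_toLp (Fin 4)).measure_preimage
    measurableSet_closedBall.nullMeasurableSet, h1, ← ENNReal.ofReal_pow (Real.sqrt_nonneg _),
    ← ENNReal.ofReal_mul (by positivity)]
  congr 1
  have hG : Real.Gamma ((Fintype.card (Fin 4) : ℝ) / 2 + 1) = 2 := by
    rw [Fintype.card_fin, show ((4 : ℕ) : ℝ) / 2 + 1 = ((2 : ℕ) : ℝ) + 1 by norm_num,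
      Real.Gamma_nat_eq_factorial]
    norm_num
  rw [hG, Fintype.card_fin, show (4 : ℕ) = 2 * 2 from rfl, pow_mul, pow_mul, Real.sq_sqrt hr,
    Real.sq_sqrt Real.pi_pos.le]
  ring

lemma volume_ballProd {r : ι → ℝ} (hr : ∀ i, 0 ≤ r i) :
    volume.real (ballProd r) = ∏ i, (Real.pi ^ 2 / 2 * r i ^ 2) := by
  rw [Measure.real, ← volume_map_uncurry, Measure.map_apply (by fun_prop) (measurableSet_ballProd r)]
  have : (fun (f : ι → Fin 4 → ℝ) (p : ι × Fin 4) => f p.1 p.2) ⁻¹' ballProd r =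
      Set.univ.pi fun i => {x : Fin 4 → ℝ | ∑ k, x k ^ 2 ≤ r i} := by
    ext f; simp [ballProd]
  rw [this, volume_pi_pi, ENNReal.toReal_prod]
  refine Finset.prod_congr rfl fun i _ => ?_
  rw [volume_four_ball (hr i), ENNReal.toReal_ofReal (by positivity)]

end OKLattice

namespace OKLattice
open MeasureTheory Filter Topology Pointwise

variable {K : Type} [Field K] [NumberField K]

/-- Asymptotic upper bound for the number of bounded items moved from a fixed item. -/
theorem Item.class_count (h : TotallyReal K) (i₀ : Item K) (F : Set (Item K))
    (hF : ∀ i ∈ F, ∃ z, Moves z i₀.lat i.lat ∧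
      z ⬝ᵥ z = algebraMap (𝓞 K) K i.a / algebraMap (𝓞 K) K i₀.a) :
    ∃ (c : ℕ → ℝ) (B : ℝ),
      Tendsto (fun n : ℕ => c n / (n : ℝ) ^ (4 * Module.finrank ℚ K)) atTop (𝓝 B) ∧
      B ≤ (2 * Real.pi ^ 2) ^ Module.finrank ℚ K / |(discr K : ℝ)| ^ 2 ∧
      ∀ (n : ℕ) (T : Finset (Item K)), (∀ i ∈ T, i ∈ F) →
        (∀ i ∈ T, ∀ σ : K →+* ℝ, σ (algebraMap (𝓞 K) K i.a) ≤ (n : ℝ) ^ 2) →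
        (∀ i ∈ T, ∀ j ∈ T, i.a = j.a → i.a ∣ i.u - j.u → i = j) → (T.card : ℝ) ≤ c n := by
  choose! z hzM hzz using hF
  have ha0 : algebraMap (𝓞 K) K i₀.a ≠ 0 := i₀.data.coe_ne_zero
  have hκ : 2 * i₀.a ≠ 0 := mul_ne_zero two_ne_zero i₀.ne_zero
  have hZ : DotIntegral (2 * i₀.a) (z '' F) := by
    rintro _ ⟨i, hi, rfl⟩ _ ⟨j, hj, rfl⟩
    obtain ⟨c, hc⟩ := Item.pair_integral (hzM i hi) (hzM j hj) (hzz i hi) (hzz j hj)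
    exact ⟨c, by rw [hc, map_mul, map_ofNat]⟩
  obtain ⟨σ₀⟩ := h.nonempty_emb
  obtain ⟨X, hZX, hX, hfull⟩ := exists_full_integral σ₀ hκ hZ
  obtain ⟨v, hv, hdet⟩ := exists_spanning_det h hκ hX hfull
  set A := Matrix.of fun p q : (K →+* ℝ) × Fin 4 => p.1 (v q p.2) with hA
  have hD : 0 < |(discr K : ℝ)| := abs_pos.mpr (by exact_mod_cast discr_ne_zero K)
  have hAdet : A.det ≠ 0 := by
    intro h0
    rw [h0, abs_zero, zero_mul] at hdet
    exact absurd hdet (not_le.mpr (by positivity))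
  set r : (K →+* ℝ) → ℝ := fun σ => (σ (algebraMap (𝓞 K) K i₀.a))⁻¹ with hr
  have hr0 : ∀ σ, 0 < r σ := fun σ => inv_pos.mpr (i₀.pos σ)
  have hlim := tendsto_card_lattice A hAdet (convex_ballProd r) (isBounded_ballProd r)
    (measurableSet_ballProd r)
  have hcard : Fintype.card ((K →+* ℝ) × Fin 4) = 4 * Module.finrank ℚ K := by
    rw [Fintype.card_prod, h.card_emb, Fintype.card_fin, mul_comm]
  rw [hcard] at hlim
  refine ⟨_, _, hlim, ?_, ?_⟩
  · rw [volume_ballProd fun σ => (hr0 σ).le]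
    have hN : (Ideal.absNorm (Ideal.span {2 * i₀.a}) : ℝ) =
        2 ^ Module.finrank ℚ K * (∏ σ, r σ)⁻¹ := by
      rw [h.absNorm_span, ← h.card_emb, ← Finset.prod_inv_distrib, ← Finset.card_univ,
        ← Finset.prod_const, ← Finset.prod_mul_distrib]
      refine Finset.prod_congr rfl fun σ _ => ?_
      rw [show ((2 * i₀.a : 𝓞 K) : K) = 2 * algebraMap (𝓞 K) K i₀.a from ((algebraMap (𝓞 K) K).map_mul 2 i₀.a).trans (by rw [map_ofNat]), map_mul, map_ofNat, abs_mul, abs_of_pos (i₀.pos σ), abs_two]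
      simp only [r, inv_inv]
    rw [hN] at hdet
    have hP : 0 < ∏ σ, r σ := Finset.prod_pos fun σ _ => hr0 σ
    rw [Finset.prod_mul_distrib, Finset.prod_const, Finset.card_univ, h.card_emb, Finset.prod_pow]
    rw [div_le_div_iff₀ (abs_pos.mpr hAdet) (by positivity)]
    set P := ∏ σ, r σ
    set d := Module.finrank ℚ K
    calc (Real.pi ^ 2 / 2) ^ d * P ^ 2 * |(discr K : ℝ)| ^ 2
        ≤ (Real.pi ^ 2 / 2) ^ d * P ^ 2 * (|A.det| * (2 ^ d * P⁻¹) ^ 2) := by gcongr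
      _ = ((Real.pi ^ 2 / 2) ^ d * (2 ^ d) ^ 2) * |A.det| * (P * P⁻¹) ^ 2 := by ring
      _ = (2 * Real.pi ^ 2) ^ d * |A.det| := by
        rw [mul_inv_cancel₀ hP.ne', one_pow, mul_one, ← pow_mul, mul_comm d 2, pow_mul,
          ← mul_pow]
        congr 2
        ring
  · intro n T hTF hTn hTu
    rcases Nat.eq_zero_or_pos n with rfl | hn
    · have : T = ∅ := by
        rw [Finset.eq_empty_iff_forall_notMem]
        intro i hi
        have h1 := hTn i hi σ₀
        have h2 := i.pos σ₀
        norm_num at h1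
        linarith
      subst this
      simp
    have hn0 : (n : ℝ) ≠ 0 := by positivity
    have hfin := finite_lattice A hAdet ((isBounded_ballProd r).smul₀ (n : ℝ))
    have : Finite {c : (K →+* ℝ) × Fin 4 → ℤ //
      A.mulVec (fun i => (c i : ℝ)) ∈ (n : ℝ) • ballProd r} := hfin
    have hcoord : ∀ i ∈ T, ∃ c : (K →+* ℝ) × Fin 4 → ℤ, ∑ q, c q • v q = z i := by
      intro i hi
      have := hv (z i) (hZX ⟨i, hTF i hi, rfl⟩)
      rwa [Submodule.mem_span_range_iff_exists_fun] at this
    choose! c hc using hcoord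
    have hAc : ∀ i ∈ T, ∀ σ k, A.mulVec (fun q => (c i q : ℝ)) (σ, k) = σ (z i k) := by
      intro i hi σ k
      rw [← hc i hi]
      simp [A, Matrix.mulVec, dotProduct, mul_comm]
    have hmem : ∀ i ∈ T, A.mulVec (fun q => (c i q : ℝ)) ∈ (n : ℝ) • ballProd r := by
      intro i hi
      rw [Set.mem_smul_set_iff_inv_smul_mem₀ hn0]
      intro σ
      have h1 : ∑ k, σ (z i k) ^ 2 = σ (algebraMap (𝓞 K) K i.a) * r σ := by
        have := congrArg σ (hzz i (hTF i hi))
        simpa [dotProduct, sq, div_eq_mul_inv, r] using this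
      have h2 : ∑ k, ((n : ℝ)⁻¹ • A.mulVec (fun q => (c i q : ℝ))) (σ, k) ^ 2 =
          ((n : ℝ) ^ 2)⁻¹ * ∑ k, σ (z i k) ^ 2 := by
        rw [Finset.mul_sum]
        refine Finset.sum_congr rfl fun k _ => ?_
        rw [Pi.smul_apply, hAc i hi, smul_eq_mul, mul_pow, inv_pow]
      rw [h2, h1, ← mul_assoc]
      refine mul_le_of_le_one_left (hr0 σ).le ?_
      rw [inv_mul_le_iff₀ (by positivity), mul_one]
      exact hTn i hi σ
    have hinj : Function.Injective fun i : T =>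
        (⟨c i, hmem i i.2⟩ : {c : (K →+* ℝ) × Fin 4 → ℤ //
          A.mulVec (fun i => (c i : ℝ)) ∈ (n : ℝ) • ballProd r}) := by
      intro i j hij
      have hcij : c i = c j := Subtype.ext_iff.mp hij
      have hzij : z i = z j := by rw [← hc i i.2, ← hc j j.2, hcij]
      have ha : i.1.a = j.1.a := by
        have h1 := hzz i (hTF i i.2)
        rw [hzij, hzz j (hTF j j.2), div_left_inj' ha0] at h1
        exact (RingOfIntegers.coe_injective h1).symm
      have hl : i.1.lat = j.1.lat := by
        have h1 := hzM i (hTF i i.2)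
        have h2 := hzM j (hTF j j.2)
        rw [hzij] at h1
        exact le_antisymm (h1.unique h2) (h2.unique h1)
      exact Subtype.ext (hTu i i.2 j j.2 ha (Item.dvd_of_lat_eq ha hl))
    have := Nat.card_le_card_of_injective _ hinj
    rw [Nat.card_eq_fintype_card, Fintype.card_coe] at this
    exact_mod_cast this

end OKLattice

namespace OKLattice
open MeasureTheory Filter Topology Pointwise

lemma integral_prod_box {ι : Type} [Fintype ι] :
    ∫ x in Set.univ.pi (fun _ : ι => Set.Ioc (0 : ℝ) 1), ∏ i, x i = (1 / 2 : ℝ) ^ Fintype.card ι := by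
  rw [volume_pi, Measure.restrict_pi_pi, integral_fintype_prod_eq_prod (fun _ x => x)]
  have : ∫ x in Set.Ioc (0 : ℝ) 1, x = 1 / 2 := by
    rw [← intervalIntegral.integral_of_le zero_le_one, integral_id]
    norm_num
  rw [Finset.prod_congr rfl fun _ _ => this, Finset.prod_const, Finset.card_univ]

lemma tendsto_sum_box {ι : Type} [Fintype ι] [DecidableEq ι] (A : Matrix ι ι ℝ) (hA : A.det ≠ 0) :
    Tendsto (fun n : ℕ => (∑' c : {c : ι → ℤ // ∀ i, 0 < A.mulVec (fun i => (c i : ℝ)) i ∧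
        A.mulVec (fun i => (c i : ℝ)) i ≤ n}, ∏ i, A.mulVec (fun i => (c.1 i : ℝ)) i) /
      (n : ℝ) ^ (2 * Fintype.card ι)) atTop (𝓝 ((1 / 2 : ℝ) ^ Fintype.card ι / |A.det|)) := by
  set f := Matrix.toLin' A with hf
  have hdet : LinearMap.det f ≠ 0 := by rw [hf, LinearMap.det_toLin']; exact hA
  have hunit : IsUnit A.det := isUnit_iff_ne_zero.mpr hA
  have hcont : Continuous f := LinearMap.continuous_of_finiteDimensional f
  set S := Set.univ.pi (fun _ : ι => Set.Ioc (0 : ℝ) 1) with hS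
  have hm : MeasurableSet S := MeasurableSet.univ_pi fun _ => measurableSet_Ioc
  have hb : Bornology.IsBounded S := Bornology.IsBounded.pi fun _ => Metric.isBounded_Ioc _ _
  have hconv : Convex ℝ (f ⁻¹' S) := (convex_pi fun _ _ => convex_Ioc _ _).linear_preimage f
  have hm' : MeasurableSet (f ⁻¹' S) := hcont.measurable hm
  have hb' : Bornology.IsBounded (f ⁻¹' S) := by
    let g := Matrix.toLin' A⁻¹
    have hg : Continuous g := LinearMap.continuous_of_finiteDimensional g
    have : f ⁻¹' S ⊆ g '' closure S := by
      intro x hx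
      refine ⟨f x, subset_closure hx, ?_⟩
      simp [f, g, Matrix.mulVec_mulVec, Matrix.nonsing_inv_mul _ hunit]
    exact ((hb.isCompact_closure.image hg).isBounded).subset this
  have hInt : ∫ x in f ⁻¹' S, ∏ i, f x i = (1 / 2 : ℝ) ^ Fintype.card ι / |A.det| := by
    rw [← setIntegral_map (f := fun y : ι → ℝ => ∏ i, y i) hm
      (Continuous.aestronglyMeasurable (by fun_prop)) hcont.aemeasurable,
      Measure.map_linearMap_addHaar_eq_smul_addHaar _ hdet, Measure.restrict_smul,
      integral_smul_measure, integral_prod_box, ENNReal.toReal_ofReal (abs_nonneg _), abs_inv,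
      hf, LinearMap.det_toLin', smul_eq_mul]
    ring
  have := tendsto_tsum_div_pow_atTop_integral (f ⁻¹' S) (fun x => ∏ i, f x i) (by fun_prop) hb' hm'
    (hconv.addHaar_frontier volume)
  rw [hInt] at this
  refine this.congr' ?_
  filter_upwards [eventually_gt_atTop 0] with n hn
  have hn' : (n : ℝ) ≠ 0 := by positivity
  have hn0 : (0 : ℝ) < n := by positivity
  have hne : NeZero n := ⟨hn.ne'⟩
  have hinv : ∀ c : ι → ℤ, A.mulVec ((n : ℝ)⁻¹ • fun i => (c i : ℝ)) =
      (n : ℝ)⁻¹ • A.mulVec (fun i => (c i : ℝ)) := fun c => Matrix.mulVec_smul _ _ _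
  let e : {c : ι → ℤ // ∀ i, 0 < A.mulVec (fun i => (c i : ℝ)) i ∧
      A.mulVec (fun i => (c i : ℝ)) i ≤ n} ≃
      ↑(f ⁻¹' S ∩ (n : ℝ)⁻¹ • (Submodule.span ℤ (Set.range (Pi.basisFun ℝ ι)) : Set (ι → ℝ))) := by
    refine Equiv.ofBijective (fun c => ⟨(n : ℝ)⁻¹ • fun i => (c.1 i : ℝ), ?_, ?_⟩) ⟨?_, ?_⟩
    · intro i _
      have := c.2 i
      simp only [f, Matrix.toLin'_apply, hinv, Pi.smul_apply, smul_eq_mul]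
      refine ⟨mul_pos (inv_pos.mpr hn0) this.1, ?_⟩
      rw [inv_mul_le_iff₀ hn0, mul_one]
      exact this.2
    · rw [← Submodule.coe_pointwise_smul, SetLike.mem_coe,
        BoxIntegral.unitPartition.mem_smul_span_iff]
      intro i
      exact ⟨c.1 i, by simp [hn']⟩
    · intro c c' h
      ext i
      have := congrFun (Subtype.ext_iff.mp h) i
      simpa [hn'] using this
    · rintro ⟨x, hx, hx'⟩
      rw [← Submodule.coe_pointwise_smul, SetLike.mem_coe,
        BoxIntegral.unitPartition.mem_smul_span_iff] at hx'
      choose c hc using hx'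
      have hcx : (fun i => (c i : ℝ)) = (n : ℝ) • x := by
        ext i; simpa using hc i
      refine ⟨⟨c, fun i => ?_⟩, ?_⟩
      · have hi := hx i trivial
        simp only [f, Matrix.toLin'_apply] at hi
        rw [hcx, Matrix.mulVec_smul, Pi.smul_apply, smul_eq_mul]
        refine ⟨mul_pos hn0 hi.1, mul_le_of_le_one_right hn0.le hi.2⟩
      · apply Subtype.ext
        simp only [hcx]
        rw [inv_smul_smul₀ hn']
  rw [← e.tsum_eq]
  have hterm : ∀ c, ∏ i, f (e c) i =
      ((n : ℝ) ^ Fintype.card ι)⁻¹ * ∏ i, A.mulVec (fun i => (c.1 i : ℝ)) i := by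
    intro c
    change ∏ i, A.mulVec ((n : ℝ)⁻¹ • fun i => (c.1 i : ℝ)) i = _
    rw [hinv]
    simp only [Pi.smul_apply, smul_eq_mul, Finset.prod_mul_distrib, Finset.prod_const,
      Finset.card_univ, inv_pow]
  simp only [hterm]
  rw [tsum_mul_left, two_mul, pow_add]
  field_simp

end OKLattice

namespace OKLattice
open Filter Topology

variable {K : Type} [Field K] [NumberField K]

instance finite_quotient_two : Finite (𝓞 K ⧸ Ideal.span {(2 : 𝓞 K)}) :=
  Ideal.finiteQuotientOfFreeOfNeBot _ (by simp)

lemma exists_pos_rep (η : 𝓞 K ⧸ Ideal.span {(2 : 𝓞 K)}) :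
    ∃ r : 𝓞 K, Ideal.Quotient.mk _ r = η ∧ ∀ σ : K →+* ℝ, 0 < σ (algebraMap (𝓞 K) K r) := by
  obtain ⟨x, rfl⟩ := Ideal.Quotient.mk_surjective η
  obtain ⟨N, hN⟩ := exists_nat_gt (∑ σ : K →+* ℝ, |σ (algebraMap (𝓞 K) K x)|)
  refine ⟨x + 2 * N, ?_, fun σ => ?_⟩
  · rw [Ideal.Quotient.eq, Ideal.mem_span_singleton]
    exact ⟨N, by ring⟩
  · have h1 := Finset.single_le_sum (f := fun σ : K →+* ℝ => |σ (algebraMap (𝓞 K) K x)|)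
      (fun _ _ => abs_nonneg _) (Finset.mem_univ σ)
    have h2 := neg_abs_le (σ (algebraMap (𝓞 K) K x))
    have h3 : (0 : ℝ) ≤ N := by positivity
    simp only [map_add, map_mul, map_ofNat, map_natCast]
    linarith

lemma isCoprime_two_of_isUnit_mk {r : 𝓞 K}
    (h : IsUnit (Ideal.Quotient.mk (Ideal.span {(2 : 𝓞 K)}) r)) : IsCoprime r 2 := by
  obtain ⟨y, hy⟩ := h.exists_left_inv
  obtain ⟨x, rfl⟩ := Ideal.Quotient.mk_surjective y
  rw [← map_mul, ← map_one (Ideal.Quotient.mk _), Ideal.Quotient.eq,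
    Ideal.mem_span_singleton] at hy
  obtain ⟨z, hz⟩ := hy
  exact ⟨x, -z, by linear_combination hz⟩

lemma exists_items (h : TotallyReal K) (b : (K →+* ℝ) → 𝓞 K)
    (hb : (Matrix.of fun σ τ : K →+* ℝ => 2 * σ (algebraMap (𝓞 K) K (b τ))).det ≠ 0)
    (r : (𝓞 K ⧸ Ideal.span {(2 : 𝓞 K)})ˣ → 𝓞 K)
    (hr : ∀ η, Ideal.Quotient.mk _ (r η) = η.1)
    (hr0 : ∀ η, ∀ σ : K →+* ℝ, 0 < σ (algebraMap (𝓞 K) K (r η)))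
    (C0 : ℕ) (hC0 : ∀ η, ∀ σ : K →+* ℝ, σ (algebraMap (𝓞 K) K (r η)) ≤ C0) (m : ℕ) :
    ∃ T : Finset (Item K), (∀ i ∈ T, ∀ σ : K →+* ℝ, σ (algebraMap (𝓞 K) K i.a) ≤ C0 + m) ∧
      (∀ i ∈ T, ∀ j ∈ T, i.a = j.a → i.a ∣ i.u - j.u → i = j) ∧
      (Nat.card (𝓞 K ⧸ Ideal.span {(2 : 𝓞 K)})ˣ : ℝ) *
        (∑' c : {c : (K →+* ℝ) → ℤ // ∀ σ, 0 < (Matrix.of fun σ τ : K →+* ℝ =>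
            2 * σ (algebraMap (𝓞 K) K (b τ))).mulVec (fun i => (c i : ℝ)) σ ∧
          (Matrix.of fun σ τ : K →+* ℝ =>
            2 * σ (algebraMap (𝓞 K) K (b τ))).mulVec (fun i => (c i : ℝ)) σ ≤ m},
        ∏ σ, (Matrix.of fun σ τ : K →+* ℝ =>
            2 * σ (algebraMap (𝓞 K) K (b τ))).mulVec (fun i => (c.1 i : ℝ)) σ) ≤ T.card := by
  classical
  set A := Matrix.of fun σ τ : K →+* ℝ => 2 * σ (algebraMap (𝓞 K) K (b τ)) with hA
  set V := {c : (K →+* ℝ) → ℤ // ∀ σ, 0 < A.mulVec (fun i => (c i : ℝ)) σ ∧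
          A.mulVec (fun i => (c i : ℝ)) σ ≤ m} with hV
  have hfin : Finite V := by
    refine ((finite_lattice A hb (S := Set.univ.pi fun _ => Set.Ioc (0 : ℝ) m)
      (Bornology.IsBounded.pi fun _ => Metric.isBounded_Ioc _ _)).subset ?_).to_subtype
    intro c hc σ _
    exact hc σ
  have : Fintype V := Fintype.ofFinite V
  have : Fintype (𝓞 K ⧸ Ideal.span {(2 : 𝓞 K)})ˣ := Fintype.ofFinite _
  let a : (𝓞 K ⧸ Ideal.span {(2 : 𝓞 K)})ˣ × V → 𝓞 K := fun p => r p.1 + 2 * ∑ τ, (p.2.1 τ : 𝓞 K) * b τ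
  have hσ : ∀ (p : (𝓞 K ⧸ Ideal.span {(2 : 𝓞 K)})ˣ × V) (σ : K →+* ℝ), σ (algebraMap (𝓞 K) K (a p)) =
      σ (algebraMap (𝓞 K) K (r p.1)) + A.mulVec (fun i => (p.2.1 i : ℝ)) σ := by
    intro p σ
    simp only [a, map_add, map_mul, map_ofNat, map_sum, map_intCast, Matrix.mulVec, dotProduct,
      hA, Matrix.of_apply, Finset.mul_sum]
    congr 1
    exact Finset.sum_congr rfl fun τ _ => by ring
  have hpos : ∀ (p : (𝓞 K ⧸ Ideal.span {(2 : 𝓞 K)})ˣ × V) (σ : K →+* ℝ), 0 < σ (algebraMap (𝓞 K) K (a p)) := fun p σ => by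
    rw [hσ]; exact add_pos (hr0 _ _) (p.2.2 σ).1
  have hne : ∀ p, a p ≠ 0 := fun p hp => by
    obtain ⟨σ⟩ := h.nonempty_emb
    have := hpos p σ
    rw [hp, map_zero, map_zero] at this
    exact lt_irrefl _ this
  have hmk : ∀ p, Ideal.Quotient.mk (Ideal.span {(2 : 𝓞 K)}) (a p) = p.1.1 := fun p => by
    rw [← hr p.1, Ideal.Quotient.eq, Ideal.mem_span_singleton]
    exact ⟨∑ τ, (p.2.1 τ : 𝓞 K) * b τ, by simp only [a]; ring⟩
  have hodd : ∀ p, IsCoprime (a p) 2 := fun p =>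
    isCoprime_two_of_isUnit_mk (by rw [hmk]; exact p.1.isUnit)
  have hinj : Function.Injective a := by
    intro p q hpq
    have h1 : p.1 = q.1 := Units.ext (by rw [← hmk, ← hmk, hpq])
    have h2 : A.mulVec (fun i => (p.2.1 i : ℝ)) = A.mulVec (fun i => (q.2.1 i : ℝ)) := by
      ext σ
      have h3 := hσ p σ
      rw [hpq, hσ q σ, h1] at h3
      linarith
    have h3 := Matrix.mulVec_injective_of_isUnit ((Matrix.isUnit_iff_isUnit_det A).mpr
      (isUnit_iff_ne_zero.mpr hb)) h2
    refine Prod.ext h1 (Subtype.ext (funext fun i => ?_))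
    exact_mod_cast congrFun h3 i
  have hqf : ∀ p, Finite (𝓞 K ⧸ Ideal.span {a p}) := fun p =>
    Ideal.finiteQuotientOfFreeOfNeBot _ (by simpa using hne p)
  let Φ : (Σ p : (𝓞 K ⧸ Ideal.span {(2 : 𝓞 K)})ˣ × V, 𝓞 K ⧸ Ideal.span {a p}) → Item K := fun x =>
    ⟨a x.1, Quotient.out x.2, hne _, hpos _, hodd _⟩
  have hout : ∀ x : (Σ p : (𝓞 K ⧸ Ideal.span {(2 : 𝓞 K)})ˣ × V, 𝓞 K ⧸ Ideal.span {a p}),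
      Ideal.Quotient.mk (Ideal.span {a x.1}) (Φ x).u = x.2 := fun x => Quotient.out_eq x.2
  have hΦ : ∀ x y, (Φ x).a = (Φ y).a → (Φ x).a ∣ (Φ x).u - (Φ y).u → x = y := by
    rintro ⟨p, x⟩ ⟨q, y⟩ h1 h2
    obtain rfl : p = q := hinj h1
    congr 1
    refine ((hout ⟨p, x⟩).symm.trans ?_).trans (hout ⟨p, y⟩)
    rw [Ideal.Quotient.eq, Ideal.mem_span_singleton]
    exact h2
  have hΦi : Function.Injective Φ := fun x y hxy => hΦ x y (by rw [hxy]) (by rw [hxy]; simp)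
  have : Fintype (Σ p : (𝓞 K ⧸ Ideal.span {(2 : 𝓞 K)})ˣ × V, 𝓞 K ⧸ Ideal.span {a p}) := Fintype.ofFinite _
  refine ⟨Finset.univ.map ⟨Φ, hΦi⟩, ?_, ?_, ?_⟩
  · intro i hi σ
    obtain ⟨x, -, rfl⟩ := Finset.mem_map.mp hi
    change σ (algebraMap (𝓞 K) K (a x.1)) ≤ _
    rw [hσ]
    exact add_le_add (hC0 _ _) (x.1.2.2 σ).2
  · intro i hi j hj h1 h2
    obtain ⟨x, -, rfl⟩ := Finset.mem_map.mp hi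
    obtain ⟨y, -, rfl⟩ := Finset.mem_map.mp hj
    exact congrArg Φ (hΦ x y h1 h2)
  · rw [Finset.card_map, Finset.card_univ, ← Nat.card_eq_fintype_card, Nat.card_sigma,
      Nat.cast_sum, Fintype.sum_prod_type, Nat.card_eq_fintype_card, ← nsmul_eq_mul,
      ← Finset.card_univ, ← Finset.sum_const, tsum_fintype]
    refine Finset.sum_le_sum fun η _ => Finset.sum_le_sum fun c _ => ?_
    have : (Nat.card (𝓞 K ⧸ Ideal.span {a (η, c)}) : ℝ) = ∏ σ : K →+* ℝ,
        |σ (algebraMap (𝓞 K) K (a (η, c)))| := by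
      rw [← h.absNorm_span, Ideal.absNorm_apply, Submodule.cardQuot_apply]
    rw [this]
    refine Finset.prod_le_prod (fun σ _ => (c.2 σ).1.le) fun σ _ => ?_
    rw [abs_of_pos (hpos _ _), hσ]
    exact le_add_of_nonneg_left (hr0 _ _).le

lemma lower_count (h : TotallyReal K) : ∃ e : ℕ → ℝ,
    Tendsto (fun n : ℕ => e n / (n : ℝ) ^ (4 * Module.finrank ℚ K)) atTop
      (𝓝 (Nat.card (𝓞 K ⧸ Ideal.span {(2 : 𝓞 K)})ˣ /
        (4 ^ Module.finrank ℚ K * √|(discr K : ℝ)|))) ∧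
    ∀ n : ℕ, ∃ T : Finset (Item K),
      (∀ i ∈ T, ∀ σ : K →+* ℝ, σ (algebraMap (𝓞 K) K i.a) ≤ (n : ℝ) ^ 2) ∧
      (∀ i ∈ T, ∀ j ∈ T, i.a = j.a → i.a ∣ i.u - j.u → i = j) ∧ e n ≤ T.card := by
  classical
  obtain ⟨b, hb, hdet⟩ := exists_basis_det h (1 : (FractionalIdeal (nonZeroDivisors (𝓞 K)) K)ˣ)
  have hb' : ∀ τ, ∃ x : 𝓞 K, algebraMap (𝓞 K) K x = b τ := fun τ => by
    have := (hb (b τ)).mp (Submodule.subset_span ⟨τ, rfl⟩)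
    simpa [FractionalIdeal.mem_one_iff] using this
  choose b' hb' using hb'
  have : Fintype (𝓞 K ⧸ Ideal.span {(2 : 𝓞 K)})ˣ := Fintype.ofFinite _
  choose r hr hr0 using fun η : (𝓞 K ⧸ Ideal.span {(2 : 𝓞 K)})ˣ => exists_pos_rep (K := K) η.1
  obtain ⟨C0, hC0⟩ := exists_nat_gt (∑ η, ∑ σ : K →+* ℝ, σ (algebraMap (𝓞 K) K (r η)))
  have hC0' : ∀ η, ∀ σ : K →+* ℝ, σ (algebraMap (𝓞 K) K (r η)) ≤ C0 := fun η σ =>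
    ((Finset.single_le_sum (f := fun σ : K →+* ℝ => σ (algebraMap (𝓞 K) K (r η)))
      (fun σ _ => (hr0 η σ).le) (Finset.mem_univ σ)).trans
      (Finset.single_le_sum (f := fun η => ∑ σ : K →+* ℝ, σ (algebraMap (𝓞 K) K (r η)))
      (fun η _ => Finset.sum_nonneg fun σ _ => (hr0 η σ).le) (Finset.mem_univ η))).trans hC0.le
  have hdet' : |(Matrix.of fun σ τ : K →+* ℝ => 2 * σ (algebraMap (𝓞 K) K (b' τ))).det| =
      2 ^ Module.finrank ℚ K * √|(discr K : ℝ)| := by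
    have : (Matrix.of fun σ τ : K →+* ℝ => 2 * σ (algebraMap (𝓞 K) K (b' τ))) =
        (2 : ℝ) • Matrix.of fun σ τ : K →+* ℝ => σ (b τ) := by
      ext σ τ
      simp [hb']
    rw [this, Matrix.det_smul, abs_mul, hdet, h.card_emb]
    simp
  have hD : 0 < √|(discr K : ℝ)| := Real.sqrt_pos.mpr (abs_pos.mpr (by
    exact_mod_cast discr_ne_zero K))
  have hne : (Matrix.of fun σ τ : K →+* ℝ => 2 * σ (algebraMap (𝓞 K) K (b' τ))).det ≠ 0 := by
    rw [← abs_pos, hdet']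
    positivity
  have hitems := exists_items h b' hne r hr hr0 C0 hC0'
  have hlim := tendsto_sum_box _ hne
  rw [hdet', h.card_emb] at hlim
  set s : ℕ → ℝ := fun m => (∑' c : {c : (K →+* ℝ) → ℤ // ∀ σ, 0 < (Matrix.of fun σ τ : K →+* ℝ =>
            2 * σ (algebraMap (𝓞 K) K (b' τ))).mulVec (fun i => (c i : ℝ)) σ ∧
          (Matrix.of fun σ τ : K →+* ℝ =>
            2 * σ (algebraMap (𝓞 K) K (b' τ))).mulVec (fun i => (c i : ℝ)) σ ≤ m},
        ∏ σ, (Matrix.of fun σ τ : K →+* ℝ =>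
            2 * σ (algebraMap (𝓞 K) K (b' τ))).mulVec (fun i => (c.1 i : ℝ)) σ) with hs
  change Tendsto (fun n : ℕ => s n / _) _ _ at hlim
  set d := Module.finrank ℚ K with hd
  refine ⟨fun n => if C0 ≤ n ^ 2 then
    (Nat.card (𝓞 K ⧸ Ideal.span {(2 : 𝓞 K)})ˣ : ℝ) * s (n ^ 2 - C0) else 0, ?_, ?_⟩
  · have ht : Tendsto (fun n : ℕ => n ^ 2 - C0) atTop atTop :=
      (tendsto_sub_atTop_nat C0).comp (tendsto_pow_atTop two_ne_zero)
    have h1 := hlim.comp ht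
    have h2 : Tendsto (fun n : ℕ => ((n ^ 2 - C0 : ℕ) : ℝ) / ((n ^ 2 : ℕ) : ℝ)) atTop (𝓝 1) := by
      have h3 : Tendsto (fun n : ℕ => 1 - (C0 : ℝ) / ((n ^ 2 : ℕ) : ℝ)) atTop (𝓝 (1 - 0)) :=
        tendsto_const_nhds.sub (Tendsto.comp (g := fun n : ℕ => (C0 : ℝ) / (n : ℝ))
          (tendsto_const_div_atTop_nhds_zero_nat _) (tendsto_pow_atTop two_ne_zero))
      rw [sub_zero] at h3
      refine h3.congr' ?_
      filter_upwards [(tendsto_pow_atTop (α := ℕ) two_ne_zero).eventually_ge_atTop (C0 + 1)]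
        with n hn
      have : ((n ^ 2 : ℕ) : ℝ) ≠ 0 := by
        have : n ^ 2 ≠ 0 := by lia
        exact_mod_cast this
      rw [Nat.cast_sub (by lia)]
      field_simp
    have h3 := ((h1.mul (h2.pow (2 * d))).const_mul
      (Nat.card (𝓞 K ⧸ Ideal.span {(2 : 𝓞 K)})ˣ : ℝ))
    have hval : (Nat.card (𝓞 K ⧸ Ideal.span {(2 : 𝓞 K)})ˣ : ℝ) *
        ((1 / 2) ^ d / (2 ^ d * √|(discr K : ℝ)|) * 1 ^ (2 * d)) =
        Nat.card (𝓞 K ⧸ Ideal.span {(2 : 𝓞 K)})ˣ / (4 ^ d * √|(discr K : ℝ)|) := by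
      rw [show (4 : ℝ) = 2 * 2 by norm_num, mul_pow, one_pow, one_div, inv_pow]
      field_simp
    rw [hval] at h3
    refine h3.congr' ?_
    filter_upwards [(tendsto_pow_atTop (α := ℕ) two_ne_zero).eventually_ge_atTop (C0 + 1)]
        with n hn
    have hn0 : (n : ℝ) ≠ 0 := by
      rintro h0
      have : n = 0 := by exact_mod_cast h0
      subst this
      simp at hn
    have hm0 : ((n ^ 2 - C0 : ℕ) : ℝ) ≠ 0 := by
      have : n ^ 2 - C0 ≠ 0 := by lia
      exact_mod_cast this
    rw [if_pos (by lia)]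
    simp only [Function.comp]
    rw [div_pow, Nat.cast_pow, ← pow_mul, show 2 * (2 * d) = 4 * d by ring]
    field_simp
  · intro n
    beta_reduce
    split_ifs with hn
    · obtain ⟨T, h1, h2, h3⟩ := hitems (n ^ 2 - C0)
      refine ⟨T, fun i hi σ => (h1 i hi σ).trans ?_, h2, h3⟩
      rw [Nat.cast_sub hn]
      push_cast
      linarith
    · exact ⟨∅, by simp, by simp, by simp⟩

end OKLattice

namespace OKLattice
open Filter Topology IsDedekindDomain Real

variable {K : Type} [Field K] [NumberField K]

lemma discr_ineq_of_universal (h : TotallyReal K) (L : OKLattice K)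
    (hL : ∀ T : OKLattice K, T.rank ≤ 3 → L.Represents T) :
    (Nat.card (𝓞 K ⧸ Ideal.span {(2 : 𝓞 K)})ˣ : ℝ) /
        (4 ^ Module.finrank ℚ K * √|(discr K : ℝ)|) ≤
      (4 ^ Module.finrank (𝓞 K) L.carrier *
        2 ^ Nat.card {P : HeightOneSpectrum (𝓞 K) // (2 : 𝓞 K) ∈ P.asIdeal} : ℕ) *
      ((2 * π ^ 2) ^ Module.finrank ℚ K / |(discr K : ℝ)| ^ 2) := by
  classical
  obtain ⟨Γ, _, f, hΓ, hf⟩ := exists_item_code h L hL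
  obtain ⟨e, he, hT⟩ := lower_count h
  have key : ∀ γ : Γ, ∃ i₀ : Item K, ∀ i, f i = γ → f i₀ = f i := by
    intro γ
    by_cases hγ : ∃ i, f i = γ
    · obtain ⟨i, rfl⟩ := hγ
      exact ⟨i, fun j hj => hj.symm⟩
    · exact ⟨Classical.arbitrary _, fun i hi => (hγ ⟨i, hi⟩).elim⟩
  choose i₀ hi₀ using key
  choose c B hc hB hcount using fun γ : Γ => Item.class_count h (i₀ γ) {i | f i = γ}
    (fun i hi => hf _ _ (hi₀ γ i hi))
  have hlim : Tendsto (fun n : ℕ => (∑ γ, c γ n) / (n : ℝ) ^ (4 * Module.finrank ℚ K)) atTop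
      (𝓝 (∑ γ, B γ)) := by
    simp_rw [Finset.sum_div]
    exact tendsto_finsetSum _ fun γ _ => hc γ
  have hle : ∀ n, e n ≤ ∑ γ, c γ n := by
    intro n
    obtain ⟨T, h1, h2, h3⟩ := hT n
    refine h3.trans ?_
    rw [Finset.card_eq_sum_card_fiberwise (f := f) (t := Finset.univ) (by simp), Nat.cast_sum]
    refine Finset.sum_le_sum fun γ _ => hcount γ n _ ?_ ?_ ?_
    · intro i hi
      exact (Finset.mem_filter.mp hi).2
    · intro i hi
      exact h1 i (Finset.mem_filter.mp hi).1
    · intro i hi j hj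
      exact h2 i (Finset.mem_filter.mp hi).1 j (Finset.mem_filter.mp hj).1
  have h1 := le_of_tendsto_of_tendsto' he hlim fun n => div_le_div_of_nonneg_right (hle n) (by positivity)
  refine h1.trans ((Finset.sum_le_sum fun γ _ => hB γ).trans ?_)
  rw [Finset.sum_const, Finset.card_univ, nsmul_eq_mul]
  refine mul_le_mul_of_nonneg_right ?_ (by positivity)
  exact_mod_cast hΓ

end OKLattice

namespace OKLattice
open Polynomial Matrix

lemma chebyshev_C_monic (n : ℕ) : (Chebyshev.C ℝ (n : ℤ)).natDegree ≤ n ∧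
    (Chebyshev.C ℝ ((n + 1 : ℕ) : ℤ)).natDegree = n + 1 ∧ (Chebyshev.C ℝ ((n + 1 : ℕ) : ℤ)).Monic := by
  induction n with
  | zero =>
    refine ⟨?_, ?_, ?_⟩
    · rw [Nat.cast_zero, Chebyshev.C_zero]
      exact (natDegree_ofNat 2).le
    · rw [zero_add, Nat.cast_one, Chebyshev.C_one, natDegree_X]
    · rw [zero_add, Nat.cast_one, Chebyshev.C_one]
      exact monic_X
  | succ n ih =>
    obtain ⟨h1, h2, h3⟩ := ih
    have h4 : Chebyshev.C ℝ ((n + 1 + 1 : ℕ) : ℤ) =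
        X * Chebyshev.C ℝ ((n + 1 : ℕ) : ℤ) - Chebyshev.C ℝ (n : ℤ) := by
      have := Chebyshev.C_add_two ℝ (n : ℤ)
      push_cast
      rw [add_assoc, one_add_one_eq_two]
      exact this
    have h5 : (X * Chebyshev.C ℝ ((n + 1 : ℕ) : ℤ)).natDegree = n + 1 + 1 := by
      rw [natDegree_X_mul h3.ne_zero, h2]
    have h6 : (X * Chebyshev.C ℝ ((n + 1 : ℕ) : ℤ)).Monic := monic_X.mul h3
    have h7 : (Chebyshev.C ℝ (n : ℤ)).natDegree < (X * Chebyshev.C ℝ ((n + 1 : ℕ) : ℤ)).natDegree := by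
      lia
    refine ⟨h2.le, ?_, ?_⟩
    · rw [h4, natDegree_sub_eq_left_of_natDegree_lt h7, h5]
    · rw [h4]
      exact h6.sub_of_left (degree_lt_degree h7)

lemma abs_chebyshev_C_le (n : ℤ) {x : ℝ} (hx : |x| ≤ 2) : |(Chebyshev.C ℝ n).eval x| ≤ 2 := by
  have h := congrArg (eval (x / 2)) (Chebyshev.C_comp_two_mul_X ℝ n)
  simp only [eval_comp, eval_mul, eval_ofNat, eval_X] at h
  rw [mul_div_cancel₀ _ (two_ne_zero)] at h
  rw [h, abs_mul, abs_two]
  have := Chebyshev.abs_eval_T_real_le_one n (x := x / 2) (by rw [abs_div, abs_two]; linarith)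
  linarith

lemma abs_det_vandermonde_le {M : ℕ} (v : Fin M → ℝ) (hv : ∀ i, |v i| ≤ 2) :
    |(vandermonde v).det| ≤ M.factorial * 2 ^ M := by
  let p : Fin M → ℝ[X] := fun i => if i.1 = 0 then 1 else Chebyshev.C ℝ (i.1 : ℤ)
  have hp : ∀ i, (p i).natDegree = i ∧ (p i).Monic := by
    rintro ⟨i, hi⟩
    simp only [p]
    obtain _ | i := i
    · simp
    · simpa using (chebyshev_C_monic i).2
  rw [det_eval_matrixOfPolynomials_eq_det_vandermonde v p (fun i => (hp i).1) fun i => (hp i).2]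
  have := Matrix.det_le (A := Matrix.of fun i j => (p j).eval (v i)) (abv := AbsoluteValue.abs)
    (x := (2 : ℝ)) (fun i j => by
      change |(p j).eval (v i)| ≤ 2
      simp only [p]
      split_ifs
      · simp
      · exact abs_chebyshev_C_le _ (hv i))
  simpa using this

lemma sum_sum_eq_two_mul {M : ℕ} (F : Fin M → Fin M → ℝ) (hF : ∀ i j, F i j = F j i)
    (h0 : ∀ i, F i i = 0) :
    ∑ i, ∑ j, F i j = 2 * ∑ i, ∑ j ∈ Finset.Ioi i, F i j := by
  have h1 : ∀ i, ∑ j, F i j = ∑ j ∈ Finset.Ioi i, F i j + ∑ j ∈ Finset.Iio i, F j i := by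
    intro i
    have : (Finset.univ : Finset (Fin M)) = Finset.Ioi i ∪ (Finset.Iio i ∪ {i}) := by
      ext j
      simp
      lia
    rw [this, Finset.sum_union, Finset.sum_union, Finset.sum_singleton, h0, add_zero]
    · exact congrArg _ (Finset.sum_congr rfl fun j _ => hF i j)
    · simp
    · rw [Finset.disjoint_left]
      intro j
      simp only [Finset.mem_Ioi, Finset.mem_union, Finset.mem_Iio, Finset.mem_singleton]
      lia
  simp_rw [h1]
  rw [Finset.sum_add_distrib, two_mul]
  congr 1
  exact Finset.sum_comm' (by simp)

lemma sum_log_sub_le {M : ℕ} (v : Fin M → ℝ) (hv : Function.Injective v) (y r : ℝ) (hr : 0 < r)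
    (hy : ∀ i, |v i - y| ≤ 2 * r) :
    ∑ i, ∑ j, Real.log |v i - v j| ≤
      M * (M - 1) * Real.log r + 2 * Real.log (M.factorial * 2 ^ M) := by
  let w : Fin M → ℝ := fun i => (v i - y) / r
  have hw : Function.Injective w := fun i j hij => hv (by
    simp only [w] at hij
    rw [div_left_inj' hr.ne'] at hij
    linarith)
  have h1 := abs_det_vandermonde_le w fun i => by
    simp only [w]
    rw [abs_div, abs_of_pos hr, div_le_iff₀ hr]
    exact hy i
  have hne : (vandermonde w).det ≠ 0 := det_vandermonde_ne_zero_iff.mpr hw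
  have h2 := Real.log_le_log (abs_pos.mpr hne) h1
  have h3 : Real.log |(vandermonde w).det| = ∑ i, ∑ j ∈ Finset.Ioi i, Real.log |w i - w j| := by
    rw [det_vandermonde, Finset.abs_prod, Real.log_prod]
    · refine Finset.sum_congr rfl fun i _ => ?_
      rw [Finset.abs_prod, Real.log_prod]
      · exact Finset.sum_congr rfl fun j _ => by rw [abs_sub_comm]
      · intro j hj
        rw [abs_ne_zero, sub_ne_zero]
        exact fun h => (Finset.mem_Ioi.mp hj).ne' (hw h)
    · intro i _
      rw [abs_ne_zero, Finset.prod_ne_zero_iff]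
      intro j hj
      rw [sub_ne_zero]
      exact fun h => (Finset.mem_Ioi.mp hj).ne' (hw h)
  have h4 : ∑ i, ∑ j, Real.log |w i - w j| = 2 * Real.log |(vandermonde w).det| := by
    rw [h3]
    exact sum_sum_eq_two_mul _ (fun i j => by rw [abs_sub_comm]) fun i => by simp
  have h5 : ∀ i j, Real.log |v i - v j| = Real.log |w i - w j| +
      (Real.log r - if i = j then Real.log r else 0) := by
    intro i j
    by_cases hij : i = j
    · simp [hij]
    · rw [if_neg hij, sub_zero]
      have : v i - v j = (w i - w j) * r := by
        simp only [w]
        field_simp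
        ring
      rw [this, abs_mul, abs_of_pos hr, Real.log_mul _ hr.ne']
      rw [abs_ne_zero, sub_ne_zero]
      exact fun h => hij (hw h)
  simp_rw [h5, Finset.sum_add_distrib, Finset.sum_sub_distrib]
  rw [h4]
  simp only [Finset.sum_ite_eq, Finset.mem_univ, if_true, Finset.sum_const, Finset.card_univ,
    Fintype.card_fin, nsmul_eq_mul]
  linarith

end OKLattice

namespace OKLattice
open Filter Topology MeasureTheory Pointwise

variable {K : Type} [Field K] [NumberField K]

lemma exists_points (h : TotallyReal K) {M : ℕ} (hM : 0 < M) {L : ℝ} (hL : 0 < L)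
    (hLd : L ^ Module.finrank ℚ K = M * √|(discr K : ℝ)|) :
    ∃ (x : Fin M → 𝓞 K) (y : (K →+* ℝ) → ℝ), Function.Injective x ∧
      ∀ i σ, |σ (algebraMap (𝓞 K) K (x i)) - y σ| ≤ L / 2 := by
  classical
  obtain ⟨b, hb, hdet⟩ := exists_basis_det h (1 : (FractionalIdeal (nonZeroDivisors (𝓞 K)) K)ˣ)
  have hb' : ∀ τ, ∃ x : 𝓞 K, algebraMap (𝓞 K) K x = b τ := fun τ => by
    have := (hb (b τ)).mp (Submodule.subset_span ⟨τ, rfl⟩)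
    simpa [FractionalIdeal.mem_one_iff] using this
  choose b' hb' using hb'
  set A := Matrix.of fun σ τ : K →+* ℝ => σ (b τ) with hA
  have hD : 0 < √|(discr K : ℝ)| := Real.sqrt_pos.mpr (abs_pos.mpr (by
    exact_mod_cast discr_ne_zero K))
  have hdet' : |A.det| = √|(discr K : ℝ)| := by rw [hdet]; simp
  have hne : A.det ≠ 0 := by rw [← abs_pos, hdet']; exact hD
  set S := Set.univ.pi fun _ : K →+* ℝ => Set.Ico (0 : ℝ) L with hS
  have hSb : Bornology.IsBounded S := Bornology.IsBounded.pi fun _ => Metric.isBounded_Ico _ _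
  have hlim := tendsto_card_lattice A hne (S := S) (convex_pi fun _ _ => convex_Ico _ _) hSb
    (MeasurableSet.univ_pi fun _ => measurableSet_Ico)
  have hvol : volume.real S / |A.det| = M := by
    have : volume.real S = L ^ Module.finrank ℚ K := by
      rw [hS, Measure.real, Real.volume_pi_Ico_toReal (fun _ => hL.le)]
      simp [h.card_emb]
    rw [this, hdet', hLd]
    field_simp
  rw [hvol, h.card_emb] at hlim
  obtain ⟨n, hn, hn0⟩ := ((hlim.eventually_const_lt (sub_one_lt (M : ℝ))).and
    (eventually_gt_atTop 0)).exists
  have hnpos : (0 : ℝ) < n := by exact_mod_cast hn0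
  set V := {c : (K →+* ℝ) → ℤ // A.mulVec (fun i => (c i : ℝ)) ∈ (n : ℝ) • S} with hV
  have hfin : Finite V := (finite_lattice A hne (hSb.smul₀ (n : ℝ))).to_subtype
  have : Fintype V := Fintype.ofFinite V
  have hmem : ∀ (c : V) σ, 0 ≤ A.mulVec (fun i => (c.1 i : ℝ)) σ / L ∧
      A.mulVec (fun i => (c.1 i : ℝ)) σ / L < n := by
    intro c σ
    obtain ⟨z, hz, hzc⟩ := c.2
    have h1 := congrFun hzc σ
    have h2 := hz σ trivial
    simp only [Pi.smul_apply, smul_eq_mul] at h1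
    rw [← h1]
    refine ⟨by have := h2.1; positivity, ?_⟩
    rw [div_lt_iff₀ hL]
    exact mul_lt_mul_of_pos_left h2.2 hnpos
  let f : V → ((K →+* ℝ) → Fin n) := fun c σ =>
    ⟨⌊A.mulVec (fun i => (c.1 i : ℝ)) σ / L⌋₊, (Nat.floor_lt (hmem c σ).1).mpr (hmem c σ).2⟩
  have hcard : Fintype.card ((K →+* ℝ) → Fin n) * (M - 1) < Fintype.card V := by
    rw [Fintype.card_fun, Fintype.card_fin, h.card_emb]
    rw [lt_div_iff₀ (by positivity), Nat.card_eq_fintype_card] at hn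
    have : ((n ^ Module.finrank ℚ K * (M - 1) : ℕ) : ℝ) < (Fintype.card V : ℝ) := by
      rw [Nat.cast_mul, Nat.cast_sub hM, mul_comm]
      exact_mod_cast hn
    exact_mod_cast this
  obtain ⟨k, hk⟩ := Fintype.exists_lt_card_fiber_of_mul_lt_card f hcard
  have hk' : Fintype.card (Fin M) ≤ Fintype.card {c : V // f c = k} := by
    rw [Fintype.card_fin, Fintype.card_subtype]
    lia
  obtain ⟨g⟩ := Function.Embedding.nonempty_of_card_le hk'
  have hx : ∀ (c : (K →+* ℝ) → ℤ) (σ : K →+* ℝ),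
      σ (algebraMap (𝓞 K) K (∑ τ, (c τ : 𝓞 K) * b' τ)) = A.mulVec (fun i => (c i : ℝ)) σ := by
    intro c σ
    simp only [map_sum, map_mul, map_intCast, Matrix.mulVec, dotProduct, hA, Matrix.of_apply, hb']
    exact Finset.sum_congr rfl fun τ _ => by ring
  refine ⟨fun i => ∑ τ, ((g i).1.1 τ : 𝓞 K) * b' τ, fun σ => L * (k σ : ℕ) + L / 2, ?_, ?_⟩
  · intro i j hij
    apply g.injective
    have h2 : A.mulVec (fun τ => ((g i).1.1 τ : ℝ)) = A.mulVec (fun τ => ((g j).1.1 τ : ℝ)) := by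
      ext σ
      rw [← hx, ← hx]
      exact congrArg (fun z => σ (algebraMap (𝓞 K) K z)) hij
    have h3 := Matrix.mulVec_injective_of_isUnit ((Matrix.isUnit_iff_isUnit_det A).mpr
      (isUnit_iff_ne_zero.mpr hne)) h2
    refine Subtype.ext (Subtype.ext (funext fun τ => ?_))
    exact_mod_cast congrFun h3 τ
  · intro i σ
    rw [hx]
    have h1 : ⌊A.mulVec (fun τ => ((g i).1.1 τ : ℝ)) σ / L⌋₊ = (k σ : ℕ) :=
      congrArg Fin.val (congrFun (g i).2 σ)
    have h2 := Nat.floor_le (hmem (g i).1 σ).1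
    have h3 := Nat.lt_floor_add_one (A.mulVec (fun τ => ((g i).1.1 τ : ℝ)) σ / L)
    rw [h1, le_div_iff₀ hL] at h2
    rw [h1, div_lt_iff₀ hL] at h3
    rw [abs_le]
    constructor <;> linarith

end OKLattice

namespace OKLattice
open IsDedekindDomain

/-- The prime ideals above `2`. -/
abbrev PrimeTwo (K : Type) [Field K] := {P : HeightOneSpectrum (𝓞 K) // (2 : 𝓞 K) ∈ P.asIdeal}

variable {K : Type} [Field K] [NumberField K]

instance instFintypePrimeTwo : Fintype (PrimeTwo K) := Fintype.ofFinite _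

/-- The absolute norm of a prime ideal above `2`. -/
def PrimeTwo.q (P : PrimeTwo K) : ℕ := Ideal.absNorm P.1.asIdeal

lemma PrimeTwo.q_def (P : PrimeTwo K) : P.q = Ideal.absNorm P.1.asIdeal := rfl

lemma isCoprime_primeTwo {P Q : PrimeTwo K} (h : P ≠ Q) : IsCoprime P.1.asIdeal Q.1.asIdeal :=
  HeightOneSpectrum.isCoprime_of_ne _ _ fun h' => h (Subtype.ext h')

lemma prod_q_dvd (s : Finset (PrimeTwo K)) (I : Ideal (𝓞 K)) (hs : ∀ P ∈ s, I ≤ P.1.asIdeal) :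
    ∏ P ∈ s, P.q ∣ Ideal.absNorm I := by
  simp_rw [PrimeTwo.q_def]
  rw [← map_prod]
  refine map_dvd Ideal.absNorm (Finset.prod_dvd_of_coprime ?_ fun P hP => Ideal.dvd_iff_le.mpr (hs P hP))
  intro P _ Q _ h
  exact isCoprime_primeTwo h

lemma absNorm_two (h : TotallyReal K) :
    Ideal.absNorm (Ideal.span {(2 : 𝓞 K)}) = 2 ^ Module.finrank ℚ K := by
  have := h.absNorm_span (2 : 𝓞 K)
  simp only [map_ofNat, abs_two, Finset.prod_const, Finset.card_univ, h.card_emb] at this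
  exact_mod_cast this

lemma prod_q_le (h : TotallyReal K) : ∏ P : PrimeTwo K, P.q ≤ 2 ^ Module.finrank ℚ K := by
  rw [← absNorm_two h]
  refine Nat.le_of_dvd ?_ (prod_q_dvd _ _ fun P _ => ?_)
  · rw [absNorm_two h]; positivity
  · rw [Ideal.span_singleton_le_iff_mem]; exact P.2

lemma PrimeTwo.exists_q_eq (h : TotallyReal K) (P : PrimeTwo K) : ∃ f : ℕ, 0 < f ∧ P.q = 2 ^ f := by
  have h1 : P.q ∣ 2 ^ Module.finrank ℚ K := by
    have := prod_q_dvd {P} (Ideal.span {(2 : 𝓞 K)}) (by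
      intro Q _
      rw [Ideal.span_singleton_le_iff_mem]; exact Q.2)
    rwa [Finset.prod_singleton, absNorm_two h] at this
  obtain ⟨f, -, hf⟩ := (Nat.dvd_prime_pow Nat.prime_two).mp h1
  refine ⟨f, Nat.pos_of_ne_zero fun h0 => ?_, hf⟩
  rw [h0, pow_zero, PrimeTwo.q_def, Ideal.absNorm_eq_one_iff] at hf
  exact P.1.isPrime.ne_top hf

lemma PrimeTwo.two_le_q (h : TotallyReal K) (P : PrimeTwo K) : 2 ≤ P.q := by
  obtain ⟨f, hf, hq⟩ := P.exists_q_eq h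
  rw [hq]
  exact Nat.le_self_pow hf.ne' 2

lemma PrimeTwo.card_quot (P : PrimeTwo K) : Nat.card (𝓞 K ⧸ P.1.asIdeal) = P.q := by
  rw [PrimeTwo.q_def, Ideal.absNorm_apply, Submodule.cardQuot_apply]

instance finite_quot_primeTwo (P : PrimeTwo K) : Finite (𝓞 K ⧸ P.1.asIdeal) :=
  Ideal.finiteQuotientOfFreeOfNeBot _ P.1.ne_bot

lemma sum_log_q_le (h : TotallyReal K) {x : 𝓞 K} (hx : x ≠ 0) [DecidablePred fun P : PrimeTwo K => x ∈ P.1.asIdeal] :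
    ∑ P : PrimeTwo K, (if x ∈ P.1.asIdeal then Real.log P.q else 0) ≤
      ∑ σ : K →+* ℝ, Real.log |σ (algebraMap (𝓞 K) K x)| := by
  have h1 := prod_q_dvd (Finset.univ.filter fun P : PrimeTwo K => x ∈ P.1.asIdeal) (Ideal.span {x})
    (by
      intro P hP
      rw [Ideal.span_singleton_le_iff_mem]
      exact (Finset.mem_filter.mp hP).2)
  have h0 : Ideal.absNorm (Ideal.span {x}) ≠ 0 := by
    rw [Ideal.absNorm_ne_zero_iff]
    exact Ideal.finiteQuotientOfFreeOfNeBot _ (by simpa using hx)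
  have h2 : ((∏ P ∈ Finset.univ.filter fun P : PrimeTwo K => x ∈ P.1.asIdeal, P.q : ℕ) : ℝ) ≤
      ∏ σ : K →+* ℝ, |σ (algebraMap (𝓞 K) K x)| := by
    rw [← h.absNorm_span]
    exact_mod_cast Nat.le_of_dvd (Nat.pos_of_ne_zero h0) h1
  rw [← Finset.sum_filter, ← Real.log_prod, ← Real.log_prod]
  · rw [Nat.cast_prod] at h2
    refine Real.log_le_log (Finset.prod_pos fun P _ => ?_) h2
    have := P.two_le_q h
    positivity
  · intro σ _
    simpa using hx
  · intro P _
    have := P.two_le_q h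
    positivity

/-- Reduction modulo all prime ideals above `2`. -/
def redTwo (K : Type) [Field K] : 𝓞 K ⧸ Ideal.span {(2 : 𝓞 K)} →+* ∀ P : PrimeTwo K, 𝓞 K ⧸ P.1.asIdeal :=
  RingHom.pi fun P => Ideal.Quotient.factor (by
    rw [Ideal.span_singleton_le_iff_mem]; exact P.2)

lemma redTwo_mk (x : 𝓞 K) (P : PrimeTwo K) :
    redTwo K (Ideal.Quotient.mk _ x) P = Ideal.Quotient.mk _ x := rfl

lemma redTwo_surjective : Function.Surjective (redTwo K) := by
  intro y
  obtain ⟨r, hr⟩ := Ideal.pi_quotient_surjective (I := fun P : PrimeTwo K => P.1.asIdeal)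
    (fun P Q hPQ => isCoprime_primeTwo hPQ) y
  exact ⟨Ideal.Quotient.mk _ r, funext fun P => by rw [redTwo_mk, hr]⟩

lemma isUnit_iff_redTwo (x : 𝓞 K ⧸ Ideal.span {(2 : 𝓞 K)}) :
    IsUnit x ↔ ∀ P, redTwo K x P ≠ 0 := by
  constructor
  · intro hx P
    have : Nontrivial (𝓞 K ⧸ P.1.asIdeal) := Ideal.Quotient.nontrivial_iff.mpr P.1.isPrime.ne_top
    exact (hx.map ((Pi.evalRingHom _ P).comp (redTwo K))).ne_zero
  · intro hx
    by_contra hu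
    obtain ⟨m, hm, hxm⟩ := exists_max_ideal_of_mem_nonunits hu
    have hmax : (m.comap (Ideal.Quotient.mk (Ideal.span {(2 : 𝓞 K)}))).IsMaximal :=
      Ideal.comap_isMaximal_of_surjective _ Ideal.Quotient.mk_surjective
    have h2 : (2 : 𝓞 K) ∈ m.comap (Ideal.Quotient.mk (Ideal.span {(2 : 𝓞 K)})) := by
      rw [Ideal.mem_comap, Ideal.Quotient.eq_zero_iff_mem.mpr (Ideal.mem_span_singleton_self _)]
      exact m.zero_mem
    obtain ⟨y, rfl⟩ := Ideal.Quotient.mk_surjective x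
    refine hx ⟨⟨_, hmax.isPrime, fun h0 => ?_⟩, h2⟩ ?_
    · rw [h0] at h2
      exact two_ne_zero ((Submodule.mem_bot _).mp h2)
    · rw [redTwo_mk, Ideal.Quotient.eq_zero_iff_mem]
      exact hxm

lemma card_units_two (h : TotallyReal K) :
    (Nat.card (𝓞 K ⧸ Ideal.span {(2 : 𝓞 K)})ˣ : ℝ) =
      2 ^ Module.finrank ℚ K * ∏ P : PrimeTwo K, (1 - 1 / (P.q : ℝ)) := by
  classical
  have : Fintype (𝓞 K ⧸ Ideal.span {(2 : 𝓞 K)}) := Fintype.ofFinite _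
  have : ∀ P : PrimeTwo K, Fintype (𝓞 K ⧸ P.1.asIdeal) := fun P => Fintype.ofFinite _
  set N := (Finset.univ.filter fun x => redTwo K x = 0).card with hN
  have hfib : ∀ y, (Finset.univ.filter fun x => redTwo K x = y).card = N := fun y =>
    AddMonoidHom.card_fiber_eq_of_mem_range (redTwo K) (redTwo_surjective y) (redTwo_surjective 0)
  have h1 : Fintype.card (𝓞 K ⧸ Ideal.span {(2 : 𝓞 K)}) = (∏ P : PrimeTwo K, P.q) * N := by
    rw [← Finset.card_univ, Finset.card_eq_sum_card_fiberwise (f := redTwo K) (t := Finset.univ)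
      (by simp), Finset.sum_congr rfl fun y _ => hfib y, Finset.sum_const, Finset.card_univ,
      Fintype.card_pi, smul_eq_mul]
    simp_rw [← Nat.card_eq_fintype_card, PrimeTwo.card_quot]
  have h2 : Nat.card (𝓞 K ⧸ Ideal.span {(2 : 𝓞 K)})ˣ = (∏ P : PrimeTwo K, (P.q - 1)) * N := by
    have e : (𝓞 K ⧸ Ideal.span {(2 : 𝓞 K)})ˣ ≃
        {x : 𝓞 K ⧸ Ideal.span {(2 : 𝓞 K)} // ∀ P, redTwo K x P ≠ 0} :=
      Equiv.ofBijective (fun u => ⟨u.1, (isUnit_iff_redTwo _).mp u.isUnit⟩)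
        ⟨fun u v huv => Units.ext (Subtype.ext_iff.mp huv),
          fun x => ⟨((isUnit_iff_redTwo _).mpr x.2).unit, rfl⟩⟩
    rw [Nat.card_congr e, Nat.card_eq_fintype_card, Fintype.card_subtype,
      Finset.card_eq_sum_card_fiberwise (f := redTwo K)
        (t := Fintype.piFinset fun P : PrimeTwo K => Finset.univ.erase 0)
        (by intro x hx; simpa using hx)]
    have : ∀ y ∈ Fintype.piFinset fun P : PrimeTwo K => (Finset.univ.erase 0 : Finset (𝓞 K ⧸ P.1.asIdeal)),
        (Finset.filter (fun x => redTwo K x = y)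
          (Finset.univ.filter fun x => ∀ P, redTwo K x P ≠ 0)).card = N := by
      intro y hy
      rw [← hfib y]
      congr 1
      ext x
      simp only [Finset.mem_filter, Finset.mem_univ, true_and, and_iff_right_iff_imp]
      rintro rfl
      simpa using hy
    rw [Finset.sum_congr rfl this, Finset.sum_const, Fintype.card_piFinset, smul_eq_mul]
    congr 1
    refine Finset.prod_congr rfl fun P _ => ?_
    rw [Finset.card_erase_of_mem (Finset.mem_univ _), Finset.card_univ, ← Nat.card_eq_fintype_card,
      PrimeTwo.card_quot]
  have h3 : Fintype.card (𝓞 K ⧸ Ideal.span {(2 : 𝓞 K)}) = 2 ^ Module.finrank ℚ K := by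
    rw [← absNorm_two h, Ideal.absNorm_apply, Submodule.cardQuot_apply, Nat.card_eq_fintype_card]
  have h4 : (2 : ℝ) ^ Module.finrank ℚ K = (∏ P : PrimeTwo K, (P.q : ℝ)) * N := by
    have := h3.symm.trans h1
    exact_mod_cast this
  rw [h2, h4, Nat.cast_mul, Nat.cast_prod, mul_right_comm, ← Finset.prod_mul_distrib]
  congr 1
  refine Finset.prod_congr rfl fun P _ => ?_
  have := P.two_le_q h
  have h0 : (P.q : ℝ) ≠ 0 := by positivity
  rw [Nat.cast_sub (by lia), mul_sub, mul_one_div, div_self h0, mul_one, Nat.cast_one]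

lemma card_congr_pairs_ge (P : PrimeTwo K) {M : ℕ} (x : Fin M → 𝓞 K)
    [∀ i j, Decidable (x i - x j ∈ P.1.asIdeal)] :
    (M : ℝ) ^ 2 / P.q ≤ ∑ i, ∑ j, (if x i - x j ∈ P.1.asIdeal then (1 : ℝ) else 0) := by
  classical
  have : Fintype (𝓞 K ⧸ P.1.asIdeal) := Fintype.ofFinite _
  have hq : Fintype.card (𝓞 K ⧸ P.1.asIdeal) = P.q := by
    rw [← Nat.card_eq_fintype_card, P.card_quot]
  let m : Fin M → 𝓞 K ⧸ P.1.asIdeal := fun i => Ideal.Quotient.mk _ (x i)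
  have h1 : ∀ i j, (if x i - x j ∈ P.1.asIdeal then (1 : ℝ) else 0) =
      ∑ c, (if m i = c then (1 : ℝ) else 0) * (if m j = c then (1 : ℝ) else 0) := by
    intro i j
    simp only [← Ideal.Quotient.eq]
    simp [m, eq_comm]
  have h2 : ∑ i, ∑ j, (if x i - x j ∈ P.1.asIdeal then (1 : ℝ) else 0) =
      ∑ c, (∑ i, if m i = c then (1 : ℝ) else 0) ^ 2 := by
    simp_rw [h1, sq, Finset.sum_mul_sum]
    rw [Finset.sum_congr rfl fun i _ => Finset.sum_comm, Finset.sum_comm]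
  have h3 : ∑ c, (∑ i, if m i = c then (1 : ℝ) else 0) = M := by
    rw [Finset.sum_comm]
    simp
  rw [h2, ← h3]
  have h4 := sq_sum_le_card_mul_sum_sq (s := Finset.univ)
    (f := fun c => ∑ i, if m i = c then (1 : ℝ) else 0)
  rw [Finset.card_univ, hq] at h4
  rcases Nat.eq_zero_or_pos P.q with h0 | h0
  · rw [h0, Nat.cast_zero, div_zero]
    positivity
  · rw [div_le_iff₀ (by exact_mod_cast h0), mul_comm]
    exact h4

end OKLattice

namespace OKLattice

variable {K : Type} [Field K] [NumberField K]

lemma sum_primeTwo_le (h : TotallyReal K) {M : ℕ} (hM : 0 < M) :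
    ∑ P : PrimeTwo K, ((M : ℝ) ^ 2 / P.q - M) * Real.log P.q ≤
      M * (M - 1) * (Real.log M + Real.log |(discr K : ℝ)| / 2 -
        Module.finrank ℚ K * Real.log 4) +
      Module.finrank ℚ K * (2 * Real.log (M.factorial * 2 ^ M)) := by
  classical
  have hd : 0 < Module.finrank ℚ K := Module.finrank_pos
  set d := Module.finrank ℚ K with hd'
  have hD : 0 < |(discr K : ℝ)| := abs_pos.mpr (by exact_mod_cast discr_ne_zero K)
  have hMr : (0 : ℝ) < M := by exact_mod_cast hM
  have hdr : (0 : ℝ) < d := by exact_mod_cast hd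
  have hX : 0 < M * √|(discr K : ℝ)| := mul_pos hMr (Real.sqrt_pos.mpr hD)
  set L := (M * √|(discr K : ℝ)|) ^ ((d : ℝ)⁻¹) with hL
  have hLpos : 0 < L := Real.rpow_pos_of_pos hX _
  have hLd : L ^ d = M * √|(discr K : ℝ)| := Real.rpow_inv_natCast_pow hX.le hd.ne'
  have hlogL : d * Real.log L = Real.log M + Real.log |(discr K : ℝ)| / 2 := by
    rw [← Real.log_pow, hLd, Real.log_mul hMr.ne' (Real.sqrt_pos.mpr hD).ne', Real.log_sqrt hD.le]
  obtain ⟨x, y, hx, hxy⟩ := exists_points h hM hLpos hLd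
  have hσ : ∀ σ : K →+* ℝ, ∑ i, ∑ j, Real.log |σ (algebraMap (𝓞 K) K (x i - x j))| ≤
      M * (M - 1) * Real.log (L / 4) + 2 * Real.log (M.factorial * 2 ^ M) := by
    intro σ
    have := sum_log_sub_le (fun i => σ (algebraMap (𝓞 K) K (x i)))
      (fun i j hij => hx (RingOfIntegers.coe_injective (σ.injective hij))) (y σ) (L / 4)
      (by positivity) (fun i => by
        have := hxy i σ
        linarith)
    simpa only [map_sub] using this
  have hsum : ∑ σ : K →+* ℝ, ∑ i, ∑ j, Real.log |σ (algebraMap (𝓞 K) K (x i - x j))| ≤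
      d * (M * (M - 1) * Real.log (L / 4) + 2 * Real.log (M.factorial * 2 ^ M)) := by
    refine (Finset.sum_le_sum fun σ _ => hσ σ).trans ?_
    rw [Finset.sum_const, Finset.card_univ, h.card_emb, nsmul_eq_mul]
  have hpair : ∀ i j, ∑ P : PrimeTwo K, ((if x i - x j ∈ P.1.asIdeal then (1 : ℝ) else 0) -
      if i = j then 1 else 0) * Real.log P.q ≤
      ∑ σ : K →+* ℝ, Real.log |σ (algebraMap (𝓞 K) K (x i - x j))| := by
    intro i j
    by_cases hij : i = j
    · subst hij
      simp
    · have := sum_log_q_le h (x := x i - x j) (sub_ne_zero.mpr fun h' => hij (hx h'))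
      simpa [hij] using this
  have hswap : ∑ i, ∑ j, ∑ P : PrimeTwo K, ((if x i - x j ∈ P.1.asIdeal then (1 : ℝ) else 0) -
      if i = j then 1 else 0) * Real.log P.q =
      ∑ P : PrimeTwo K, (∑ i, ∑ j, (if x i - x j ∈ P.1.asIdeal then (1 : ℝ) else 0) - M) *
        Real.log P.q := by
    rw [Finset.sum_congr rfl fun i _ => Finset.sum_comm, Finset.sum_comm]
    refine Finset.sum_congr rfl fun P _ => ?_
    simp_rw [← Finset.sum_mul, Finset.sum_sub_distrib]
    simp
  have hswap2 : ∑ i, ∑ j, ∑ σ : K →+* ℝ, Real.log |σ (algebraMap (𝓞 K) K (x i - x j))| =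
      ∑ σ : K →+* ℝ, ∑ i, ∑ j, Real.log |σ (algebraMap (𝓞 K) K (x i - x j))| := by
    rw [Finset.sum_congr rfl fun i _ => Finset.sum_comm, Finset.sum_comm]
  have h1 : ∑ P : PrimeTwo K, ((M : ℝ) ^ 2 / P.q - M) * Real.log P.q ≤
      ∑ P : PrimeTwo K, (∑ i, ∑ j, (if x i - x j ∈ P.1.asIdeal then (1 : ℝ) else 0) - M) *
        Real.log P.q := by
    refine Finset.sum_le_sum fun P _ => mul_le_mul_of_nonneg_right ?_ (Real.log_natCast_nonneg _)
    exact sub_le_sub_right (card_congr_pairs_ge P x) _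
  have h2 := Finset.sum_le_sum fun i (_ : i ∈ Finset.univ) =>
    Finset.sum_le_sum fun j (_ : j ∈ Finset.univ) => hpair i j
  rw [hswap, hswap2] at h2
  refine (h1.trans (h2.trans hsum)).trans (le_of_eq ?_)
  rw [Real.log_div hLpos.ne' four_ne_zero, ← hlogL]
  ring

end OKLattice

namespace OKLattice
open IsDedekindDomain Real

variable {K : Type} [Field K] [NumberField K]

lemma log_factor_le {f : ℕ} (hf : 0 < f) :
    log 2 - log (1 - 1 / ((2 ^ f : ℕ) : ℝ)) ≤
      f * log (3 / 2) + 3 / ((2 ^ f : ℕ) : ℝ) * (f * log 2) := by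
  have hl : 0 < log 2 := log_pos one_lt_two
  have hk : 0 < log (3 / 2) := log_pos (by norm_num)
  have hk2 : 2 * log (3 / 2) = log (9 / 4) := by
    rw [← Nat.cast_ofNat (R := ℝ) (n := 2), ← log_pow]; norm_num
  have hk3 : 3 * log (3 / 2) = log (27 / 8) := by
    rw [← Nat.cast_ofNat (R := ℝ) (n := 3), ← log_pow]; norm_num
  obtain rfl | rfl | h3 : f = 1 ∨ f = 2 ∨ 3 ≤ f := by lia
  · have h1 : log (1 - 1 / ((2 ^ 1 : ℕ) : ℝ)) = - log 2 := by
      rw [← log_inv]; norm_num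
    have h2 : log 2 ≤ log (9 / 4) := log_le_log two_pos (by norm_num)
    rw [h1]
    push_cast
    linarith
  · have h1 : log (1 - 1 / ((2 ^ 2 : ℕ) : ℝ)) = - log (4 / 3) := by
      rw [← log_inv]; norm_num
    have h2 : log (4 / 3) ≤ log (9 / 4) := log_le_log (by norm_num) (by norm_num)
    rw [h1]
    push_cast
    linarith
  · have hq : (8 : ℝ) ≤ ((2 ^ f : ℕ) : ℝ) := by
      have : 2 ^ 3 ≤ 2 ^ f := Nat.pow_le_pow_right two_pos h3
      exact_mod_cast this
    have h1 : log (7 / 8) ≤ log (1 - 1 / ((2 ^ f : ℕ) : ℝ)) := by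
      refine log_le_log (by norm_num) ?_
      have : 1 / ((2 ^ f : ℕ) : ℝ) ≤ 1 / 8 := one_div_le_one_div_of_le (by norm_num) hq
      linarith
    have h2 : log 2 - log (7 / 8) ≤ log (27 / 8) := by
      rw [← log_div two_ne_zero (by norm_num)]
      exact log_le_log (by norm_num) (by norm_num)
    have h4 : 3 * log (3 / 2) ≤ f * log (3 / 2) :=
      mul_le_mul_of_nonneg_right (by exact_mod_cast h3) hk.le
    have h5 : 0 ≤ 3 / ((2 ^ f : ℕ) : ℝ) * (f * log 2) := by positivity
    linarith

lemma log_six_pi_sq_le : 10 * log (6 * π ^ 2) ≤ 59 * log 2 := by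
  have h1 : 10 * log (6 * π ^ 2) = log ((6 * π ^ 2) ^ 10) := by rw [log_pow]; norm_num
  have h2 : 59 * log 2 = log (2 ^ 59) := by rw [log_pow]; norm_num
  rw [h1, h2]
  refine log_le_log (by positivity) ?_
  have h3 : 6 * π ^ 2 ≤ 59.6 := by
    have := pi_lt_d2
    have := pi_pos
    nlinarith
  calc (6 * π ^ 2) ^ 10 ≤ 59.6 ^ 10 := pow_le_pow_left₀ (by positivity) h3 _
    _ ≤ 2 ^ 59 := by norm_num

lemma log_discr_le (h : TotallyReal K) (L : OKLattice K)
    (hL : ∀ T : OKLattice K, T.rank ≤ 3 → L.Represents T) :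
    3 / 2 * log |(discr K : ℝ)| ≤ Module.finrank (𝓞 K) L.carrier * log 4 +
      ∑ P : PrimeTwo K, (log 2 - log (1 - 1 / (P.q : ℝ))) +
      Module.finrank ℚ K * log (4 * π ^ 2) := by
  have h1 := discr_ineq_of_universal h L hL
  have hD : 0 < |(discr K : ℝ)| := abs_pos.mpr (by exact_mod_cast discr_ne_zero K)
  have hs : 0 < √|(discr K : ℝ)| := sqrt_pos.mpr hD
  have hP : ∀ P : PrimeTwo K, 0 < 1 - 1 / (P.q : ℝ) := fun P => by
    have h2 : (2 : ℝ) ≤ P.q := by exact_mod_cast P.two_le_q h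
    have : 1 / (P.q : ℝ) ≤ 1 / 2 := one_div_le_one_div_of_le two_pos h2
    linarith
  have hprod : 0 < ∏ P : PrimeTwo K, (1 - 1 / (P.q : ℝ)) := Finset.prod_pos fun P _ => hP P
  rw [card_units_two h] at h1
  have h2 := log_le_log (by positivity) h1
  push_cast at h2
  rw [log_div (by positivity) (by positivity), log_mul (by positivity) hprod.ne',
    log_mul (by positivity) hs.ne', log_mul (by positivity) (by positivity),
    log_mul (by positivity) (by positivity), log_div (by positivity) (by positivity),
    log_pow, log_pow, log_pow, log_pow, log_pow, log_pow, log_sqrt hD.le,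
    log_prod (fun P _ => (hP P).ne'), Nat.card_eq_fintype_card] at h2
  have h4 : log (4 : ℝ) = 2 * log 2 := by
    rw [show (4 : ℝ) = 2 ^ 2 by norm_num, log_pow]; norm_num
  have h5 : log (4 * π ^ 2) = log 2 + log (2 * π ^ 2) := by
    rw [← log_mul two_ne_zero (by positivity)]; ring_nf
  rw [Finset.sum_sub_distrib, Finset.sum_const, Finset.card_univ, nsmul_eq_mul, h5]
  rw [h4] at h2 ⊢
  push_cast at h2
  linarith

lemma discr_le (h : TotallyReal K) (L : OKLattice K)
    (hL : ∀ T : OKLattice K, T.rank ≤ 3 → L.Represents T) {R : ℕ}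
    (hR : Module.finrank (𝓞 K) L.carrier ≤ R) :
    |discr K| ≤ 2 ^ (2 * R + 8 * (40 * R + 1020)) := by
  have hl : 0 < log 2 := log_pos one_lt_two
  have h4 : log (4 : ℝ) = 2 * log 2 := by
    rw [show (4 : ℝ) = 2 ^ 2 by norm_num, log_pow]; norm_num
  have hD : 0 < |(discr K : ℝ)| := abs_pos.mpr (by exact_mod_cast discr_ne_zero K)
  have hstar := log_discr_le h L hL
  set d := Module.finrank ℚ K with hd
  set x := log |(discr K : ℝ)| with hx
  have hstar' : 3 / 2 * x ≤ R * (2 * log 2) +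
      ∑ P : PrimeTwo K, (log 2 - log (1 - 1 / (P.q : ℝ))) + d * log (4 * π ^ 2) := by
    have : (Module.finrank (𝓞 K) L.carrier : ℝ) * log 4 ≤ R * (2 * log 2) := by
      rw [h4]
      exact mul_le_mul_of_nonneg_right (by exact_mod_cast hR) (by positivity)
    linarith
  choose f hf hq using fun P : PrimeTwo K => P.exists_q_eq h
  have hfsum : ((∑ P, f P : ℕ) : ℝ) ≤ d := by
    have h1 := prod_q_le h
    simp_rw [hq] at h1
    rw [Finset.prod_pow_eq_pow_sum] at h1
    exact_mod_cast (Nat.pow_le_pow_iff_right one_lt_two).mp h1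
  rw [Nat.cast_sum] at hfsum
  have hlogq : ∀ P : PrimeTwo K, log (P.q : ℝ) = f P * log 2 := fun P => by
    rw [hq, Nat.cast_pow, log_pow, Nat.cast_ofNat]
  have hq2 : ∀ P : PrimeTwo K, (2 : ℝ) ≤ P.q := fun P => by exact_mod_cast P.two_le_q h
  have hd0 : (0 : ℝ) ≤ d := by positivity
  -- the degree bound
  have hdeg : (d : ℝ) ≤ 40 * R + 1020 := by
    obtain ⟨M, hM⟩ : ∃ M : ℕ, M = 2 ^ 16 + 1 := ⟨_, rfl⟩
    have hM0 : 0 < M := by omega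
    have hMr : (M : ℝ) = 65537 := by rw [hM]; norm_num
    have hV := sum_primeTwo_le h (M := M) hM0
    have hfac : log ((M.factorial : ℝ) * 2 ^ M) ≤ M * (18 * log 2) := by
      have h1 : ((M.factorial : ℝ) * 2 ^ M) ≤ ((2 : ℝ) ^ 18) ^ M := by
        have h2 : ((M.factorial : ℕ) : ℝ) ≤ ((2 : ℝ) ^ 17) ^ M := by
          have h3 : M.factorial ≤ (2 ^ 17) ^ M :=
            (Nat.factorial_le_pow _).trans (Nat.pow_le_pow_left (by omega) _)
          exact_mod_cast h3
        calc _ ≤ ((2 : ℝ) ^ 17) ^ M * 2 ^ M := mul_le_mul_of_nonneg_right h2 (by positivity)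
          _ = _ := by rw [← mul_pow, ← pow_succ]
      have h2 := log_le_log (by positivity) h1
      rw [log_pow, log_pow] at h2
      exact_mod_cast h2
    have hlogM : log (M : ℝ) ≤ 17 * log 2 := by
      have h1 : log (M : ℝ) ≤ log (2 ^ 17) :=
        log_le_log (by positivity) (by rw [hMr]; norm_num)
      rw [log_pow] at h1
      exact_mod_cast h1
    set A := ∑ P : PrimeTwo K, 3 / (P.q : ℝ) * (f P * log 2) with hA
    have hA0 : 0 ≤ A := Finset.sum_nonneg fun P _ => by positivity
    have hk : 0 < log (3 / 2) := log_pos (by norm_num)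
    have hsum : ∑ P : PrimeTwo K, (log 2 - log (1 - 1 / (P.q : ℝ))) ≤ d * log (3 / 2) + A := by
      refine (Finset.sum_le_sum (g := fun P => (f P : ℝ) * log (3 / 2) +
        3 / (P.q : ℝ) * (f P * log 2)) fun P _ => ?_).trans ?_
      · rw [hq]
        exact log_factor_le (hf P)
      · rw [Finset.sum_add_distrib, ← Finset.sum_mul]
        exact add_le_add_left (mul_le_mul_of_nonneg_right hfsum hk.le) _
    have hVsum : ∀ m : ℝ, ∑ P : PrimeTwo K, (m ^ 2 / P.q - m) * log P.q =
        m ^ 2 / 3 * A - m * (log 2 * ∑ P, (f P : ℝ)) := by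
      intro m
      rw [hA, Finset.mul_sum, Finset.mul_sum, Finset.mul_sum, ← Finset.sum_sub_distrib]
      refine Finset.sum_congr rfl fun P _ => ?_
      rw [hlogq]
      ring
    rw [hVsum, h4] at hV
    rw [← hd, ← hx] at hV
    clear_value x d
    generalize log ((M.factorial : ℝ) * 2 ^ M) = Lf at hV hfac
    generalize log (M : ℝ) = lM at hV hlogM
    rw [hMr] at hV hfac
    have hfsum' := mul_le_mul_of_nonneg_left hfsum hl.le
    have hfac' := mul_le_mul_of_nonneg_left hfac hd0
    have hlp : log (4 * π ^ 2) + log (3 / 2) ≤ 59 / 10 * log 2 := by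
      have h1 := log_six_pi_sq_le
      rw [← log_mul (by positivity) (by positivity),
        show 4 * π ^ 2 * (3 / 2) = 6 * π ^ 2 by ring]
      linarith
    have hlp' := mul_le_mul_of_nonneg_left hlp hd0
    have hfin : (d : ℝ) * log 2 * (1 / 20) ≤ (2 * R + 51) * log 2 := by
      have hdl : 0 ≤ d * log 2 := by positivity
      linarith
    have := le_of_mul_le_mul_right (a := log 2) (b := (d : ℝ) * (1 / 20)) (c := 2 * R + 51)
      (by linarith) hl
    linarith
  have hg : ∑ P : PrimeTwo K, (log 2 - log (1 - 1 / (P.q : ℝ))) ≤ d * (2 * log 2) := by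
    refine le_trans (Finset.sum_le_sum (g := fun P => (f P : ℝ) * (2 * log 2)) fun P _ => ?_) ?_
    · have h1 : log (1 / 2) ≤ log (1 - 1 / (P.q : ℝ)) := by
        refine log_le_log (by norm_num) ?_
        have : 1 / (P.q : ℝ) ≤ 1 / 2 := one_div_le_one_div_of_le two_pos (hq2 P)
        linarith
      rw [one_div, log_inv] at h1
      have h2 : (1 : ℝ) ≤ f P := by exact_mod_cast hf P
      nlinarith
    · rw [← Finset.sum_mul]
      exact mul_le_mul_of_nonneg_right hfsum (by positivity)
  have hpi : log (4 * π ^ 2) ≤ 6 * log 2 := by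
    have h1 : log (4 * π ^ 2) ≤ log (6 * π ^ 2) :=
      log_le_log (by positivity) (by have := sq_nonneg π; linarith)
    have := log_six_pi_sq_le
    linarith
  have hx2 : x ≤ (2 * R + 8 * (40 * R + 1020) : ℕ) * log 2 := by
    push_cast
    have h1 := mul_le_mul_of_nonneg_left hpi hd0
    have h2 := mul_le_mul_of_nonneg_right hdeg hl.le
    have h3 : (0 : ℝ) ≤ R * log 2 := by positivity
    nlinarith
  rw [← log_pow, hx] at hx2
  have := (log_le_log_iff hD (by positivity)).mp hx2
  exact_mod_cast this

end OKLattice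

theorem stmt7 (C : ℝ) (hC : 0 < C) (n : ℕ) (hn : 3 ≤ n) :
    {K : Subfield ℝ |
      FiniteDimensional ℚ K ∧ TotallyReal K ∧
        ∃ (k : ℕ) (S : Fin k → OKLattice K),
          (k : ℝ) < C ∧ (∀ i, (S i).rank = n) ∧
            ∀ L : OKLattice K, L.IsUniversal n ↔ ∀ i, L.Represents (S i)}.Finite := by
  let R := ⌈C⌉₊ * n
  refine ((NumberField.finite_of_discr_bdd ℝ
    (2 ^ (2 * R + 8 * (40 * R + 1020)))).image fun F => F.1.toSubfield).subset ?_
  rintro K ⟨hfd, h, k, S, hk, hr, hS⟩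
  have : NumberField K := ⟨⟩
  obtain ⟨L, hL, hrep⟩ := OKLattice.exists_universal S hr hS
  have hR : Module.finrank (𝓞 K) L.carrier ≤ R := by
    rw [hL]
    exact Nat.mul_le_mul_right _ (by exact_mod_cast hk.le.trans (Nat.le_ceil C))
  have hd := OKLattice.discr_le h L (fun T hT => hrep T (hT.trans hn)) hR
  let F : IntermediateField ℚ ℝ :=
    { K with algebraMap_mem' := fun q => by simp }
  refine ⟨⟨F, ?_⟩, ?_, rfl⟩
  · exact hfd
  · exact_mod_cast hd
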